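/- arXiv:2201.13088 — 15 statements merged into one kernel-verified Lean document; each statement's English description precedes it below -/
import Mathlib

section
/- Let U and W be two-dimensional subspaces of V with I(U) = U and I(W) = W. Then there exists an Sp(n)-transformation g of V with g(U) = W. (In other words, all 2-dimensional I-complex subspaces of V form a single Sp(n)-orbit in the real Grassmannian of 2-planes.) -/
open RealInnerProductSpace Module Submodule

/-- A two-dimensional `I`-invariant subspace is spanned by `u, I u` for a unit vector `u`. -/
lemma exists_unit_span {V : Type*} [NormedAddCommGroup V] [InnerProductSpace ℝ V]
    [FiniteDimensional ℝ V] (I : V →ₗ[ℝ] V)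
    (hII : ∀ x, I (I x) = -x) (hIsk : ∀ x y, ⟪I x, y⟫ = -⟪x, I y⟫)
    (U : Submodule ℝ V) (hU2 : finrank ℝ U = 2) (hUI : U.map I = U) :
    ∃ u : V, ⟪u, u⟫ = (1 : ℝ) ∧ U = span ℝ {u, I u} := by
  have hne : U ≠ ⊥ := by
    rintro rfl
    simp at hU2
  obtain ⟨x, hxU, hx0⟩ := U.exists_mem_ne_zero_of_ne_bot hne
  have hn : ‖x‖ ≠ 0 := norm_ne_zero_iff.mpr hx0
  obtain ⟨u, hu⟩ : ∃ u : V, u = (‖x‖⁻¹ : ℝ) • x := ⟨_, rfl⟩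
  have huU : u ∈ U := hu ▸ U.smul_mem _ hxU
  have huu : ⟪u, u⟫ = (1 : ℝ) := by
    rw [hu, real_inner_smul_left, real_inner_smul_right, real_inner_self_eq_norm_sq]
    field_simp
  have hIu : I u ∈ U := by
    rw [← hUI]
    exact Submodule.mem_map_of_mem huU
  have h0 : ⟪u, I u⟫ = (0 : ℝ) := by
    have := hIsk u u
    rw [real_inner_comm] at this
    linarith
  have h1 : ⟪I u, I u⟫ = (1 : ℝ) := by
    rw [hIsk, hII, inner_neg_right, huu, neg_neg]
  refine ⟨u, huu, ?_⟩
  have hli : LinearIndependent ℝ ![u, I u] := by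
    rw [LinearIndependent.pair_iff]
    intro s t hst
    have e1 : ⟪u, s • u + t • I u⟫ = (0 : ℝ) := by rw [hst, inner_zero_right]
    have e2 : ⟪I u, s • u + t • I u⟫ = (0 : ℝ) := by rw [hst, inner_zero_right]
    rw [inner_add_right, real_inner_smul_right, real_inner_smul_right] at e1 e2
    rw [huu, h0] at e1
    rw [real_inner_comm] at h0
    rw [h0, h1] at e2
    constructor <;> linarith
  have hle : span ℝ {u, I u} ≤ U := by
    rw [span_le]
    rintro y (rfl | rfl)
    · exact huU
    · exact hIu
  have hf := finrank_span_eq_card hli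
  have hr : Set.range ![u, I u] = {u, I u} := by simp [Set.pair_comm]
  rw [hr] at hf
  exact (Submodule.eq_of_le_of_finrank_eq hle (by rw [hf, hU2]; simp)).symm

/-- The quaternionic rank-one map `x ↦ h(x,v) y`. -/
noncomputable def rankOne {V : Type*} [NormedAddCommGroup V] [InnerProductSpace ℝ V]
    (I J K : V →ₗ[ℝ] V) (v y : V) : V →ₗ[ℝ] V :=
  (innerₗ V v).smulRight y + (innerₗ V (I v)).smulRight (I y)
    + (innerₗ V (J v)).smulRight (J y) + (innerₗ V (K v)).smulRight (K y)

lemma rankOne_apply {V : Type*} [NormedAddCommGroup V] [InnerProductSpace ℝ V]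
    (I J K : V →ₗ[ℝ] V) (v y x : V) : rankOne I J K v y x =
    (⟪v, x⟫ : ℝ) • y + (⟪I v, x⟫ : ℝ) • I y + (⟪J v, x⟫ : ℝ) • J y + (⟪K v, x⟫ : ℝ) • K y := by
  simp [rankOne]

/-- Transitivity of `Sp(n)` on unit vectors, by a quaternionic reflection. -/
lemma exists_sp_map {V : Type*} [NormedAddCommGroup V] [InnerProductSpace ℝ V]
    [FiniteDimensional ℝ V]
    (I J K : V →ₗ[ℝ] V)
    (hII : ∀ x, I (I x) = -x) (hJJ : ∀ x, J (J x) = -x) (hKK : ∀ x, K (K x) = -x)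
    (hIJ : ∀ x, I (J x) = K x) (hJI : ∀ x, J (I x) = -K x)
    (hIsk : ∀ x y, ⟪I x, y⟫ = -⟪x, I y⟫)
    (hJsk : ∀ x y, ⟪J x, y⟫ = -⟪x, J y⟫)
    (hKsk : ∀ x y, ⟪K x, y⟫ = -⟪x, K y⟫)
    (u w : V) (hu : ⟪u, u⟫ = (1 : ℝ)) (hw : ⟪w, w⟫ = (1 : ℝ)) :
    ∃ g : V ≃ₗᵢ[ℝ] V, (∀ x, g (I x) = I (g x)) ∧ (∀ x, g (J x) = J (g x)) ∧
      (∀ x, g (K x) = K (g x)) ∧ g u = w := by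
  by_cases huw : u = w
  · exact ⟨LinearIsometryEquiv.refl ℝ V, by simp, by simp, by simp, by simpa using huw⟩
  have hIK : ∀ x, I (K x) = -J x := fun x => by rw [← hIJ, hII]
  have hKJ : ∀ x, K (J x) = -I x := fun x => by rw [← hIJ, hJJ, map_neg]
  have hJK : ∀ x, J (K x) = I x := fun x => by rw [← hIJ, hJI, hKJ, neg_neg]
  have hKI : ∀ x, K (I x) = J x := fun x => by rw [← hIJ, hJI, map_neg, hIK, neg_neg]
  obtain ⟨v, hv⟩ : ∃ v, v = u - w := ⟨_, rfl⟩
  have hv0 : v ≠ 0 := by rw [hv]; exact sub_ne_zero.mpr huw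
  have hvpos : (0 : ℝ) < ⟪v, v⟫ := real_inner_self_pos.mpr hv0
  obtain ⟨a, ha⟩ : ∃ a : ℝ, a = ⟪v, u⟫ := ⟨_, rfl⟩
  obtain ⟨b, hb⟩ : ∃ b : ℝ, b = ⟪I v, u⟫ := ⟨_, rfl⟩
  obtain ⟨c, hc⟩ : ∃ c : ℝ, c = ⟪J v, u⟫ := ⟨_, rfl⟩
  obtain ⟨d, hd⟩ : ∃ d : ℝ, d = ⟪K v, u⟫ := ⟨_, rfl⟩
  have h2a : ⟪v, v⟫ = 2 * a := by
    rw [ha, hv]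
    simp only [inner_sub_left, inner_sub_right, hu, hw, real_inner_comm u w]
    ring
  have hapos : 0 < a := by linarith
  obtain ⟨N, hN⟩ : ∃ N : ℝ, N = a ^ 2 + b ^ 2 + c ^ 2 + d ^ 2 := ⟨_, rfl⟩
  have hNpos : 0 < N := by rw [hN]; positivity
  obtain ⟨y, hy⟩ : ∃ y : V, y = N⁻¹ • (a • v - b • I v - c • J v - d • K v) := ⟨_, rfl⟩
  have hIy : I y = N⁻¹ • (a • I v + b • v - c • K v + d • J v) := by
    rw [hy]; simp only [map_smul, map_sub, hII, hIJ, hIK]; module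
  have hJy : J y = N⁻¹ • (a • J v + b • K v + c • v - d • I v) := by
    rw [hy]; simp only [map_smul, map_sub, hJI, hJJ, hJK]; module
  have hKy : K y = N⁻¹ • (a • K v - b • J v + c • I v + d • v) := by
    rw [hy]; simp only [map_smul, map_sub, hKI, hKJ, hKK]; module
  -- orthogonality relations
  have oI : ∀ z, ⟪z, I z⟫ = (0 : ℝ) := fun z => by
    have := hIsk z z; rw [real_inner_comm] at this; linarith
  have oJ : ∀ z, ⟪z, J z⟫ = (0 : ℝ) := fun z => by
    have := hJsk z z; rw [real_inner_comm] at this; linarith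
  have oK : ∀ z, ⟪z, K z⟫ = (0 : ℝ) := fun z => by
    have := hKsk z z; rw [real_inner_comm] at this; linarith
  have key : ∀ (z : V) (p q r s : ℝ),
      ⟪p • z + q • I z + r • J z + s • K z, p • z + q • I z + r • J z + s • K z⟫
        = (p ^ 2 + q ^ 2 + r ^ 2 + s ^ 2) * ⟪z, z⟫ := by
    intro z p q r s
    simp only [inner_add_left, inner_add_right, real_inner_smul_left, real_inner_smul_right,
      hIsk, hJsk, hKsk, hII, hJJ, hKK, hIJ, hJI, hIK, hKI, hJK, hKJ, inner_neg_right, oI, oJ, oK]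
    ring
  have hyy : ⟪y, y⟫ = 2 * a / N := by
    have e : y = (N⁻¹ * a) • v + (-(N⁻¹ * b)) • I v + (-(N⁻¹ * c)) • J v
        + (-(N⁻¹ * d)) • K v := by rw [hy]; module
    have := key v (N⁻¹ * a) (-(N⁻¹ * b)) (-(N⁻¹ * c)) (-(N⁻¹ * d))
    rw [← e, h2a] at this
    rw [this]
    have : (N⁻¹ * a) ^ 2 + (-(N⁻¹ * b)) ^ 2 + (-(N⁻¹ * c)) ^ 2 + (-(N⁻¹ * d)) ^ 2
      = N⁻¹ ^ 2 * N := by rw [hN]; ring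
    rw [this]
    field_simp
  have hiso : ∀ x, ⟪x - rankOne I J K v y x, x - rankOne I J K v y x⟫ = (⟪x, x⟫ : ℝ) := by
    intro x
    have h1 : ⟪rankOne I J K v y x, rankOne I J K v y x⟫ = ((⟪v, x⟫ : ℝ) ^ 2 + ⟪I v, x⟫ ^ 2
        + ⟪J v, x⟫ ^ 2 + ⟪K v, x⟫ ^ 2) * (2 * a / N) := by
      rw [rankOne_apply, key, hyy]
    have h2 : ⟪rankOne I J K v y x, x⟫ = ((⟪v, x⟫ : ℝ) ^ 2 + ⟪I v, x⟫ ^ 2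
        + ⟪J v, x⟫ ^ 2 + ⟪K v, x⟫ ^ 2) * (a / N) := by
      rw [rankOne_apply, hIy, hJy, hKy, hy]
      simp only [inner_add_left, inner_sub_left, real_inner_smul_left]
      ring
    rw [inner_sub_left, inner_sub_right, inner_sub_right,
      real_inner_comm (rankOne I J K v y x) x, h1, h2]
    ring
  let L : V →ₗ[ℝ] V := LinearMap.id - rankOne I J K v y
  have hL : ∀ x, L x = x - rankOne I J K v y x := fun x => rfl
  have hLn : ∀ x, ‖L x‖ = ‖x‖ := by
    intro x
    have := hiso x
    rw [← hL, real_inner_self_eq_norm_sq, real_inner_self_eq_norm_sq] at this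
    exact (pow_left_inj₀ (norm_nonneg _) (norm_nonneg _) two_ne_zero).mp this
  let g : V ≃ₗᵢ[ℝ] V := LinearIsometry.toLinearIsometryEquiv ⟨L, hLn⟩ rfl
  have hg : ∀ x, g x = x - rankOne I J K v y x := fun x => rfl
  refine ⟨g, fun x => ?_, fun x => ?_, fun x => ?_, ?_⟩
  · rw [hg, hg, rankOne_apply, rankOne_apply]
    simp only [map_sub, map_add, map_smul, hIsk, hJsk, hKsk, hII, hIJ, hIK, hJI, hKI,
      inner_neg_right]
    module
  · rw [hg, hg, rankOne_apply, rankOne_apply]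
    simp only [map_sub, map_add, map_smul, hIsk, hJsk, hKsk, hJJ, hIJ, hJK, hJI, hKJ,
      inner_neg_right]
    module
  · rw [hg, hg, rankOne_apply, rankOne_apply]
    simp only [map_sub, map_add, map_smul, hIsk, hJsk, hKsk, hKK, hIK, hJK, hKI, hKJ,
      inner_neg_right]
    module
  · have e : rankOne I J K v y u = v := by
      rw [rankOne_apply, ← ha, ← hb, ← hc, ← hd, hIy, hJy, hKy, hy]
      have : (N⁻¹ * (a ^ 2 + b ^ 2 + c ^ 2 + d ^ 2)) • v = v := by
        rw [← hN, inv_mul_cancel₀ hNpos.ne', one_smul]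
      refine Eq.trans ?_ this
      module
    rw [hg, e, hv, sub_sub_cancel]

/-- All 2-dimensional `I`-complex subspaces of a Hermitian hypercomplex vector space
form a single `Sp(n)`-orbit in the real Grassmannian of 2-planes. -/
theorem stmt_0 {V : Type*} [NormedAddCommGroup V] [InnerProductSpace ℝ V]
    [FiniteDimensional ℝ V]
    (I J K : V →ₗ[ℝ] V)
    (hII : ∀ x, I (I x) = -x) (hJJ : ∀ x, J (J x) = -x) (hKK : ∀ x, K (K x) = -x)
    (hIJ : ∀ x, I (J x) = K x) (hJI : ∀ x, J (I x) = -K x)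
    (hIsk : ∀ x y, ⟪I x, y⟫ = -⟪x, I y⟫)
    (hJsk : ∀ x y, ⟪J x, y⟫ = -⟪x, J y⟫)
    (hKsk : ∀ x y, ⟪K x, y⟫ = -⟪x, K y⟫)
    (U W : Submodule ℝ V)
    (hU2 : finrank ℝ U = 2) (hW2 : finrank ℝ W = 2)
    (hUI : U.map I = U) (hWI : W.map I = W) :
    ∃ g : V ≃ₗᵢ[ℝ] V, (∀ x, g (I x) = I (g x)) ∧ (∀ x, g (J x) = J (g x)) ∧
      (∀ x, g (K x) = K (g x)) ∧ U.map (g.toLinearEquiv : V →ₗ[ℝ] V) = W := by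
  obtain ⟨u, hu, rfl⟩ := exists_unit_span I hII hIsk U hU2 hUI
  obtain ⟨w, hw, rfl⟩ := exists_unit_span I hII hIsk W hW2 hWI
  obtain ⟨g, h1, h2, h3, h4⟩ :=
    exists_sp_map I J K hII hJJ hKK hIJ hJI hIsk hJsk hKsk u w hu hw
  refine ⟨g, h1, h2, h3, ?_⟩
  rw [Submodule.map_span, Set.image_pair]
  have e1 : (g.toLinearEquiv : V →ₗ[ℝ] V) u = w := h4
  have e2 : (g.toLinearEquiv : V →ₗ[ℝ] V) (I u) = I w := (h1 u).trans (by rw [h4])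
  rw [e1, e2]
end

section
/- Let U and W be 4-dimensional subspaces of V with I(U) = U and I(W) = W. Then there exists an Sp(n)-transformation g of V with g(U) = W if and only if ⟪X, J Y⟫² + ⟪X, K Y⟫² = ⟪X', J Y'⟫² + ⟪X', K Y'⟫² for every I-orthonormal pair (X, Y) of U and every I-orthonormal pair (X', Y') of W. (The pair (I, θ^{I⊥}) consisting of the complex structure I and the I⊥-Kähler angle θ^{I⊥}, with cos²θ^{I⊥} = ⟪X, J Y⟫² + ⟪X, K Y⟫², completely determines the Sp(n)-orbit of a 4-dimensional I-complex subspace.) -/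
open RealInnerProductSpace Module Submodule

set_option linter.unusedSimpArgs false

theorem aux_quat_norm {V : Type*} [NormedAddCommGroup V] [InnerProductSpace ℝ V]
    (I J K : V →ₗ[ℝ] V)
    (hII : ∀ x, I (I x) = -x) (hJJ : ∀ x, J (J x) = -x) (hKK : ∀ x, K (K x) = -x)
    (hIJ : ∀ x, I (J x) = K x) (hJI : ∀ x, J (I x) = -K x)
    (hIsk : ∀ x y, ⟪I x, y⟫ = -⟪x, I y⟫)
    (hJsk : ∀ x y, ⟪J x, y⟫ = -⟪x, J y⟫)
    (hKsk : ∀ x y, ⟪K x, y⟫ = -⟪x, K y⟫) (u : V) (a b c d : ℝ) :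
    ⟪a • u + b • I u + c • J u + d • K u, a • u + b • I u + c • J u + d • K u⟫
      = (a ^ 2 + b ^ 2 + c ^ 2 + d ^ 2) * ⟪u, u⟫ := by
  have hIK : ∀ x, I (K x) = -J x := fun x => by rw [← hIJ, hII]
  have hJK : ∀ x, J (K x) = I x := fun x => by rw [← hIJ, hJI, ← hIJ, hJJ]; simp
  have z : ∀ A : V →ₗ[ℝ] V, (∀ x y, ⟪A x, y⟫ = -⟪x, A y⟫) → ⟪u, A u⟫ = 0 := fun A h => by
    have := h u u
    rw [real_inner_comm] at this; linarith
  have z1 := z I hIsk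
  have z2 := z J hJsk
  have z3 := z K hKsk
  have hKI : ∀ x, K (I x) = J x := fun x => by rw [← hIJ, hJI, map_neg, hIK, neg_neg]
  have hKJ : ∀ x, K (J x) = -I x := fun x => by rw [← hIJ, hJJ, map_neg]
  simp only [inner_add_left, inner_add_right, real_inner_smul_left, real_inner_smul_right,
    hIsk, hJsk, hKsk, hII, hJJ, hKK, hIJ, hJI, hIK, hJK, hKI, hKJ, inner_neg_right, z1, z2, z3]
  ring

theorem aux_transvection {V : Type*} [NormedAddCommGroup V] [InnerProductSpace ℝ V]
    [FiniteDimensional ℝ V]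
    (I J K : V →ₗ[ℝ] V)
    (hII : ∀ x, I (I x) = -x) (hJJ : ∀ x, J (J x) = -x) (hKK : ∀ x, K (K x) = -x)
    (hIJ : ∀ x, I (J x) = K x) (hJI : ∀ x, J (I x) = -K x)
    (hIsk : ∀ x y, ⟪I x, y⟫ = -⟪x, I y⟫)
    (hJsk : ∀ x y, ⟪J x, y⟫ = -⟪x, J y⟫)
    (hKsk : ∀ x y, ⟪K x, y⟫ = -⟪x, K y⟫) (A B : V) (hAB : ‖A‖ = ‖B‖) :
    ∃ g : V ≃ₗᵢ[ℝ] V, (∀ x, g (I x) = I (g x)) ∧ (∀ x, g (J x) = J (g x)) ∧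
      (∀ x, g (K x) = K (g x)) ∧ g A = B ∧
      ∀ v, ⟪A - B, v⟫ = 0 → ⟪I (A - B), v⟫ = 0 → ⟪J (A - B), v⟫ = 0 →
        ⟪K (A - B), v⟫ = 0 → g v = v := by
  have hIK : ∀ x, I (K x) = -J x := fun x => by rw [← hIJ, hII]
  have hJK : ∀ x, J (K x) = I x := fun x => by rw [← hIJ, hJI, ← hIJ, hJJ]; simp
  have hKI : ∀ x, K (I x) = J x := fun x => by rw [← hIJ, hJI, map_neg, hIK, neg_neg]
  have hKJ : ∀ x, K (J x) = -I x := fun x => by rw [← hIJ, hJJ, map_neg]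
  by_cases hne : A = B
  · exact ⟨LinearIsometryEquiv.refl ℝ V, by simp [hne]⟩
  have hu0 : A - B ≠ 0 := sub_ne_zero.2 hne
  have hAu : 2 * ⟪A - B, A⟫ = ⟪A - B, A - B⟫ := by
    have h1 : ⟪A, A⟫ = ⟪B, B⟫ := by
      rw [real_inner_self_eq_norm_sq, real_inner_self_eq_norm_sq, hAB]
    simp only [inner_sub_left, inner_sub_right, real_inner_comm A B]
    linarith [real_inner_comm A B]
  have hBA : B = A - (A - B) := by abel
  generalize A - B = u at *
  subst hBA
  have hupos : 0 < ⟪u, u⟫ := real_inner_self_pos.2 hu0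
  set a0 := ⟪u, A⟫ with ha0
  set a1 := ⟪I u, A⟫ with ha1
  set a2 := ⟪J u, A⟫ with ha2
  set a3 := ⟪K u, A⟫ with ha3
  set N := a0 ^ 2 + a1 ^ 2 + a2 ^ 2 + a3 ^ 2 with hN
  have hNpos : 0 < N := by
    have : 0 < a0 := by linarith
    positivity
  obtain ⟨w, hw⟩ : ∃ w, w = (a0 / N) • u + (-a1 / N) • I u + (-a2 / N) • J u + (-a3 / N) • K u :=
    ⟨_, rfl⟩
  have hww : N * ⟪w, w⟫ = ⟪u, u⟫ := by
    rw [hw, aux_quat_norm I J K hII hJJ hKK hIJ hJI hIsk hJsk hKsk]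
    field_simp
    rw [hN]
  let P : V →ₗ[ℝ] V :=
    (innerₛₗ ℝ u).smulRight w + (innerₛₗ ℝ (I u)).smulRight (I w)
     + (innerₛₗ ℝ (J u)).smulRight (J w) + (innerₛₗ ℝ (K u)).smulRight (K w)
  have hP : ∀ v, P v = ⟪u, v⟫ • w + ⟪I u, v⟫ • I w + ⟪J u, v⟫ • J w + ⟪K u, v⟫ • K w := by
    intro v; simp [P]
  have hPI : ∀ v, P (I v) = I (P v) := by
    intro v
    simp only [hP, map_add, map_smul, hIsk, hJsk, hKsk, hII, hJI, hKI, hIJ, hIK, hJJ, hKK, hJK, hKJ,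
      inner_neg_right, neg_neg, neg_smul, smul_neg, map_neg]
    abel
  have hPJ : ∀ v, P (J v) = J (P v) := by
    intro v
    simp only [hP, map_add, map_smul, hIsk, hJsk, hKsk, hII, hJI, hKI, hIJ, hIK, hJJ, hKK, hJK, hKJ,
      inner_neg_right, neg_neg, neg_smul, smul_neg, map_neg]
    abel
  have hPK : ∀ v, P (K v) = K (P v) := by
    intro v
    rw [← hIJ, hPI, hPJ, hIJ]
  have hPA : P A = u := by
    rw [hP, ← ha0, ← ha1, ← ha2, ← ha3, hw]
    simp only [map_add, map_smul, hII, hJI, hKI, hIJ, hIK, hJJ, hKK, hJK, hKJ]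
    have h1 : (1 : ℝ) = (a0 ^ 2 + a1 ^ 2 + a2 ^ 2 + a3 ^ 2) / N := by
      rw [← hN]; field_simp
    conv_rhs => rw [← one_smul ℝ u, h1]
    module
  have hiso : ∀ v, ⟪P v, P v⟫ = 2 * ⟪v, P v⟫ := by
    intro v
    have e1 : ⟪P v, P v⟫ = (⟪u, v⟫ ^ 2 + ⟪I u, v⟫ ^ 2 + ⟪J u, v⟫ ^ 2 + ⟪K u, v⟫ ^ 2) * ⟪w, w⟫ := by
      rw [hP, aux_quat_norm I J K hII hJJ hKK hIJ hJI hIsk hJsk hKsk]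
    have e2 : ⟪v, P v⟫ = (⟪u, v⟫ ^ 2 + ⟪I u, v⟫ ^ 2 + ⟪J u, v⟫ ^ 2 + ⟪K u, v⟫ ^ 2) * (a0 / N) := by
      rw [hP, hw]
      simp only [map_add, map_smul, hII, hJI, hKI, hIJ, hIK, hJJ, hKK, hJK, hKJ, inner_add_right,
        real_inner_smul_right, inner_neg_right, real_inner_comm v]
      ring
    have e3 : ⟪w, w⟫ = 2 * (a0 / N) := by
      field_simp; linarith
    rw [e1, e2, e3]; ring
  let f : V →ₗᵢ[ℝ] V := ⟨LinearMap.id - P, by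
    intro v
    have : ‖v - P v‖ ^ 2 = ‖v‖ ^ 2 := by
      rw [norm_sub_sq_real, ← real_inner_self_eq_norm_sq (P v), hiso]; ring
    have h2 := (sq_eq_sq₀ (norm_nonneg _) (norm_nonneg _)).1 this
    simpa using h2⟩
  have hf : ∀ v, f.toLinearIsometryEquiv rfl v = v - P v := fun v => rfl
  refine ⟨f.toLinearIsometryEquiv rfl, ?_, ?_, ?_, ?_, ?_⟩
  · intro x; rw [hf, hf, hPI, map_sub]
  · intro x; rw [hf, hf, hPJ, map_sub]
  · intro x; rw [hf, hf, hPK, map_sub]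
  · rw [hf, hPA]
  · intro v h0 h1 h2 h3
    rw [hf, hP, h0, h1, h2, h3]; simp

theorem aux_span {V : Type*} [NormedAddCommGroup V] [InnerProductSpace ℝ V]
    [FiniteDimensional ℝ V] (I : V →ₗ[ℝ] V) (hII : ∀ x, I (I x) = -x)
    (hIsk : ∀ x y, ⟪I x, y⟫ = -⟪x, I y⟫)
    (U : Submodule ℝ V) (hU4 : finrank ℝ U = 4) (hUI : U.map I = U)
    (X Y : V) (hX : X ∈ U) (hY : Y ∈ U) (nX : ‖X‖ = 1) (nY : ‖Y‖ = 1) (hXY : ⟪X, Y⟫ = 0)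
    (hIXY : ⟪I X, Y⟫ = 0) : U = span ℝ (Set.range ![X, I X, Y, I Y]) := by
  have hIm : ∀ x ∈ U, I x ∈ U := fun x hx => by rw [← hUI]; exact mem_map_of_mem hx
  have z : ∀ u, ⟪u, I u⟫ = 0 := fun u => by
    have := hIsk u u
    rw [real_inner_comm] at this; linarith
  have xx : ⟪X, X⟫ = 1 := by rw [real_inner_self_eq_norm_sq, nX]; norm_num
  have yy : ⟪Y, Y⟫ = 1 := by rw [real_inner_self_eq_norm_sq, nY]; norm_num
  have hXIY : ⟪X, I Y⟫ = 0 := by have := hIsk X Y; linarith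
  have hYX : ⟪Y, X⟫ = 0 := by rw [real_inner_comm]; exact hXY
  have hYIX : ⟪Y, I X⟫ = 0 := by rw [real_inner_comm]; exact hIXY
  have nI : ∀ u : V, ‖I u‖ = ‖u‖ := fun u => by
    have : ‖I u‖ ^ 2 = ‖u‖ ^ 2 := by
      rw [← real_inner_self_eq_norm_sq, ← real_inner_self_eq_norm_sq, hIsk, hII, inner_neg_right,
        neg_neg]
    exact (sq_eq_sq₀ (norm_nonneg _) (norm_nonneg _)).1 this
  have ho : Orthonormal ℝ ![X, I X, Y, I Y] := by
    rw [orthonormal_iff_ite]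
    intro i j
    fin_cases i <;> fin_cases j <;>
      simp [hIsk, hII, z, hXY, hXIY, hYX, hYIX, nX, nY, nI]
  symm
  apply Submodule.eq_of_le_of_finrank_eq
  · rw [span_le]
    rintro _ ⟨i, rfl⟩
    fin_cases i <;> simp [hX, hY, hIm]
  · rw [finrank_span_eq_card ho.linearIndependent, hU4]; simp

theorem aux_exists {V : Type*} [NormedAddCommGroup V] [InnerProductSpace ℝ V]
    [FiniteDimensional ℝ V] (I : V →ₗ[ℝ] V)
    (U : Submodule ℝ V) (hU4 : finrank ℝ U = 4) :
    ∃ X ∈ U, ∃ Y ∈ U, ‖X‖ = 1 ∧ ‖Y‖ = 1 ∧ ⟪X, Y⟫ = 0 ∧ ⟪I X, Y⟫ = 0 := by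
  have key : ∀ a b : V, ∃ Y ∈ U, ‖Y‖ = 1 ∧ ⟪a, Y⟫ = 0 ∧ ⟪b, Y⟫ = 0 := by
    intro a b
    let L : U →ₗ[ℝ] ℝ × ℝ := ((innerₛₗ ℝ a).prod (innerₛₗ ℝ b)).comp U.subtype
    have hk : LinearMap.ker L ≠ ⊥ := LinearMap.ker_ne_bot_of_finrank_lt (by simp [hU4])
    obtain ⟨y, hy, hy0⟩ := Submodule.exists_mem_ne_zero_of_ne_bot hk
    have hy' : ⟪a, (y : V)⟫ = 0 ∧ ⟪b, (y : V)⟫ = 0 := by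
      simpa [L, Prod.ext_iff] using hy
    have hn : ‖(y : V)‖ ≠ 0 := by simpa using hy0
    refine ⟨‖(y : V)‖⁻¹ • (y : V), U.smul_mem _ y.2, ?_, ?_, ?_⟩
    · rw [norm_smul, norm_inv, norm_norm, inv_mul_cancel₀ hn]
    · rw [real_inner_smul_right, hy'.1, mul_zero]
    · rw [real_inner_smul_right, hy'.2, mul_zero]
  obtain ⟨X, hX, nX, -, -⟩ := key 0 0
  obtain ⟨Y, hY, nY, h1, h2⟩ := key X (I X)
  exact ⟨X, hX, Y, hY, nX, nY, h1, h2⟩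

theorem aux_indep {V : Type*} [NormedAddCommGroup V] [InnerProductSpace ℝ V]
    [FiniteDimensional ℝ V]
    (I J K : V →ₗ[ℝ] V)
    (hII : ∀ x, I (I x) = -x) (hJJ : ∀ x, J (J x) = -x) (hKK : ∀ x, K (K x) = -x)
    (hIJ : ∀ x, I (J x) = K x) (hJI : ∀ x, J (I x) = -K x)
    (hIsk : ∀ x y, ⟪I x, y⟫ = -⟪x, I y⟫)
    (hJsk : ∀ x y, ⟪J x, y⟫ = -⟪x, J y⟫)
    (hKsk : ∀ x y, ⟪K x, y⟫ = -⟪x, K y⟫)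
    (U : Submodule ℝ V) (hU4 : finrank ℝ U = 4) (hUI : U.map I = U)
    (X Y : V) (hX : X ∈ U) (hY : Y ∈ U) (nX : ‖X‖ = 1) (nY : ‖Y‖ = 1) (hXY : ⟪X, Y⟫ = 0)
    (hIXY : ⟪I X, Y⟫ = 0)
    (X' Y' : V) (hX' : X' ∈ U) (hY' : Y' ∈ U) (nX' : ‖X'‖ = 1) (nY' : ‖Y'‖ = 1)
    (hXY' : ⟪X', Y'⟫ = 0) (hIXY' : ⟪I X', Y'⟫ = 0) :
    ⟪X, J Y⟫ ^ 2 + ⟪X, K Y⟫ ^ 2 = ⟪X', J Y'⟫ ^ 2 + ⟪X', K Y'⟫ ^ 2 := by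
  have hIK : ∀ x, I (K x) = -J x := fun x => by rw [← hIJ, hII]
  have hJK : ∀ x, J (K x) = I x := fun x => by rw [← hIJ, hJI, ← hIJ, hJJ]; simp
  have hKI : ∀ x, K (I x) = J x := fun x => by rw [← hIJ, hJI, map_neg, hIK, neg_neg]
  have hKJ : ∀ x, K (J x) = -I x := fun x => by rw [← hIJ, hJJ, map_neg]
  have z : ∀ A : V →ₗ[ℝ] V, (∀ x y, ⟪A x, y⟫ = -⟪x, A y⟫) → ∀ u, ⟪u, A u⟫ = 0 := fun A h u => by
    have := h u u
    rw [real_inner_comm] at this; linarith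
  have z1 := z I hIsk
  have z2 := z J hJsk
  have z3 := z K hKsk
  have xx : ⟪X, X⟫ = 1 := by rw [real_inner_self_eq_norm_sq, nX]; norm_num
  have yy : ⟪Y, Y⟫ = 1 := by rw [real_inner_self_eq_norm_sq, nY]; norm_num
  have xx' : ⟪X', X'⟫ = 1 := by rw [real_inner_self_eq_norm_sq, nX']; norm_num
  have yy' : ⟪Y', Y'⟫ = 1 := by rw [real_inner_self_eq_norm_sq, nY']; norm_num
  have hXIY : ⟪X, I Y⟫ = 0 := by have := hIsk X Y; linarith
  have hYX : ⟪Y, X⟫ = 0 := by rw [real_inner_comm]; exact hXY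
  have hYIX : ⟪Y, I X⟫ = 0 := by rw [real_inner_comm]; exact hIXY
  have hYJX : ⟪Y, J X⟫ = - ⟪X, J Y⟫ := by rw [real_inner_comm, hJsk]
  have hYKX : ⟪Y, K X⟫ = - ⟪X, K Y⟫ := by rw [real_inner_comm, hKsk]
  have hs := aux_span I hII hIsk U hU4 hUI X Y hX hY nX nY hXY hIXY
  rw [hs, Submodule.mem_span_range_iff_exists_fun] at hX' hY'
  obtain ⟨c, rfl⟩ := hX'
  obtain ⟨d, rfl⟩ := hY'
  simp only [Fin.sum_univ_four, Matrix.cons_val, map_add, map_smul, inner_add_left, inner_add_right,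
    real_inner_smul_left, real_inner_smul_right, hIsk, hJsk, hKsk, hII, hJJ, hKK, hIJ, hJI, hIK,
    hJK, hKI, hKJ, inner_neg_right, inner_neg_left, z1, z2, z3, xx, yy, hXY, hXIY, hYX, hYIX, hYJX, hYKX]
    at xx' yy' hXY' hIXY' ⊢
  generalize ⟪X, J Y⟫ = p
  generalize ⟪X, K Y⟫ = q
  generalize c 0 = c0 at *
  generalize c 1 = c1 at *
  generalize c 2 = c2 at *
  generalize c 3 = c3 at *
  generalize d 0 = d0 at *
  generalize d 1 = d1 at *
  generalize d 2 = d2 at *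
  generalize d 3 = d3 at *
  have h1 : c0 ^ 2 + c1 ^ 2 + c2 ^ 2 + c3 ^ 2 = 1 := by linarith
  have h2 : d0 ^ 2 + d1 ^ 2 + d2 ^ 2 + d3 ^ 2 = 1 := by linarith
  have h3 : c0 * d0 + c1 * d1 + c2 * d2 + c3 * d3 = 0 := by linarith
  have h4 : c0 * d1 - c1 * d0 + c2 * d3 - c3 * d2 = 0 := by linarith
  have h5 : (c0 * d2 - c1 * d3 - c2 * d0 + c3 * d1) ^ 2
      + (c0 * d3 + c1 * d2 - c2 * d1 - c3 * d0) ^ 2 = 1 := by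
    have : (c0 * d2 - c1 * d3 - c2 * d0 + c3 * d1) ^ 2
      + (c0 * d3 + c1 * d2 - c2 * d1 - c3 * d0) ^ 2
      = (c0 ^ 2 + c1 ^ 2 + c2 ^ 2 + c3 ^ 2) * (d0 ^ 2 + d1 ^ 2 + d2 ^ 2 + d3 ^ 2)
        - (c0 * d0 + c1 * d1 + c2 * d2 + c3 * d3) ^ 2
        - (c0 * d1 - c1 * d0 + c2 * d3 - c3 * d2) ^ 2 := by ring
    rw [this, h1, h2, h3, h4]; norm_num
  linear_combination (-(p ^ 2 + q ^ 2)) * h5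

/-- The pair `(I, θ^{I⊥})` completely determines the `Sp(n)`-orbit of a
4-dimensional `I`-complex subspace. -/
theorem stmt_1 {V : Type*} [NormedAddCommGroup V] [InnerProductSpace ℝ V]
    [FiniteDimensional ℝ V]
    (I J K : V →ₗ[ℝ] V)
    (hII : ∀ x, I (I x) = -x) (hJJ : ∀ x, J (J x) = -x) (hKK : ∀ x, K (K x) = -x)
    (hIJ : ∀ x, I (J x) = K x) (hJI : ∀ x, J (I x) = -K x)
    (hIsk : ∀ x y, ⟪I x, y⟫ = -⟪x, I y⟫)
    (hJsk : ∀ x y, ⟪J x, y⟫ = -⟪x, J y⟫)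
    (hKsk : ∀ x y, ⟪K x, y⟫ = -⟪x, K y⟫)
    (U W : Submodule ℝ V)
    (hU4 : finrank ℝ U = 4) (hW4 : finrank ℝ W = 4)
    (hUI : U.map I = U) (hWI : W.map I = W) :
    (∃ g : V ≃ₗᵢ[ℝ] V, (∀ x, g (I x) = I (g x)) ∧ (∀ x, g (J x) = J (g x)) ∧
      (∀ x, g (K x) = K (g x)) ∧ U.map (g.toLinearEquiv : V →ₗ[ℝ] V) = W) ↔
    (∀ X ∈ U, ∀ Y ∈ U, ‖X‖ = 1 → ‖Y‖ = 1 → ⟪X, Y⟫ = 0 → ⟪I X, Y⟫ = 0 →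
      ∀ X' ∈ W, ∀ Y' ∈ W, ‖X'‖ = 1 → ‖Y'‖ = 1 → ⟪X', Y'⟫ = 0 → ⟪I X', Y'⟫ = 0 →
        ⟪X, J Y⟫ ^ 2 + ⟪X, K Y⟫ ^ 2 = ⟪X', J Y'⟫ ^ 2 + ⟪X', K Y'⟫ ^ 2) := by
  constructor
  · rintro ⟨g, gI, gJ, gK, gU⟩ X hX Y hY nX nY hXY hIXY X' hX' Y' hY' nX' nY' hXY' hIXY'
    have hm : ∀ x ∈ U, g x ∈ W := fun x hx => by
      rw [← gU]; exact mem_map_of_mem hx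
    have := aux_indep I J K hII hJJ hKK hIJ hJI hIsk hJsk hKsk W hW4 hWI (g X) (g Y) (hm X hX)
      (hm Y hY) (by simpa using nX) (by simpa using nY) (by simpa using hXY)
      (by rw [← gI]; simpa using hIXY) X' Y' hX' hY' nX' nY' hXY' hIXY'
    rw [← this, ← gJ, ← gK, g.inner_map_map, g.inner_map_map]
  · intro H
    have hIK : ∀ x, I (K x) = -J x := fun x => by rw [← hIJ, hII]
    have hKI : ∀ x, K (I x) = J x := fun x => by rw [← hIJ, hJI, map_neg, hIK, neg_neg]
    have hIm : ∀ x ∈ W, I x ∈ W := fun x hx => by rw [← hWI]; exact mem_map_of_mem hx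
    have hIm' : ∀ x ∈ U, I x ∈ U := fun x hx => by rw [← hUI]; exact mem_map_of_mem hx
    obtain ⟨X, hX, Y, hY, nX, nY, hXY, hIXY⟩ := aux_exists I U hU4
    obtain ⟨X', hX', Y', hY', nX', nY', hXY', hIXY'⟩ := aux_exists I W hW4
    have h := H X hX Y hY nX nY hXY hIXY X' hX' Y' hY' nX' nY' hXY' hIXY'
    have hYIY : ⟪Y', I Y'⟫ = 0 := by
      have := hIsk Y' Y'
      rw [real_inner_comm] at this; linarith
    have hXIY' : ⟪X', I Y'⟫ = 0 := by have := hIsk X' Y'; linarith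
    obtain ⟨c, s, hcs, hc1, hc2⟩ : ∃ c s : ℝ, c ^ 2 + s ^ 2 = 1 ∧
        c * ⟪X', J Y'⟫ - s * ⟪X', K Y'⟫ = ⟪X, J Y⟫ ∧
        c * ⟪X', K Y'⟫ + s * ⟪X', J Y'⟫ = ⟪X, K Y⟫ := by
      revert h
      generalize ⟪X', J Y'⟫ = p'
      generalize ⟪X', K Y'⟫ = q'
      generalize ⟪X, J Y⟫ = p
      generalize ⟪X, K Y⟫ = q
      intro h
      by_cases hr : p' ^ 2 + q' ^ 2 = 0
      · have a1 : p' = 0 := by nlinarith [sq_nonneg p', sq_nonneg q']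
        have a2 : q' = 0 := by nlinarith [sq_nonneg p', sq_nonneg q']
        have a3 : p = 0 := by nlinarith [sq_nonneg p, sq_nonneg q]
        have a4 : q = 0 := by nlinarith [sq_nonneg p, sq_nonneg q]
        exact ⟨1, 0, by simp [a1, a2, a3, a4]⟩
      · refine ⟨(p * p' + q * q') / (p' ^ 2 + q' ^ 2), (q * p' - p * q') / (p' ^ 2 + q' ^ 2),
          ?_, ?_, ?_⟩
        · field_simp
          linear_combination (p' ^ 2 + q' ^ 2) * h
        · field_simp; ring
        · field_simp; ring
    obtain ⟨Z, hZ⟩ : ∃ Z, Z = c • Y' + s • I Y' := ⟨_, rfl⟩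
    have hZW : Z ∈ W := by
      rw [hZ]; exact W.add_mem (W.smul_mem _ hY') (W.smul_mem _ (hIm _ hY'))
    have nZ : ‖Z‖ = 1 := by
      have yy' : ⟪Y', Y'⟫ = 1 := by rw [real_inner_self_eq_norm_sq, nY']; norm_num
      have : ⟪Z, Z⟫ = 1 := by
        rw [hZ]
        simp only [inner_add_left, inner_add_right, real_inner_smul_left, real_inner_smul_right,
          hIsk, hII, inner_neg_right, hYIY, yy']
        linarith
      rw [real_inner_self_eq_norm_sq] at this
      nlinarith [norm_nonneg Z]
    have hXZ : ⟪X', Z⟫ = 0 := by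
      rw [hZ, inner_add_right, real_inner_smul_right, real_inner_smul_right, hXY', hXIY']; ring
    have hIXZ : ⟪I X', Z⟫ = 0 := by
      rw [hZ, inner_add_right, real_inner_smul_right, real_inner_smul_right, hIXY', hIsk, hII,
        inner_neg_right, hXY']; ring
    have hJZ : ⟪X', J Z⟫ = ⟪X, J Y⟫ := by
      rw [hZ, map_add, map_smul, map_smul, hJI, inner_add_right, real_inner_smul_right,
        real_inner_smul_right, inner_neg_right]; linarith
    have hKZ : ⟪X', K Z⟫ = ⟪X, K Y⟫ := by
      rw [hZ, map_add, map_smul, map_smul, hKI, inner_add_right, real_inner_smul_right,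
        real_inner_smul_right]; linarith
    obtain ⟨g₁, g1I, g1J, g1K, g1X, -⟩ := aux_transvection I J K hII hJJ hKK hIJ hJI hIsk hJsk hKsk
      X X' (nX.trans nX'.symm)
    obtain ⟨g₂, g2I, g2J, g2K, g2Y, g2f⟩ := aux_transvection I J K hII hJJ hKK hIJ hJI hIsk hJsk
      hKsk (g₁ Y) Z (by rw [g₁.norm_map, nY, nZ])
    have g2X : g₂ X' = X' := by
      apply g2f
      · rw [real_inner_comm, inner_sub_right, hXZ, ← g1X, g₁.inner_map_map, hXY, sub_zero]
      · rw [real_inner_comm, map_sub, inner_sub_right, ← g1I, ← neg_inj, ← g1X, neg_sub,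
          g₁.inner_map_map, g1X]
        have e1 := hIsk X Y
        have e2 := hIsk X' Z
        linarith
      · rw [real_inner_comm, map_sub, inner_sub_right, hJZ, ← g1X, ← g1J, g₁.inner_map_map,
          sub_self]
      · rw [real_inner_comm, map_sub, inner_sub_right, hKZ, ← g1X, ← g1K, g₁.inner_map_map,
          sub_self]
    refine ⟨g₁.trans g₂, ?_, ?_, ?_, ?_⟩
    · intro x; simp [g1I, g2I]
    · intro x; simp [g1J, g2J]
    · intro x; simp [g1K, g2K]
    · symm
      apply Submodule.eq_of_le_of_finrank_eq
      · rw [aux_span I hII hIsk W hW4 hWI X' Z hX' hZW nX' nZ hXZ hIXZ, span_le]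
        rintro _ ⟨i, rfl⟩
        fin_cases i
        · exact ⟨X, hX, by simp [g1X, g2X]⟩
        · exact ⟨I X, hIm' _ hX, by simp [g1I, g2I, g1X, g2X]⟩
        · exact ⟨Y, hY, by simp [g2Y]⟩
        · exact ⟨I Y, hIm' _ hY, by simp [g1I, g2I, g2Y]⟩
      · rw [hW4, ← hU4]
        exact (LinearEquiv.finrank_map_eq (g₁.trans g₂).toLinearEquiv U).symm
end

section
/- Let U and W be subspaces of V of the same finite dimension 2m such that I(U) = U, I(W) = W, U is strictly orthogonal to J(U) and to K(U), and W is strictly orthogonal to J(W) and to K(W) (i.e. U and W are totally I-complex). Then there exists an Sp(n)-transformation g of V with g(U) = W. (All totally I-complex subspaces of the same dimension form one Sp(n)-orbit.) -/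
open RealInnerProductSpace Module Submodule

/-- The family `e 0, …, e (n-1)` is orthonormal with respect to the operators `A`. -/
def QO {V : Type*} [NormedAddCommGroup V] [InnerProductSpace ℝ V] {r : ℕ}
    (A : Fin r → V →ₗ[ℝ] V) (n : ℕ) (e : ℕ → V) : Prop :=
  (∀ i < n, ‖e i‖ = 1) ∧ ∀ i < n, ∀ j < n, i ≠ j → ∀ a, ⟪e i, A a (e j)⟫ = 0

/-- Conditions on a system of operators. -/
structure GoodOps {V : Type*} [NormedAddCommGroup V] [InnerProductSpace ℝ V] {r : ℕ}
    (A : Fin r → V →ₗ[ℝ] V) : Prop where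
  one : ∃ a, A a = LinearMap.id
  norm : ∀ a v, ‖A a v‖ = ‖v‖
  orth : ∀ v a b, a ≠ b → ⟪A a v, A b v⟫ = 0
  perp : ∀ v w, (∀ c, ⟪v, A c w⟫ = 0) → ∀ a b, ⟪A a v, A b w⟫ = 0

theorem QO.orthonormal {V : Type*} [NormedAddCommGroup V] [InnerProductSpace ℝ V] {r : ℕ}
    {A : Fin r → V →ₗ[ℝ] V} (hA : GoodOps A) {n : ℕ} {e : ℕ → V} (h : QO A n e) :
    Orthonormal ℝ (fun p : Fin n × Fin r => A p.2 (e p.1)) := by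
  refine ⟨fun p => by rw [hA.norm]; exact h.1 _ p.1.2, ?_⟩
  rintro ⟨i, a⟩ ⟨j, b⟩ hne
  show ⟪A a (e i), A b (e j)⟫ = 0
  by_cases hij : i = j
  · subst hij
    exact hA.orth _ _ _ (fun hab => hne (by rw [hab]))
  · exact hA.perp _ _ (h.2 _ i.2 _ j.2 (fun hh => hij (Fin.ext hh))) a b

theorem QO.step {V : Type*} [NormedAddCommGroup V] [InnerProductSpace ℝ V]
    [FiniteDimensional ℝ V] {r : ℕ}
    {A : Fin r → V →ₗ[ℝ] V} (hA : GoodOps A) {n : ℕ} {e : ℕ → V} (h : QO A n e)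
    (U : Submodule ℝ V) (hU : ∀ i < n, e i ∈ U) (hAU : ∀ a, ∀ x ∈ U, A a x ∈ U)
    (hd : n * r < finrank ℝ U) :
    ∃ e' : ℕ → V, QO A (n + 1) e' ∧ (∀ i < n, e' i = e i) ∧ ∀ i < n + 1, e' i ∈ U := by
  have ho := h.orthonormal hA
  set S := span ℝ (Set.range (fun p : Fin n × Fin r => A p.2 (e p.1))) with hS
  have hSd : finrank ℝ S = n * r := by
    rw [hS, finrank_span_eq_card ho.linearIndependent]; simp
  have hSU : S ≤ U := by
    rw [hS, span_le]
    rintro _ ⟨p, rfl⟩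
    exact hAU _ _ (hU _ p.1.2)
  have hne : Sᗮ ⊓ U ≠ ⊥ := by
    intro hbot
    have := Submodule.finrank_add_inf_finrank_orthogonal hSU
    rw [hbot] at this
    simp at this
    omega
  obtain ⟨v, hv, hv0⟩ := Submodule.exists_mem_ne_zero_of_ne_bot hne
  obtain ⟨u, hu1, huS, huU⟩ : ∃ u : V, ‖u‖ = 1 ∧ u ∈ Sᗮ ∧ u ∈ U := by
    refine ⟨(‖v‖)⁻¹ • v, ?_, Sᗮ.smul_mem _ hv.1, U.smul_mem _ hv.2⟩
    rw [norm_smul, norm_inv, norm_norm, inv_mul_cancel₀ (norm_ne_zero_iff.2 hv0)]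
  have h1 : ∀ j < n, ∀ a, ⟪u, A a (e j)⟫ = 0 := by
    intro j hj a
    rw [real_inner_comm]
    exact huS _ (subset_span ⟨(⟨j, hj⟩, a), rfl⟩)
  have h2 : ∀ j < n, ∀ a, ⟪e j, A a u⟫ = 0 := by
    intro j hj a
    obtain ⟨o, ho⟩ := hA.one
    have := hA.perp _ _ (h1 j hj) a o
    rw [ho] at this
    rw [real_inner_comm]; exact this
  refine ⟨fun i => if i < n then e i else u, ⟨?_, ?_⟩, ?_, ?_⟩
  · intro i _
    by_cases hi : i < n
    · simp [hi, h.1]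
    · simp [hi, hu1]
  · intro i hi' j hj' hij a
    by_cases hi : i < n <;> by_cases hj : j < n
    · simp [hi, hj, h.2 i hi j hj hij]
    · simp [hi, hj, h2]
    · simp [hi, hj, h1]
    · omega
  · intro i hi; simp [hi]
  · intro i _
    by_cases hi : i < n
    · simp [hi, hU]
    · simp [hi, huU]

theorem QO.extend {V : Type*} [NormedAddCommGroup V] [InnerProductSpace ℝ V]
    [FiniteDimensional ℝ V] {r : ℕ} (hr : 0 < r)
    {A : Fin r → V →ₗ[ℝ] V} (hA : GoodOps A) {k : ℕ} {e : ℕ → V} (h : QO A k e)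
    (U : Submodule ℝ V) (hU : ∀ i < k, e i ∈ U) (hAU : ∀ a, ∀ x ∈ U, A a x ∈ U)
    (n : ℕ) (hkn : k ≤ n) :
    n * r ≤ finrank ℝ U →
    ∃ e' : ℕ → V, QO A n e' ∧ (∀ i < k, e' i = e i) ∧ ∀ i < n, e' i ∈ U := by
  induction n, hkn using Nat.le_induction with
  | base => exact fun _ => ⟨e, h, fun _ _ => rfl, hU⟩
  | succ n hkn ih =>
    intro hd
    have hlt : n * r < finrank ℝ U := by nlinarith
    obtain ⟨e', h1, h2, h3⟩ := ih hlt.le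
    obtain ⟨e2, g1, g2, g3⟩ := h1.step hA U h3 hAU hlt
    exact ⟨e2, g1, fun i hi => (g2 i (by omega)).trans (h2 i hi), g3⟩

theorem QO.card_le {V : Type*} [NormedAddCommGroup V] [InnerProductSpace ℝ V]
    [FiniteDimensional ℝ V] {r : ℕ}
    {A : Fin r → V →ₗ[ℝ] V} (hA : GoodOps A) {n : ℕ} {e : ℕ → V} (h : QO A n e) :
    n * r ≤ finrank ℝ V := by
  simpa using (h.orthonormal hA).linearIndependent.fintype_card_le_finrank

/-- Extension to a full basis. -/
theorem QO.full {V : Type*} [NormedAddCommGroup V] [InnerProductSpace ℝ V]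
    [FiniteDimensional ℝ V] {r : ℕ} (hr : 0 < r)
    {A : Fin r → V →ₗ[ℝ] V} (hA : GoodOps A) {k : ℕ} {e : ℕ → V} (h : QO A k e) :
    ∃ e' : ℕ → V, (∀ i < k, e' i = e i) ∧
      ∃ b : OrthonormalBasis (Fin (finrank ℝ V / r) × Fin r) ℝ V,
        ∀ p, b p = A p.2 (e' p.1) := by
  set n := finrank ℝ V / r with hn
  have hkn : k ≤ n := (Nat.le_div_iff_mul_le hr).2 (h.card_le hA)
  have hle : n * r ≤ finrank ℝ V := Nat.div_mul_le_self _ _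
  obtain ⟨e', h1, h2, -⟩ := h.extend hr hA ⊤ (by simp) (by simp) n hkn (by simpa using hle)
  have heq : n * r = finrank ℝ V := by
    by_contra hne
    obtain ⟨e2, g1, -, -⟩ := h1.step hA ⊤ (by simp) (by simp)
      (by rw [finrank_top]; omega)
    have := g1.card_le hA
    have := (Nat.le_div_iff_mul_le hr).2 this
    omega
  have ho := h1.orthonormal hA
  have hsp : span ℝ (Set.range (fun p : Fin n × Fin r => A p.2 (e' p.1))) = ⊤ := by
    apply Submodule.eq_top_of_finrank_eq
    rw [finrank_span_eq_card ho.linearIndependent]; simpa using heq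
  refine ⟨e', h2, OrthonormalBasis.mk ho hsp.ge, fun p => by simp⟩

/-- A unitary basis of a totally complex subspace extends to a symplectic basis. -/
theorem exists_adapted {V : Type*} [NormedAddCommGroup V] [InnerProductSpace ℝ V]
    [FiniteDimensional ℝ V]
    (I J K : V →ₗ[ℝ] V)
    (hII : ∀ x, I (I x) = -x) (hJJ : ∀ x, J (J x) = -x) (hKK : ∀ x, K (K x) = -x)
    (hIJ : ∀ x, I (J x) = K x) (hJI : ∀ x, J (I x) = -K x)
    (hIsk : ∀ x y, ⟪I x, y⟫ = -⟪x, I y⟫)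
    (hJsk : ∀ x y, ⟪J x, y⟫ = -⟪x, J y⟫)
    (hKsk : ∀ x y, ⟪K x, y⟫ = -⟪x, K y⟫)
    (U : Submodule ℝ V) (m : ℕ)
    (hUdim : finrank ℝ U = 2 * m) 
    (hUI : U.map I = U) 
    (hUJ : ∀ x ∈ U, ∀ y ∈ U.map J, ⟪x, y⟫ = 0)
    (hUK : ∀ x ∈ U, ∀ y ∈ U.map K, ⟪x, y⟫ = 0) :
    ∃ e : ℕ → V, U = span ℝ {x | ∃ i < m, x = e i ∨ x = I (e i)} ∧ m ≤ finrank ℝ V / 4 ∧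
      ∃ b : OrthonormalBasis (Fin (finrank ℝ V / 4) × Fin 4) ℝ V,
        ∀ p, b p = (![LinearMap.id, I, J, K] : Fin 4 → V →ₗ[ℝ] V) p.2 (e p.1) := by
  have hIK : ∀ x, I (K x) = - J x := fun x => by rw [← hIJ, hII]
  have hKJ : ∀ x, K (J x) = - I x := fun x => by rw [← hIJ, hJJ, map_neg]
  have hJK : ∀ x, J (K x) = I x := fun x => by rw [← hIJ, hJI, hKJ, neg_neg]
  have hKI : ∀ x, K (I x) = J x := fun x => by rw [← hIJ, hJI, map_neg, hIK, neg_neg]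
  have hI0 : ∀ x, ⟪x, I x⟫ = 0 := fun x => by
    have := hIsk x x; rw [real_inner_comm] at this; linarith
  have hJ0 : ∀ x, ⟪x, J x⟫ = 0 := fun x => by
    have := hJsk x x; rw [real_inner_comm] at this; linarith
  have hK0 : ∀ x, ⟪x, K x⟫ = 0 := fun x => by
    have := hKsk x x; rw [real_inner_comm] at this; linarith
  have nrm : ∀ T : V →ₗ[ℝ] V, (∀ x, T (T x) = -x) → (∀ x y, ⟪T x, y⟫ = -⟪x, T y⟫) →
      ∀ x, ‖T x‖ = ‖x‖ := by
    intro T h1 h2 x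
    have : ⟪T x, T x⟫ = ⟪x, x⟫ := by rw [h2, h1, inner_neg_right, neg_neg]
    rw [real_inner_self_eq_norm_sq, real_inner_self_eq_norm_sq] at this
    exact (sq_eq_sq₀ (norm_nonneg _) (norm_nonneg _)).1 this
  have G2 : GoodOps (![LinearMap.id, I] : Fin 2 → V →ₗ[ℝ] V) := by
    refine ⟨⟨0, rfl⟩, ?_, ?_, ?_⟩
    · intro a v
      fin_cases a <;> simp [nrm I hII hIsk]
    · intro v a b hab
      fin_cases a <;> fin_cases b <;> simp_all
    · intro v w h a b
      have h0 := h 0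
      have h1 := h 1
      simp at h0 h1
      fin_cases a <;> fin_cases b <;> simp [hIsk, hII, h0, h1]
  have G4 : GoodOps (![LinearMap.id, I, J, K] : Fin 4 → V →ₗ[ℝ] V) := by
    refine ⟨⟨0, rfl⟩, ?_, ?_, ?_⟩
    · intro a v
      fin_cases a <;> simp [nrm I hII hIsk, nrm J hJJ hJsk, nrm K hKK hKsk]
    · intro v a b hab
      fin_cases a <;> fin_cases b <;> first
        | exact absurd rfl hab
        | simp [hIsk, hJsk, hKsk, hI0, hJ0, hK0, hIJ, hJI, hIK, hKI, hJK, hKJ]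
    · intro v w h a b
      have h0 := h 0
      have h1 := h 1
      have h2 := h 2
      have h3 := h 3
      simp at h0 h1 h2 h3
      fin_cases a <;> fin_cases b <;> 
        simp [hIsk, hJsk, hKsk, hII, hJJ, hKK, hIJ, hJI, hIK, hKI, hJK, hKJ, h0, h1, h2, h3]
  have hIU : ∀ x ∈ U, I x ∈ U := fun x hx => by
    rw [← hUI]; exact mem_map_of_mem hx
  have hAU : ∀ a, ∀ x ∈ U, (![LinearMap.id, I] : Fin 2 → V →ₗ[ℝ] V) a x ∈ U := by
    intro a x hx
    fin_cases a
    · simpa using hx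
    · simpa using hIU x hx
  have q0 : QO (![LinearMap.id, I] : Fin 2 → V →ₗ[ℝ] V) 0 (fun _ => 0) :=
    ⟨by simp, by simp⟩
  obtain ⟨e, he, -, heU⟩ := q0.extend (by norm_num) G2 U (by simp) hAU m (by simp) (by omega)
  have hq : QO (![LinearMap.id, I, J, K] : Fin 4 → V →ₗ[ℝ] V) m e := by
    refine ⟨he.1, fun i hi j hj hij a => ?_⟩
    have h0 := he.2 i hi j hj hij 0
    have h1 := he.2 i hi j hj hij 1
    have h2 := hUJ _ (heU i hi) _ (mem_map_of_mem (heU j hj))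
    have h3 := hUK _ (heU i hi) _ (mem_map_of_mem (heU j hj))
    fin_cases a
    · exact h0
    · exact h1
    · exact h2
    · exact h3
  have hspan : U = span ℝ {x | ∃ i < m, x = e i ∨ x = I (e i)} := by
    symm
    have hle : span ℝ {x | ∃ i < m, x = e i ∨ x = I (e i)} ≤ U := by
      rw [span_le]
      rintro x ⟨i, hi, rfl | rfl⟩
      · exact heU i hi
      · exact hIU _ (heU i hi)
    apply Submodule.eq_of_le_of_finrank_le hle
    have ho := (he.orthonormal G2).linearIndependent
    have hc := finrank_span_eq_card ho
    simp only [Fintype.card_prod, Fintype.card_fin] at hc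
    rw [hUdim, mul_comm, ← hc]
    apply Submodule.finrank_mono
    apply span_mono
    rintro _ ⟨⟨i, a⟩, rfl⟩
    refine ⟨i, i.2, ?_⟩
    fin_cases a
    · left; rfl
    · right; rfl
  obtain ⟨e', h1, b, hb⟩ := hq.full (by norm_num) G4
  refine ⟨e', ?_, (Nat.le_div_iff_mul_le (by norm_num)).2 (hq.card_le G4), b, hb⟩
  rw [hspan]
  congr 1
  ext x
  constructor
  · rintro ⟨i, hi, h⟩; exact ⟨i, hi, by rwa [h1 i hi]⟩
  · rintro ⟨i, hi, h⟩; exact ⟨i, hi, by rwa [h1 i hi] at h⟩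


/-- All totally `I`-complex subspaces of the same dimension `2m` form one
`Sp(n)`-orbit. -/
theorem stmt_2 {V : Type*} [NormedAddCommGroup V] [InnerProductSpace ℝ V]
    [FiniteDimensional ℝ V]
    (I J K : V →ₗ[ℝ] V)
    (hII : ∀ x, I (I x) = -x) (hJJ : ∀ x, J (J x) = -x) (hKK : ∀ x, K (K x) = -x)
    (hIJ : ∀ x, I (J x) = K x) (hJI : ∀ x, J (I x) = -K x)
    (hIsk : ∀ x y, ⟪I x, y⟫ = -⟪x, I y⟫)
    (hJsk : ∀ x y, ⟪J x, y⟫ = -⟪x, J y⟫)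
    (hKsk : ∀ x y, ⟪K x, y⟫ = -⟪x, K y⟫)
    (U W : Submodule ℝ V) (m : ℕ)
    (hUdim : finrank ℝ U = 2 * m) (hWdim : finrank ℝ W = 2 * m)
    (hUI : U.map I = U) (hWI : W.map I = W)
    (hUJ : ∀ x ∈ U, ∀ y ∈ U.map J, ⟪x, y⟫ = 0)
    (hUK : ∀ x ∈ U, ∀ y ∈ U.map K, ⟪x, y⟫ = 0)
    (hWJ : ∀ x ∈ W, ∀ y ∈ W.map J, ⟪x, y⟫ = 0)
    (hWK : ∀ x ∈ W, ∀ y ∈ W.map K, ⟪x, y⟫ = 0) :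
    ∃ g : V ≃ₗᵢ[ℝ] V, (∀ x, g (I x) = I (g x)) ∧ (∀ x, g (J x) = J (g x)) ∧
      (∀ x, g (K x) = K (g x)) ∧ U.map (g.toLinearEquiv : V →ₗ[ℝ] V) = W := by
  obtain ⟨e, hU, hm, b, hb⟩ := exists_adapted I J K hII hJJ hKK hIJ hJI hIsk hJsk hKsk U m
    hUdim hUI hUJ hUK
  obtain ⟨f, hW, -, c, hc⟩ := exists_adapted I J K hII hJJ hKK hIJ hJI hIsk hJsk hKsk W m
    hWdim hWI hWJ hWK
  have hIK : ∀ x, I (K x) = - J x := fun x => by rw [← hIJ, hII]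
  have hKJ : ∀ x, K (J x) = - I x := fun x => by rw [← hIJ, hJJ, map_neg]
  have hJK : ∀ x, J (K x) = I x := fun x => by rw [← hIJ, hJI, hKJ, neg_neg]
  let g : V ≃ₗᵢ[ℝ] V := b.equiv c (Equiv.refl _)
  have hg : ∀ p, g (b p) = c p := fun p => by simp [g]
  have g0 : ∀ i : Fin (finrank ℝ V / 4), g (e i) = f i := fun i => by
    have := hg (i, 0); rw [hb, hc] at this; exact this
  have g1 : ∀ i : Fin (finrank ℝ V / 4), g (I (e i)) = I (f i) := fun i => by
    have := hg (i, 1); rw [hb, hc] at this; exact this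
  have g2 : ∀ i : Fin (finrank ℝ V / 4), g (J (e i)) = J (f i) := fun i => by
    have := hg (i, 2); rw [hb, hc] at this; exact this
  have g3 : ∀ i : Fin (finrank ℝ V / 4), g (K (e i)) = K (f i) := fun i => by
    have := hg (i, 3); rw [hb, hc] at this; exact this
  have key : ∀ T : V →ₗ[ℝ] V, (∀ p, g (T (b p)) = T (g (b p))) → ∀ x, g (T x) = T (g x) := by
    intro T hT x
    have : (g.toLinearEquiv : V →ₗ[ℝ] V) ∘ₗ T = T ∘ₗ (g.toLinearEquiv : V →ₗ[ℝ] V) := by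
      apply b.toBasis.ext
      intro p
      simpa using hT p
    exact LinearMap.congr_fun this x
  have cI : ∀ x, g (I x) = I (g x) := by
    apply key
    rintro ⟨i, a⟩
    rw [hb]
    fin_cases a <;> simp [g0, g1, g2, g3, hII, hIJ, hIK]
  have cJ : ∀ x, g (J x) = J (g x) := by
    apply key
    rintro ⟨i, a⟩
    rw [hb]
    fin_cases a <;> simp [g0, g1, g2, g3, hJI, hJJ, hJK]
  refine ⟨g, cI, cJ, fun x => by rw [← hIJ, cI, cJ, hIJ], ?_⟩
  apply Submodule.eq_of_le_of_finrank_eq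
  · conv_lhs => rw [hU]
    rw [map_span_le]
    rintro x ⟨i, hi, rfl | rfl⟩
    · rw [hW]
      exact subset_span ⟨i, hi, Or.inl (g0 ⟨i, by omega⟩)⟩
    · rw [hW]
      exact subset_span ⟨i, hi, Or.inr (g1 ⟨i, by omega⟩)⟩
  · rw [hWdim, ← hUdim]
    exact LinearEquiv.finrank_map_eq g.toLinearEquiv U
end

section
/- Let U be a pure subspace of V of dimension 2m with I(U) = U. Then there exist subspaces U₁, …, U_q of U, pairwise Hermitian orthogonal, whose internal direct sum is U, such that I(U_i) = U_i for every i, and such that: if m is even then every U_i has dimension 4, while if m is odd then every U_i has dimension 4 except exactly one, which has dimension 2 and is strictly orthogonal to its image under J (i.e. is totally I-complex). -/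
open RealInnerProductSpace Module Submodule

theorem aux_orth {V : Type*} [NormedAddCommGroup V] [InnerProductSpace ℝ V]
    (x : V) (S : Set V) (h : ∀ y ∈ S, ⟪x, y⟫ = 0) : ∀ y ∈ span ℝ S, ⟪x, y⟫ = 0 := by
  intro y hy
  induction hy using Submodule.span_induction with
  | mem y hy => exact h y hy
  | zero => simp
  | add a b _ _ ha hb => rw [inner_add_right, ha, hb, add_zero]
  | smul c a _ ha => rw [inner_smul_right, ha, mul_zero]

theorem aux_map {V : Type*} [AddCommGroup V] [Module ℝ V] (I : V →ₗ[ℝ] V)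
    (hII : ∀ x, I (I x) = -x) (S : Submodule ℝ V) (h : ∀ x ∈ S, I x ∈ S) : S.map I = S := by
  apply le_antisymm
  · rintro _ ⟨x, hx, rfl⟩
    exact h x hx
  · intro x hx
    exact ⟨-(I x), S.neg_mem (h x hx), by rw [map_neg, hII, neg_neg]⟩

theorem aux_inner {V : Type*} [NormedAddCommGroup V] [InnerProductSpace ℝ V]
    (I : V →ₗ[ℝ] V) (hIsk : ∀ x y, ⟪I x, y⟫ = -⟪x, I y⟫) (x : V) : ⟪x, I x⟫ = 0 := by
  have := hIsk x x
  rw [real_inner_comm] at this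
  linarith

theorem aux_ne {V : Type*} [AddCommGroup V] [Module ℝ V] (I : V →ₗ[ℝ] V)
    (hII : ∀ x, I (I x) = -x) (x : V) (hx : x ≠ 0) : I x ≠ 0 := by
  intro h
  have := hII x
  rw [h, map_zero] at this
  exact hx (by simpa using this.symm)

theorem aux_fin4 {V : Type*} [NormedAddCommGroup V] [InnerProductSpace ℝ V]
    [FiniteDimensional ℝ V] (I : V →ₗ[ℝ] V)
    (hII : ∀ x, I (I x) = -x) (hIsk : ∀ x y, ⟪I x, y⟫ = -⟪x, I y⟫)
    (x y : V) (hx : x ≠ 0) (hy : y ≠ 0) (hxy : ⟪x, y⟫ = 0) (hxIy : ⟪x, I y⟫ = 0) :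
    finrank ℝ (span ℝ (Set.range ![x, I x, y, I y])) = 4 := by
  have hIx := aux_ne I hII x hx
  have hIy := aux_ne I hII y hy
  have e1 := aux_inner I hIsk x
  have e2 := aux_inner I hIsk y
  have e3 : ⟪I x, y⟫ = 0 := by rw [hIsk, hxIy, neg_zero]
  have e4 : ⟪I x, I y⟫ = 0 := by rw [hIsk, hII, inner_neg_right, hxy]; simp
  have li : LinearIndependent ℝ ![x, I x, y, I y] := by
    apply linearIndependent_of_ne_zero_of_inner_eq_zero (𝕜 := ℝ)
    · intro i
      fin_cases i <;> simpa
    · intro i j hij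
      fin_cases i <;> fin_cases j <;>
        first
        | exact absurd rfl hij
        | (simp; first | assumption | (rw [real_inner_comm]; assumption))
  rw [finrank_span_eq_card li]; simp

theorem aux_step {V : Type*} [NormedAddCommGroup V] [InnerProductSpace ℝ V]
    [FiniteDimensional ℝ V]
    (I J : V →ₗ[ℝ] V)
    (hII : ∀ x, I (I x) = -x) (hIJ : ∀ x, J (I x) = - I (J x))
    (hIsk : ∀ x y, ⟪I x, y⟫ = -⟪x, I y⟫)
    (hJsk : ∀ x y, ⟪J x, y⟫ = -⟪x, J y⟫)
    (U : Submodule ℝ V) (hU : ∀ x ∈ U, I x ∈ U) (hdim : 3 ≤ finrank ℝ U) :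
    ∃ W ≤ U, (∀ x ∈ W, I x ∈ W) ∧ finrank ℝ W = 4 ∧
      ∀ u ∈ U, (∀ w ∈ W, ⟪u, w⟫ = 0) → ∀ w ∈ W, ⟪u, J w⟫ = 0 := by
  -- reduce to a pair of vectors
  suffices h : ∃ x ∈ U, ∃ y ∈ U, x ≠ 0 ∧ y ≠ 0 ∧ ⟪x, y⟫ = 0 ∧ ⟪x, I y⟫ = 0 ∧
      ∀ u ∈ U, ⟪u, x⟫ = 0 → ⟪u, y⟫ = 0 → ⟪u, J x⟫ = 0 ∧ ⟪u, J y⟫ = 0 by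
    obtain ⟨x, hxU, y, hyU, hx, hy, hxy, hxIy, hJ⟩ := h
    have mem : ∀ i, ![x, I x, y, I y] i ∈ span ℝ (Set.range ![x, I x, y, I y]) :=
      fun i => subset_span ⟨i, rfl⟩
    have m0 := mem 0
    have m1 := mem 1
    have m2 := mem 2
    have m3 := mem 3
    simp only [Matrix.cons_val] at m0 m1 m2 m3
    have hWI : ∀ w ∈ span ℝ (Set.range ![x, I x, y, I y]),
        I w ∈ span ℝ (Set.range ![x, I x, y, I y]) := by
      intro w hw
      have : span ℝ (Set.range ![x, I x, y, I y]) ≤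
          (span ℝ (Set.range ![x, I x, y, I y])).comap I := by
        rw [span_le]
        rintro _ ⟨i, rfl⟩
        fin_cases i
        · exact m1
        · show I (I x) ∈ span ℝ (Set.range ![x, I x, y, I y])
          rw [hII]; exact neg_mem m0
        · exact m3
        · show I (I y) ∈ span ℝ (Set.range ![x, I x, y, I y])
          rw [hII]; exact neg_mem m2
      exact this hw
    refine ⟨span ℝ (Set.range ![x, I x, y, I y]), ?_, hWI,
      aux_fin4 I hII hIsk x y hx hy hxy hxIy, ?_⟩
    · rw [span_le]
      rintro _ ⟨i, rfl⟩
      fin_cases i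
      · exact hxU
      · exact hU x hxU
      · exact hyU
      · exact hU y hyU
    · intro u hu huW w hw
      have h1 := hJ u hu (huW _ m0) (huW _ m2)
      have h2 := hJ (I u) (hU u hu) (by rw [hIsk, huW _ m1, neg_zero])
        (by rw [hIsk, huW _ m3, neg_zero])
      rw [hIsk, hIsk] at h2
      have := aux_orth (J u) (Set.range ![x, I x, y, I y]) (by
        rintro _ ⟨i, rfl⟩
        rw [hJsk]
        fin_cases i
        · show -⟪u, J x⟫ = 0
          rw [h1.1, neg_zero]
        · show -⟪u, J (I x)⟫ = 0
          rw [hIJ, inner_neg_right, h2.1, neg_zero]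
        · show -⟪u, J y⟫ = 0
          rw [h1.2, neg_zero]
        · show -⟪u, J (I y)⟫ = 0
          rw [hIJ, inner_neg_right, h2.2, neg_zero]) w hw
      rw [hJsk] at this
      linarith
  have hfind : ∀ S : Submodule ℝ V, finrank ℝ S < finrank ℝ U →
      ∃ y ∈ U, y ≠ 0 ∧ ∀ s ∈ S, ⟪s, y⟫ = 0 := by
    intro S hS
    have h1 := Submodule.finrank_add_finrank_orthogonal (𝕜 := ℝ) S
    have h2 := Submodule.finrank_sup_add_finrank_inf_eq U Sᗮ
    have h3 := Submodule.finrank_le (U ⊔ Sᗮ)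
    have h4 : U ⊓ Sᗮ ≠ ⊥ := by
      intro h
      rw [h, finrank_bot] at h2
      omega
    obtain ⟨y, hy, hy0⟩ := Submodule.exists_mem_ne_zero_of_ne_bot h4
    exact ⟨y, hy.1, hy0, fun s hs => (Submodule.mem_orthogonal S y).1 hy.2 s hs⟩
  by_cases hz : ∀ x ∈ U, ∀ y ∈ U, ⟪x, J y⟫ = 0
  · obtain ⟨x, hxU, hx, -⟩ := hfind ⊥ (by rw [finrank_bot]; omega)
    obtain ⟨y, hyU, hy, hxy⟩ := hfind (span ℝ (Set.range ![x, I x])) (by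
      have := finrank_range_le_card (R := ℝ) ![x, I x]
      rw [Fintype.card_fin] at this
      exact lt_of_le_of_lt this (by omega))
    have h1 := hxy x (subset_span ⟨0, rfl⟩)
    have h2 := hxy (I x) (subset_span ⟨1, rfl⟩)
    rw [hIsk] at h2
    exact ⟨x, hxU, y, hyU, hx, hy, h1, by linarith,
      fun u hu _ _ => ⟨hz u hu x hxU, hz u hu y hyU⟩⟩
  · push Not at hz
    obtain ⟨a, ha, b, hb, hab⟩ := hz
    let P : V →ₗ[ℝ] V := U.starProjection.toLinearMap
    have hP : ∀ x y, ⟪P x, y⟫ = ⟪x, P y⟫ := fun x y => U.inner_starProjection_left_eq_right x y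
    have hPU : ∀ x, P x ∈ U := fun x => U.starProjection_apply_mem x
    have hPid : ∀ x ∈ U, P x = x := fun x hx => Submodule.starProjection_eq_self_iff.2 hx
    let B : V →ₗ[ℝ] V := P ∘ₗ J ∘ₗ P
    have hB : ∀ x, B x = P (J (P x)) := fun x => rfl
    have hBsk : ∀ x y, ⟪B x, y⟫ = -⟪x, B y⟫ := by
      intro x y
      rw [hB, hB, hP, hJsk, hP]
    have hBU : ∀ x, B x ∈ U := fun x => hPU _
    have hBJ : ∀ u ∈ U, ∀ x ∈ U, ⟪u, B x⟫ = ⟪u, J x⟫ := by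
      intro u hu x hx
      rw [hB, ← hP, hPid u hu, hPid x hx]
    have hT : (B ∘ₗ B).IsSymmetric := by
      intro x y
      show ⟪B (B x), y⟫ = ⟪x, B (B y)⟫
      rw [hBsk, hBsk, neg_neg]
    have hex : ∃ μ : ℝ, μ ≠ 0 ∧ ∃ x, x ≠ 0 ∧ B (B x) = μ • x := by
      by_contra hcon
      push Not at hcon
      have hle : (⨆ μ, Module.End.eigenspace (B ∘ₗ B) μ) ≤ LinearMap.ker (B ∘ₗ B) := by
        apply iSup_le
        intro μ x hx
        have hx' : B (B x) = μ • x := Module.End.mem_eigenspace_iff.1 hx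
        rw [LinearMap.mem_ker]
        show B (B x) = 0
        by_cases hμ : μ = 0
        · rw [hx', hμ, zero_smul]
        · by_cases hx0 : x = 0
          · rw [hx0, map_zero, map_zero]
          · exact absurd hx' (hcon μ hμ x hx0)
      have htop : (⨆ μ, Module.End.eigenspace (B ∘ₗ B) μ) = ⊤ := by
        rw [← Submodule.orthogonal_eq_bot_iff]
        exact hT.orthogonalComplement_iSup_eigenspaces_eq_bot
      have hBB : B (B b) = 0 := by
        have : b ∈ LinearMap.ker (B ∘ₗ B) := hle (htop ▸ Submodule.mem_top)
        exact this
      have : ⟪B b, B b⟫ = 0 := by rw [hBsk, hBB, inner_zero_right, neg_zero]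
      rw [inner_self_eq_zero] at this
      apply hab
      rw [← hBJ a ha b hb, this, inner_zero_right]
    obtain ⟨μ, hμ, x, hx, hBB⟩ := hex
    have hxU : x ∈ U := by
      have : x = μ⁻¹ • B (B x) := by rw [hBB, smul_smul, inv_mul_cancel₀ hμ, one_smul]
      rw [this]
      exact U.smul_mem _ (hBU _)
    refine ⟨x, hxU, B x, hBU x, hx, ?_, aux_inner B hBsk x, ?_, ?_⟩
    · intro h
      rw [h, map_zero] at hBB
      exact (smul_ne_zero hμ hx) hBB.symm
    · -- uses skewness of `I ∘ J`
      have h1 : ⟪I x, B x⟫ = ⟪I x, J x⟫ := hBJ _ (hU x hxU) x hxU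
      have h2 : ⟪I x, J x⟫ = -⟪x, I (J x)⟫ := hIsk _ _
      have h3 : ⟪J x, I x⟫ = -⟪x, J (I x)⟫ := hJsk _ _
      rw [hIJ, inner_neg_right, real_inner_comm] at h3
      have h4 : ⟪I x, B x⟫ = -⟪x, I (B x)⟫ := hIsk _ _
      linarith
    · intro u hu hux huy
      refine ⟨by rw [← hBJ u hu x hxU, huy], ?_⟩
      rw [← hBJ u hu _ (hBU x), hBB, inner_smul_right, hux, mul_zero]

theorem aux_main {V : Type*} [NormedAddCommGroup V] [InnerProductSpace ℝ V]
    [FiniteDimensional ℝ V]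
    (I J : V →ₗ[ℝ] V)
    (hII : ∀ x, I (I x) = -x) (hIJ : ∀ x, J (I x) = - I (J x))
    (hIsk : ∀ x y, ⟪I x, y⟫ = -⟪x, I y⟫)
    (hJsk : ∀ x y, ⟪J x, y⟫ = -⟪x, J y⟫) (m : ℕ) :
    ∀ U : Submodule ℝ V, (∀ x ∈ U, I x ∈ U) → finrank ℝ U = 2 * m →
    ∃ (q : ℕ) (Us : Fin q → Submodule ℝ V),
      (∀ i, Us i ≤ U) ∧
      (⨆ i, Us i) = U ∧
      (∀ i j, i ≠ j → ∀ x ∈ Us i, ∀ y ∈ Us j, ⟪x, y⟫ = 0 ∧ ⟪x, J y⟫ = 0) ∧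
      (∀ i, ∀ x ∈ Us i, I x ∈ Us i) ∧
      (Even m → ∀ i, finrank ℝ (Us i) = 4) ∧
      (Odd m → ∃ i₀, finrank ℝ (Us i₀) = 2 ∧
        (∀ x ∈ Us i₀, ∀ y ∈ Us i₀, ⟪x, J y⟫ = 0) ∧
        ∀ i, i ≠ i₀ → finrank ℝ (Us i) = 4) := by
  induction m using Nat.twoStepInduction with
  | zero =>
    intro U hU hdim
    have : U = ⊥ := Submodule.finrank_eq_zero.1 (by simpa using hdim)
    subst this
    exact ⟨0, Fin.elim0, fun i => i.elim0, by simp, fun i => i.elim0, fun i => i.elim0,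
      fun _ i => i.elim0, fun h => absurd h (by decide)⟩
  | one =>
    intro U hU hdim
    refine ⟨1, fun _ => U, fun _ => le_rfl, by simp, fun i j hij => absurd (Subsingleton.elim i j) hij,
      fun _ => hU, fun h => absurd h (by decide), fun _ => ⟨0, by simpa using hdim, ?_,
      fun i hi => absurd (Subsingleton.elim i 0) hi⟩⟩
    have hne : U ≠ ⊥ := by
      rintro rfl
      simp at hdim
    obtain ⟨x, hxU, hx⟩ := Submodule.exists_mem_ne_zero_of_ne_bot hne
    have e1 := aux_inner I hIsk x
    have li : LinearIndependent ℝ ![x, I x] := by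
      apply linearIndependent_of_ne_zero_of_inner_eq_zero (𝕜 := ℝ)
      · intro i
        fin_cases i
        · exact hx
        · exact aux_ne I hII x hx
      · intro i j hij
        fin_cases i <;> fin_cases j <;>
          first
          | exact absurd rfl hij
          | (simp; first | assumption | (rw [real_inner_comm]; assumption))
    have hspan : span ℝ (Set.range ![x, I x]) = U := by
      apply Submodule.eq_of_le_of_finrank_eq
      · rw [span_le]
        rintro _ ⟨i, rfl⟩
        fin_cases i
        · exact hxU
        · exact hU x hxU
      · rw [finrank_span_eq_card li, hdim]; simp
    have f1 : ⟪x, J x⟫ = 0 := aux_inner J hJsk x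
    have f2 : ⟪x, I (J x)⟫ = 0 := by
      have h2 : ⟪I x, J x⟫ = -⟪x, I (J x)⟫ := hIsk _ _
      have h3 : ⟪J x, I x⟫ = -⟪x, J (I x)⟫ := hJsk _ _
      rw [hIJ, inner_neg_right, real_inner_comm] at h3
      linarith
    -- `x` is orthogonal to `J U`, and so is `I x`
    have g1 : ∀ y ∈ U, ⟪J x, y⟫ = 0 := by
      intro y hy
      rw [← hspan] at hy
      refine aux_orth (J x) _ ?_ y hy
      rintro _ ⟨i, rfl⟩
      rw [hJsk]
      fin_cases i
      · show -⟪x, J x⟫ = 0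
        rw [f1, neg_zero]
      · show -⟪x, J (I x)⟫ = 0
        rw [hIJ, inner_neg_right, f2]; simp
    intro a ha y hy
    have ha' := ha
    rw [← hspan] at ha'
    have := aux_orth (J y) _ (by
      rintro _ ⟨i, rfl⟩
      fin_cases i
      · show ⟪J y, x⟫ = 0
        rw [hJsk, real_inner_comm, g1 y hy, neg_zero]
      · show ⟪J y, I x⟫ = 0
        rw [hJsk, hIJ, inner_neg_right, real_inner_comm, hIsk, g1 _ (hU y hy)]; simp) a ha'
    rw [real_inner_comm]
    exact this
  | more n ih _ =>
    intro U hU hdim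
    obtain ⟨W, hWU, hWI, hW4, hWJ⟩ := aux_step I J hII hIJ hIsk hJsk U hU (by omega)
    have hsup : W ⊔ Wᗮ ⊓ U = U := Submodule.sup_orthogonal_inf_of_hasOrthogonalProjection hWU
    have hdim' : finrank ℝ (Wᗮ ⊓ U : Submodule ℝ V) = 2 * n := by
      have := Submodule.finrank_add_inf_finrank_orthogonal (𝕜 := ℝ) hWU
      omega
    obtain ⟨q, Us, h1, h2, h3, h4, h5, h6⟩ := ih (Wᗮ ⊓ U) (by
      intro x hx
      refine ⟨?_, hU x hx.2⟩
      rw [SetLike.mem_coe, Submodule.mem_orthogonal]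
      intro w hw
      have := (Submodule.mem_orthogonal W x).1 hx.1 (I w) (hWI w hw)
      rw [hIsk] at this
      linarith) hdim'
    have hort : ∀ i, ∀ x ∈ Us i, ∀ w ∈ W, ⟪x, w⟫ = 0 := by
      intro i x hx w hw
      rw [real_inner_comm]
      exact (Submodule.mem_orthogonal W x).1 (h1 i hx).1 w hw
    have hortJ : ∀ i, ∀ x ∈ Us i, ∀ w ∈ W, ⟪x, J w⟫ = 0 := fun i x hx w hw =>
      hWJ x (h1 i hx).2 (hort i x hx) w hw
    refine ⟨q + 1, Fin.cons W Us, ?_, ?_, ?_, ?_, ?_, ?_⟩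
    · intro i
      refine Fin.cases ?_ (fun i => ?_) i
      · exact hWU
      · exact (h1 i).trans inf_le_right
    · rw [← hsup, ← h2]
      apply le_antisymm
      · apply iSup_le
        intro i
        refine Fin.cases ?_ (fun i => ?_) i
        · exact le_sup_left
        · exact le_sup_of_le_right (le_iSup Us i)
      · apply sup_le
        · exact le_iSup (Fin.cons W Us : Fin (q + 1) → Submodule ℝ V) 0
        · apply iSup_le
          intro i
          exact le_iSup (Fin.cons W Us : Fin (q + 1) → Submodule ℝ V) i.succ
    · intro i j
      refine Fin.cases ?_ (fun i => ?_) i <;> refine Fin.cases ?_ (fun j => ?_) j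
      · intro h; exact absurd rfl h
      · intro _ x hx y hy
        simp only [Fin.cons_zero, Fin.cons_succ] at hx hy
        refine ⟨by rw [real_inner_comm]; exact hort j y hy x hx, ?_⟩
        have h := hortJ j y hy x hx
        have h' := hJsk x y
        rw [real_inner_comm] at h'
        linarith
      · intro _ x hx y hy
        exact ⟨hort i x hx y hy, hortJ i x hx y hy⟩
      · intro hij x hx y hy
        exact h3 i j (fun h => hij (by rw [h])) x hx y hy
    · intro i
      refine Fin.cases ?_ (fun i => ?_) i
      · exact hWI
      · exact h4 i
    · intro he i
      have he' : Even n := by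
        rw [Nat.even_iff] at he ⊢; omega
      refine Fin.cases ?_ (fun i => ?_) i
      · exact hW4
      · exact h5 he' i
    · intro ho
      have ho' : Odd n := by
        rw [Nat.odd_iff] at ho ⊢; omega
      obtain ⟨i₀, k1, k2, k3⟩ := h6 ho'
      refine ⟨i₀.succ, k1, k2, fun i => ?_⟩
      refine Fin.cases ?_ (fun i => ?_) i
      · intro _; exact hW4
      · intro hi; exact k3 i (fun h => hi (by rw [h]))

/-- Any pure `I`-complex subspace of dimension `2m` admits a decomposition into
a Hermitian-orthogonal sum of 4-dimensional `I`-complex subspaces, plus one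
totally `I`-complex 2-plane when `m` is odd. -/
theorem stmt_3 {V : Type*} [NormedAddCommGroup V] [InnerProductSpace ℝ V]
    [FiniteDimensional ℝ V]
    (I J K : V →ₗ[ℝ] V)
    (hII : ∀ x, I (I x) = -x) (hJJ : ∀ x, J (J x) = -x) (hKK : ∀ x, K (K x) = -x)
    (hIJ : ∀ x, I (J x) = K x) (hJI : ∀ x, J (I x) = -K x)
    (hIsk : ∀ x y, ⟪I x, y⟫ = -⟪x, I y⟫)
    (hJsk : ∀ x y, ⟪J x, y⟫ = -⟪x, J y⟫)
    (hKsk : ∀ x y, ⟪K x, y⟫ = -⟪x, K y⟫)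
    (U : Submodule ℝ V) (m : ℕ) (hUdim : finrank ℝ U = 2 * m)
    (hUI : U.map I = U)
    (hpure : ∀ S : Submodule ℝ V, S ≤ U → S.map I = S → S.map J = S → S.map K = S → S = ⊥) :
    ∃ (q : ℕ) (Us : Fin q → Submodule ℝ V),
      (∀ i, Us i ≤ U) ∧
      (⨆ i, Us i) = U ∧
      (∀ i j, i ≠ j →
        ∀ x ∈ (Us i ⊔ (Us i).map I ⊔ (Us i).map J ⊔ (Us i).map K),
        ∀ y ∈ (Us j ⊔ (Us j).map I ⊔ (Us j).map J ⊔ (Us j).map K), ⟪x, y⟫ = 0) ∧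
      (∀ i, (Us i).map I = Us i) ∧
      (Even m → ∀ i, finrank ℝ (Us i) = 4) ∧
      (Odd m → ∃ i₀, finrank ℝ (Us i₀) = 2 ∧
        (∀ x ∈ Us i₀, ∀ y ∈ (Us i₀).map J, ⟪x, y⟫ = 0) ∧
        ∀ i, i ≠ i₀ → finrank ℝ (Us i) = 4) := by
  have hIJ' : ∀ x, J (I x) = - I (J x) := fun x => by rw [hJI, hIJ]
  have hUI' : ∀ x ∈ U, I x ∈ U := fun x hx => hUI ▸ Submodule.mem_map_of_mem hx
  obtain ⟨q, Us, h1, h2, h3, h4, h5, h6⟩ :=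
    aux_main I J hII hIJ' hIsk hJsk m U hUI' hUdim
  have hmem : ∀ i, ∀ x ∈ (Us i ⊔ (Us i).map I ⊔ (Us i).map J ⊔ (Us i).map K),
      ∃ s ∈ Us i, ∃ t ∈ Us i, s + J t = x := by
    intro i x hx
    have hle : (Us i ⊔ (Us i).map I ⊔ (Us i).map J ⊔ (Us i).map K) ≤ Us i ⊔ (Us i).map J := by
      rw [aux_map I hII _ (h4 i), sup_idem]
      refine sup_le le_rfl ?_
      rintro _ ⟨y, hy, rfl⟩
      refine Submodule.mem_sup_right ⟨-(I y), neg_mem (h4 i y hy), ?_⟩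
      rw [map_neg, hJI, neg_neg]
    obtain ⟨s, hs, z, ⟨t, ht, rfl⟩, rfl⟩ := Submodule.mem_sup.1 (hle hx)
    exact ⟨s, hs, t, ht, rfl⟩
  refine ⟨q, Us, h1, h2, ?_, fun i => aux_map I hII _ (h4 i), h5, ?_⟩
  · intro i j hij x hx y hy
    obtain ⟨s, hs, t, ht, rfl⟩ := hmem i x hx
    obtain ⟨s', hs', t', ht', rfl⟩ := hmem j y hy
    rw [inner_add_left, inner_add_right, inner_add_right, hJsk, hJsk, hJJ, inner_neg_right,
      (h3 i j hij s hs s' hs').1, (h3 i j hij s hs t' ht').2, (h3 i j hij t ht s' hs').2,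
      (h3 i j hij t ht t' ht').1]
    simp
  · intro ho
    obtain ⟨i₀, k1, k2, k3⟩ := h6 ho
    refine ⟨i₀, k1, ?_, k3⟩
    rintro x hx _ ⟨y, hy, rfl⟩
    exact k2 x hx y hy
end

section
/- Let U be a 4-dimensional subspace of V with I(U) = U. Then: (a) the quantity ⟪X, J Y⟫² + ⟪X, K Y⟫² takes the same value, call it c², for every I-orthonormal pair (X, Y) of U; and (b) for every x ∈ U one has ‖proj_{K(U)}(x)‖² = c²·‖x‖², i.e. the pair of subspaces (U, K(U)) is isoclinic with angle of isoclinicity θ satisfying cos²θ = c². -/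
open RealInnerProductSpace Module Submodule

theorem span_aux {V : Type*} [NormedAddCommGroup V] [InnerProductSpace ℝ V]
    [FiniteDimensional ℝ V] (U : Submodule ℝ V) (hU4 : finrank ℝ U = 4)
    (v : Fin 4 → V) (hv : Orthonormal ℝ v) (hm : ∀ i, v i ∈ U) (x : V) (hx : x ∈ U) :
    ∃ a b c d : ℝ, x = a • v 0 + b • v 1 + c • v 2 + d • v 3 := by
  have hle : span ℝ (Set.range v) ≤ U := by
    rw [span_le]; rintro _ ⟨i, rfl⟩; exact hm i
  have heq : span ℝ (Set.range v) = U := by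
    apply Submodule.eq_of_le_of_finrank_eq hle
    rw [finrank_span_eq_card hv.linearIndependent, hU4]; simp
  rw [← heq, Submodule.mem_span_range_iff_exists_fun] at hx
  obtain ⟨c, hc⟩ := hx
  exact ⟨c 0, c 1, c 2, c 3, by rw [← hc, Fin.sum_univ_four]⟩

theorem key_aux {V : Type*} [NormedAddCommGroup V] [InnerProductSpace ℝ V]
    [FiniteDimensional ℝ V]
    (I J K : V →ₗ[ℝ] V)
    (hII : ∀ x, I (I x) = -x) (hJJ : ∀ x, J (J x) = -x) (hKK : ∀ x, K (K x) = -x)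
    (hIJ : ∀ x, I (J x) = K x) (hJI : ∀ x, J (I x) = -K x)
    (hIsk : ∀ x y, ⟪I x, y⟫ = -⟪x, I y⟫)
    (hJsk : ∀ x y, ⟪J x, y⟫ = -⟪x, J y⟫)
    (hKsk : ∀ x y, ⟪K x, y⟫ = -⟪x, K y⟫)
    (U : Submodule ℝ V) (hU4 : finrank ℝ U = 4) (hUI : U.map I = U)
    (X : V) (hX : X ∈ U) (Y : V) (hY : Y ∈ U) (nX : ‖X‖ = 1) (nY : ‖Y‖ = 1)
    (hXY : ⟪X, Y⟫ = 0) (hIXY : ⟪I X, Y⟫ = 0) (x : V) (hx : x ∈ U) :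
    ‖((orthogonalProjection (U.map K) x : U.map K) : V)‖ ^ 2
        = (⟪X, J Y⟫ ^ 2 + ⟪X, K Y⟫ ^ 2) * ‖x‖ ^ 2 := by
  have mI : ∀ z ∈ U, I z ∈ U := fun z hz => by
    rw [← hUI]; exact Submodule.mem_map_of_mem hz
  have hIK : ∀ z, I (K z) = - J z := fun z => by rw [← hIJ, hII]
  have hKI : ∀ z, K (I z) = J z := fun z => by rw [← hIJ, hJI, map_neg, hIK, neg_neg]
  have sI : ∀ z, ⟪z, I z⟫ = 0 := fun z => by
    have := hIsk z z; rw [real_inner_comm] at this; linarith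
  have sJ : ∀ z, ⟪z, J z⟫ = 0 := fun z => by
    have := hJsk z z; rw [real_inner_comm] at this; linarith
  have sK : ∀ z, ⟪z, K z⟫ = 0 := fun z => by
    have := hKsk z z; rw [real_inner_comm] at this; linarith
  have hXX : ⟪X, X⟫ = 1 := by rw [real_inner_self_eq_norm_sq, nX]; norm_num
  have hYY : ⟪Y, Y⟫ = 1 := by rw [real_inner_self_eq_norm_sq, nY]; norm_num
  have hYX : ⟪Y, X⟫ = 0 := by rw [real_inner_comm]; exact hXY
  have hXIY : ⟪X, I Y⟫ = 0 := by have := hIsk X Y; linarith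
  have hYIX : ⟪Y, I X⟫ = 0 := by rw [real_inner_comm]; exact hIXY
  have hYJX : ⟪Y, J X⟫ = -⟪X, J Y⟫ := by rw [real_inner_comm, hJsk]
  have hYKX : ⟪Y, K X⟫ = -⟪X, K Y⟫ := by rw [real_inner_comm, hKsk]
  have nI : ∀ z, ‖I z‖ = ‖z‖ := fun z => by
    have : ‖I z‖ ^ 2 = ‖z‖ ^ 2 := by
      rw [← real_inner_self_eq_norm_sq, ← real_inner_self_eq_norm_sq, hIsk, hII, inner_neg_right,
        neg_neg]
    exact (sq_eq_sq₀ (norm_nonneg _) (norm_nonneg _)).1 this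
  have dec := span_aux U hU4 ![X, I X, Y, I Y] (by
    rw [orthonormal_iff_ite]
    intro i j
    fin_cases i <;> fin_cases j <;>
      simp [hIsk, hII, hXX, hYY, hXY, hYX, hXIY, hYIX, sI, nX, nY, nI]) (by
    intro i
    fin_cases i <;> simp [hX, hY, mI])
  obtain ⟨a, b, c, d, hxe⟩ := dec x hx
  have hPm := (orthogonalProjection (U.map K) x).2
  obtain ⟨u, hu, hue⟩ := hPm
  have hort : ∀ w ∈ U, ⟪x - K u, K w⟫ = 0 := fun w hw => by
    rw [hue]
    exact Submodule.starProjection_inner_eq_zero x _ (Submodule.mem_map_of_mem hw)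
  rw [← hue]
  obtain ⟨e, f, g, h, hu'⟩ := dec u hu
  have h1 := hort X hX
  have h2 := hort (I X) (mI _ hX)
  have h3 := hort Y hY
  have h4 := hort (I Y) (mI _ hY)
  simp only [Matrix.cons_val] at hxe hu'
  rw [← real_inner_self_eq_norm_sq, ← real_inner_self_eq_norm_sq]
  have hJK : ∀ z, J (K z) = I z := fun z => by
    have := hJI (J z); rw [hIJ] at this; rw [this, ← hIJ, hJJ, map_neg, neg_neg]
  have hKJ : ∀ z, K (J z) = - I z := fun z => by rw [← hIJ, hJJ, map_neg]
  generalize hp : ⟪X, J Y⟫ = p at *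
  generalize hq : ⟪X, K Y⟫ = q at *
  simp only [hxe, hu', map_add, map_smul, map_neg, inner_add_left, inner_add_right, inner_sub_left,
    inner_smul_left, inner_smul_right, inner_neg_left, inner_neg_right, hKsk, hIsk, hJsk, hII, hJJ,
    hKK, hIJ, hJI, hIK, hKI, hJK, hKJ, hXX, hYY, hXY, hYX, hXIY, hYIX, hYJX, hYKX, sI, sJ, sK,
    hp, hq, conj_trivial] at h1 h2 h3 h4 ⊢
  have e1 : e = -(c * q) - d * p := by linarith
  have e2 : f = d * q - c * p := by linarith
  have e3 : g = a * q + b * p := by linarith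
  have e4 : h = a * p - b * q := by linarith
  rw [e1, e2, e3, e4]
  ring

/-- A 4-dimensional `I`-complex subspace is isoclinic with its `K`-image, the
common square-cosine being `⟪X, J Y⟫² + ⟪X, K Y⟫²` for any `I`-orthonormal pair. -/
theorem stmt_4 {V : Type*} [NormedAddCommGroup V] [InnerProductSpace ℝ V]
    [FiniteDimensional ℝ V]
    (I J K : V →ₗ[ℝ] V)
    (hII : ∀ x, I (I x) = -x) (hJJ : ∀ x, J (J x) = -x) (hKK : ∀ x, K (K x) = -x)
    (hIJ : ∀ x, I (J x) = K x) (hJI : ∀ x, J (I x) = -K x)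
    (hIsk : ∀ x y, ⟪I x, y⟫ = -⟪x, I y⟫)
    (hJsk : ∀ x y, ⟪J x, y⟫ = -⟪x, J y⟫)
    (hKsk : ∀ x y, ⟪K x, y⟫ = -⟪x, K y⟫)
    (U : Submodule ℝ V) (hU4 : finrank ℝ U = 4) (hUI : U.map I = U) :
    ∃ c : ℝ, 0 ≤ c ∧
      (∀ X ∈ U, ∀ Y ∈ U, ‖X‖ = 1 → ‖Y‖ = 1 → ⟪X, Y⟫ = 0 → ⟪I X, Y⟫ = 0 →
        ⟪X, J Y⟫ ^ 2 + ⟪X, K Y⟫ ^ 2 = c ^ 2) ∧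
      (∀ x ∈ U, ‖((orthogonalProjection (U.map K) x : U.map K) : V)‖ ^ 2
        = c ^ 2 * ‖x‖ ^ 2) := by
  have mI : ∀ z ∈ U, I z ∈ U := fun z hz => by
    rw [← hUI]; exact Submodule.mem_map_of_mem hz
  have unit : ∀ W : Submodule ℝ V, 0 < finrank ℝ W → ∃ z ∈ W, ‖z‖ = 1 := by
    intro W hW
    have hne : W ≠ ⊥ := by
      rintro rfl
      simp at hW
    obtain ⟨z, hz, hz0⟩ := W.exists_mem_ne_zero_of_ne_bot hne
    exact ⟨‖z‖⁻¹ • z, W.smul_mem _ hz, by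
      rw [norm_smul, norm_inv, norm_norm, inv_mul_cancel₀ (norm_ne_zero_iff.2 hz0)]⟩
  classical
  obtain ⟨A, hA, nA⟩ := unit U (by omega)
  have hle : span ℝ (({A, I A} : Finset V) : Set V) ≤ U := by
    rw [span_le]
    intro z hz
    simp at hz
    rcases hz with rfl | rfl
    · exact hA
    · exact mI _ hA
  have h2 : finrank ℝ (span ℝ (({A, I A} : Finset V) : Set V)) ≤ 2 :=
    (finrank_span_finset_le_card _).trans Finset.card_le_two
  have h3 := Submodule.finrank_add_inf_finrank_orthogonal hle
  obtain ⟨B, hB, nB⟩ := unit _ (show 0 < finrank ℝ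
    ((span ℝ (({A, I A} : Finset V) : Set V))ᗮ ⊓ U : Submodule ℝ V) by omega)
  have key := key_aux I J K hII hJJ hKK hIJ hJI hIsk hJsk hKsk U hU4 hUI
  have kA := key A hA B hB.2 nA nB (hB.1 A (subset_span (by simp)))
    (hB.1 (I A) (subset_span (by simp)))
  have hs : Real.sqrt (⟪A, J B⟫ ^ 2 + ⟪A, K B⟫ ^ 2) ^ 2 = ⟪A, J B⟫ ^ 2 + ⟪A, K B⟫ ^ 2 :=
    Real.sq_sqrt (by positivity)
  refine ⟨Real.sqrt (⟪A, J B⟫ ^ 2 + ⟪A, K B⟫ ^ 2), Real.sqrt_nonneg _, ?_, ?_⟩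
  · intro X hX Y hY nX nY h1 h2
    have k1 := key X hX Y hY nX nY h1 h2 A hA
    have k2 := kA A hA
    rw [nA] at k1 k2
    rw [hs]
    linarith
  · intro x hx
    rw [hs]
    exact kA x hx
end

section
/- Let U be a 4-dimensional subspace of V with I(U) = U, let (X, Y) be an I-orthonormal pair of U, and set c² = ⟪X, J Y⟫² + ⟪X, K Y⟫². Then for every compatible complex structure A = αI + βJ + γK and every x ∈ U one has ‖proj_{A(U)}(x)‖² = (α² + (1 − α²)·c²)·‖x‖². In particular, the pair (U, A(U)) is isoclinic with cos²θ^A = α² + (1 − α²)·c². -/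
open RealInnerProductSpace Module Submodule

lemma exists_onb_aux {V : Type*} [NormedAddCommGroup V] [InnerProductSpace ℝ V]
    [FiniteDimensional ℝ V] (S : Submodule ℝ V) (hS : finrank ℝ S = 4) (e : Fin 4 → V)
    (he : Orthonormal ℝ e) (hm : ∀ i, e i ∈ S) :
    ∃ b : OrthonormalBasis (Fin 4) ℝ S, ∀ i, (b i : V) = e i := by
  have hf : Orthonormal ℝ (fun i => (⟨e i, hm i⟩ : S)) := by
    rw [orthonormal_iff_ite] at he ⊢
    intro i j
    simpa using he i j
  have hsp := hf.linearIndependent.span_eq_top_of_card_eq_finrank (by simp [hS])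
  refine ⟨OrthonormalBasis.mk hf hsp.ge, fun i => by simp⟩

lemma proj_norm_aux {V : Type*} [NormedAddCommGroup V] [InnerProductSpace ℝ V]
    [FiniteDimensional ℝ V] (S : Submodule ℝ V) (hS : finrank ℝ S = 4) (e : Fin 4 → V)
    (he : Orthonormal ℝ e) (hm : ∀ i, e i ∈ S) (x : V) :
    ‖((orthogonalProjection S x : S) : V)‖ ^ 2 = ∑ i, ⟪e i, x⟫ ^ 2 := by
  obtain ⟨b, hb⟩ := exists_onb_aux S hS e he hm
  have h := b.sum_sq_norm_inner_right (orthogonalProjection S x)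
  refine h.symm.trans ?_
  refine Finset.sum_congr rfl fun i _ => ?_
  rw [← hb i, Real.norm_eq_abs, sq_abs, Submodule.inner_orthogonalProjection_eq_of_mem_left]

lemma expand_aux {V : Type*} [NormedAddCommGroup V] [InnerProductSpace ℝ V]
    [FiniteDimensional ℝ V] (S : Submodule ℝ V) (hS : finrank ℝ S = 4) (e : Fin 4 → V)
    (he : Orthonormal ℝ e) (hm : ∀ i, e i ∈ S) (x : V) (hx : x ∈ S) :
    ∃ c : Fin 4 → ℝ, x = ∑ i, c i • e i := by
  obtain ⟨b, hb⟩ := exists_onb_aux S hS e he hm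
  refine ⟨fun i => b.repr ⟨x, hx⟩ i, ?_⟩
  have h := congrArg (Subtype.val) (b.sum_repr ⟨x, hx⟩)
  simp only [Submodule.coe_sum, Submodule.coe_smul, hb] at h
  exact h.symm

/-- For a 4-dimensional `I`-complex subspace `U` with `c² = ⟪X,JY⟫² + ⟪X,KY⟫²`,
the pair `(U, A U)` is isoclinic with `cos²θ^A = α² + (1−α²) c²` for every
compatible complex structure `A = αI + βJ + γK`. -/
theorem stmt_5 {V : Type*} [NormedAddCommGroup V] [InnerProductSpace ℝ V]
    [FiniteDimensional ℝ V]
    (I J K : V →ₗ[ℝ] V)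
    (hII : ∀ x, I (I x) = -x) (hJJ : ∀ x, J (J x) = -x) (hKK : ∀ x, K (K x) = -x)
    (hIJ : ∀ x, I (J x) = K x) (hJI : ∀ x, J (I x) = -K x)
    (hIsk : ∀ x y, ⟪I x, y⟫ = -⟪x, I y⟫)
    (hJsk : ∀ x y, ⟪J x, y⟫ = -⟪x, J y⟫)
    (hKsk : ∀ x y, ⟪K x, y⟫ = -⟪x, K y⟫)
    (U : Submodule ℝ V) (hU4 : finrank ℝ U = 4) (hUI : U.map I = U)
    (X Y : V) (hXU : X ∈ U) (hYU : Y ∈ U)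
    (hX1 : ‖X‖ = 1) (hY1 : ‖Y‖ = 1) (hXY : ⟪X, Y⟫ = 0) (hIXY : ⟪I X, Y⟫ = 0)
    (α β γ : ℝ) (hαβγ : α ^ 2 + β ^ 2 + γ ^ 2 = 1) :
    ∀ x ∈ U,
      ‖((orthogonalProjection (U.map (α • I + β • J + γ • K)) x :
          U.map (α • I + β • J + γ • K)) : V)‖ ^ 2
        = (α ^ 2 + (1 - α ^ 2) * (⟪X, J Y⟫ ^ 2 + ⟪X, K Y⟫ ^ 2)) * ‖x‖ ^ 2 := by
  have hIK : ∀ x, I (K x) = -J x := fun x => by rw [← hIJ, hII]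
  have hKI : ∀ x, K (I x) = J x := fun x => by rw [← hIJ, hJI, map_neg, hIK, neg_neg]
  have hKJ : ∀ x, K (J x) = -I x := fun x => by rw [← hIJ, hJJ, map_neg]
  have hJK : ∀ x, J (K x) = I x := fun x => by rw [← hIJ, hJI, hKJ, neg_neg]
  have hsI : ∀ x, ⟪x, I x⟫ = 0 := fun x => by
    have := hIsk x x
    rw [real_inner_comm] at this; linarith
  have hsJ : ∀ x, ⟪x, J x⟫ = 0 := fun x => by
    have := hJsk x x
    rw [real_inner_comm] at this; linarith
  have hsK : ∀ x, ⟪x, K x⟫ = 0 := fun x => by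
    have := hKsk x x
    rw [real_inner_comm] at this; linarith
  have hXX : ⟪X, X⟫ = 1 := by rw [real_inner_self_eq_norm_sq, hX1]; norm_num
  have hYY : ⟪Y, Y⟫ = 1 := by rw [real_inner_self_eq_norm_sq, hY1]; norm_num
  have hYX : ⟪Y, X⟫ = 0 := by rw [real_inner_comm, hXY]
  have hXIY : ⟪X, I Y⟫ = 0 := by have := hIsk X Y; linarith
  have hYIX : ⟪Y, I X⟫ = 0 := by rw [real_inner_comm, hIXY]
  have hYJX : ⟪Y, J X⟫ = -⟪X, J Y⟫ := by rw [real_inner_comm, hJsk]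
  have hYKX : ⟪Y, K X⟫ = -⟪X, K Y⟫ := by rw [real_inner_comm, hKsk]
  have hIX1 : ‖I X‖ = 1 := by
    have h := real_inner_self_eq_norm_sq (I X)
    rw [hIsk, hII, inner_neg_right, neg_neg, hXX] at h
    nlinarith [norm_nonneg (I X)]
  have hIY1 : ‖I Y‖ = 1 := by
    have h := real_inner_self_eq_norm_sq (I Y)
    rw [hIsk, hII, inner_neg_right, neg_neg, hYY] at h
    nlinarith [norm_nonneg (I Y)]
  have hIU : ∀ x ∈ U, I x ∈ U := fun x hx => by
    rw [← hUI]; exact Submodule.mem_map_of_mem hx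
  set A : V →ₗ[ℝ] V := α • I + β • J + γ • K with hA
  have hAx : ∀ x, A x = α • I x + β • J x + γ • K x := fun x => by simp [hA]
  have hAsk : ∀ x y, ⟪A x, y⟫ = -⟪x, A y⟫ := fun x y => by
    simp only [hAx, inner_add_left, inner_add_right, real_inner_smul_left,
      real_inner_smul_right, hIsk x y, hJsk x y, hKsk x y]
    ring
  have hAA : ∀ x, A (A x) = -x := fun x => by
    have : A (A x) = -((α ^ 2 + β ^ 2 + γ ^ 2) • x) := by
      simp only [hAx, map_add, map_smul, hII, hJJ, hKK, hIJ, hJI, hIK, hKI, hKJ, hJK]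
      module
    rw [this, hαβγ, one_smul]
  have hAin : ∀ x y, ⟪A x, A y⟫ = ⟪x, y⟫ := fun x y => by
    rw [hAsk, hAA, inner_neg_right, neg_neg]
  have hAinj : Function.Injective A := fun x y h => by
    have := congrArg A h
    rwa [hAA, hAA, neg_inj] at this
  let e : Fin 4 → V := ![X, I X, Y, I Y]
  have he : Orthonormal ℝ e := by
    rw [orthonormal_iff_ite]
    intro i j
    fin_cases i <;> fin_cases j <;>
      simp [e, hIsk, hII, hsI, hX1, hY1, hIX1, hIY1, hXY, hYX, hXIY, hYIX]
  have hm : ∀ i, e i ∈ U := by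
    intro i
    fin_cases i <;> simp [e, hXU, hYU, hIU]
  have hAe : Orthonormal ℝ (fun i => A (e i)) := by
    rw [orthonormal_iff_ite] at he ⊢
    intro i j
    rw [hAin, he i j]
  have hfr : finrank ℝ (U.map A) = 4 := by
    rw [← hU4]
    exact (Submodule.equivMapOfInjective A hAinj U).finrank_eq.symm
  intro x hx
  rw [proj_norm_aux (U.map A) hfr _ hAe (fun i => Submodule.mem_map_of_mem (hm i))]
  obtain ⟨c, rfl⟩ := expand_aux U hU4 e he hm x hx
  rw [← real_inner_self_eq_norm_sq]
  simp only [Fin.sum_univ_four, e, Matrix.cons_val, hAx, inner_add_left, inner_add_right,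
    real_inner_smul_left, real_inner_smul_right, hIsk, hJsk, hKsk, hII, hIJ, hJI, hIK, hKI,
    hJJ, hKK, hJK, hKJ, hsI, hsJ, hsK, hXX, hYY, hXY, hYX, hXIY, hYIX, hYJX, hYKX, map_neg,
    inner_neg_right, inner_neg_left, neg_neg, neg_zero]
  have h1 : 1 - α ^ 2 = β ^ 2 + γ ^ 2 := by linarith
  rw [h1]
  ring
end

section
/- Let U be a finite-dimensional pure subspace of V with I(U) = U, and define the linear operator T : U → U by T(x) = proj_U(K x). Then for every real μ ≠ 0 the dimension of the kernel of T∘T + μ·id_U is divisible by 4, and the dimension of the kernel of T is even. (Every principal angle θ ≠ π/2 of the pair (U, K(U)) has multiplicity divisible by 4, and the principal angle π/2 has even multiplicity.) -/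
open RealInnerProductSpace Module Submodule

lemma four_dvd_aux {E : Type*} [AddCommGroup E] [Module ℝ E] [FiniteDimensional ℝ E]
    (i j : Module.End ℝ E) (hi : i * i = -1) (hj : j * j = -1) (hij : j * i = -(i * j)) :
    4 ∣ finrank ℝ E := by
  let B : QuaternionAlgebra.Basis (Module.End ℝ E) (-1 : ℝ) 0 (-1) :=
    { i := i, j := j, k := i * j
      i_mul_i := by simp [hi]
      j_mul_j := by simp [hj]
      i_mul_j := rfl
      j_mul_i := by simp [hij] }
  let f : Quaternion ℝ →ₐ[ℝ] Module.End ℝ E := B.liftHom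
  letI : Module (Quaternion ℝ) E := Module.compHom E f.toRingHom
  haveI : IsScalarTower ℝ (Quaternion ℝ) E := by
    refine ⟨fun r q x => ?_⟩
    change f (r • q) x = r • f q x
    rw [map_smul]; rfl
  have h := Module.finrank_mul_finrank ℝ (Quaternion ℝ) E
  rw [Quaternion.finrank_eq_four] at h
  exact ⟨_, h.symm⟩

lemma even_aux {E : Type*} [AddCommGroup E] [Module ℝ E] [FiniteDimensional ℝ E]
    (i : Module.End ℝ E) (hi : i * i = -1) : Even (finrank ℝ E) := by
  by_contra h
  rw [Nat.not_even_iff_odd] at h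
  have h1 := congrArg LinearMap.det hi
  have h2 : (-1 : Module.End ℝ E) = (-1 : ℝ) • (1 : Module.End ℝ E) := by simp
  rw [map_mul, h2, LinearMap.det_smul, h.neg_one_pow, map_one] at h1
  nlinarith [mul_self_nonneg (LinearMap.det i)]

/-- For a pure `I`-complex subspace `U` and `T x = proj_U (K x)`, every principal
angle `θ ≠ π/2` of `(U, K U)` has multiplicity divisible by 4, and the principal
angle `π/2` has even multiplicity. -/
theorem stmt_6 {V : Type*} [NormedAddCommGroup V] [InnerProductSpace ℝ V]
    [FiniteDimensional ℝ V]
    (I J K : V →ₗ[ℝ] V)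
    (hII : ∀ x, I (I x) = -x) (hJJ : ∀ x, J (J x) = -x) (hKK : ∀ x, K (K x) = -x)
    (hIJ : ∀ x, I (J x) = K x) (hJI : ∀ x, J (I x) = -K x)
    (hIsk : ∀ x y, ⟪I x, y⟫ = -⟪x, I y⟫)
    (hJsk : ∀ x y, ⟪J x, y⟫ = -⟪x, J y⟫)
    (hKsk : ∀ x y, ⟪K x, y⟫ = -⟪x, K y⟫)
    (U : Submodule ℝ V) (hUI : U.map I = U)
    (hpure : ∀ S : Submodule ℝ V, S ≤ U → S.map I = S → S.map J = S → S.map K = S → S = ⊥)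
    (T : U →ₗ[ℝ] U)
    (hT : ∀ x : U, T x = orthogonalProjection U (K (x : V))) :
    (∀ μ : ℝ, μ ≠ 0 →
      4 ∣ finrank ℝ (LinearMap.ker (T ∘ₗ T + μ • (LinearMap.id : U →ₗ[ℝ] U)))) ∧
    Even (finrank ℝ (LinearMap.ker T)) := by
  have hIU : ∀ x ∈ U, I x ∈ U := fun x hx => by
    have : I x ∈ U.map I := Submodule.mem_map_of_mem hx
    rwa [hUI] at this
  have hKI : ∀ x, K (I x) = -I (K x) := fun x => by
    rw [← hIJ, ← hIJ, hJI, ← hIJ, map_neg]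
  let i : U →ₗ[ℝ] U := I.restrict hIU
  have hi : ∀ x : U, ((i x : U) : V) = I x := fun x => rfl
  have hii : ∀ x, i (i x) = -x := fun x => by
    apply Subtype.ext; simp [hi, hII]
  have hin : ∀ x y : U, ⟪T x, y⟫ = ⟪K (x : V), (y : V)⟫ := fun x y => by
    rw [hT]
    exact Submodule.inner_orthogonalProjection_eq_of_mem_right y _
  have hTi : ∀ x, T (i x) = -i (T x) := fun x => by
    refine ext_inner_right ℝ fun y => ?_
    have e : ⟪i (T x), y⟫ = -⟪T x, i y⟫ := hIsk _ _
    rw [inner_neg_left, e, hin, hin, hi, hi, hKI, inner_neg_left, hIsk]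
  have hTsk : ∀ x y, ⟪T x, y⟫ = -⟪x, T y⟫ := fun x y => by
    rw [hin, real_inner_comm (T y) x, hin, hKsk, real_inner_comm]
  constructor
  · intro μ hμ
    set E := LinearMap.ker (T ∘ₗ T + μ • (LinearMap.id : U →ₗ[ℝ] U)) with hE
    have hmem : ∀ x, x ∈ E ↔ T (T x) = -(μ • x) := fun x => by
      simp [hE, LinearMap.mem_ker, eq_neg_iff_add_eq_zero]
    rcases lt_or_gt_of_ne hμ with hneg | hpos
    · have : E = ⊥ := by
        rw [eq_bot_iff]
        intro x hx
        rw [hmem] at hx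
        have h1 := hTsk x (T x)
        rw [hx, inner_neg_right, real_inner_smul_right, neg_neg] at h1
        have h2 : 0 ≤ ⟪T x, T x⟫ := real_inner_self_nonneg
        have h3 : 0 ≤ ⟪x, x⟫ := real_inner_self_nonneg
        have h4 : ⟪x, x⟫ = 0 := by nlinarith
        simpa using h4
      rw [this]; simp
    · have hiE : ∀ x ∈ E, i x ∈ E := fun x hx => by
        rw [hmem] at hx ⊢
        rw [hTi, map_neg, hTi, hx]; simp
      have hTE : ∀ x ∈ E, ((√μ)⁻¹ • T) x ∈ E := fun x hx => by
        refine E.smul_mem _ ?_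
        rw [hmem] at hx ⊢
        rw [hx]; simp
      refine four_dvd_aux (E := E) (i.restrict hiE) (((√μ)⁻¹ • T).restrict hTE) ?_ ?_ ?_
      · ext1 x; apply Subtype.ext
        exact hii x
      · ext1 x; apply Subtype.ext
        have hx := (hmem x).1 x.2
        change (√μ)⁻¹ • T ((√μ)⁻¹ • T x) = -(x : U)
        rw [map_smul, hx, smul_smul, smul_neg, smul_smul, ← mul_inv,
          Real.mul_self_sqrt hpos.le, inv_mul_cancel₀ hμ, one_smul]
      · ext1 x; apply Subtype.ext
        change (√μ)⁻¹ • T (i x) = -(i ((√μ)⁻¹ • T x))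
        rw [hTi, map_smul, smul_neg]
  · have hiE : ∀ x ∈ LinearMap.ker T, i x ∈ LinearMap.ker T := fun x hx => by
      rw [LinearMap.mem_ker] at hx ⊢
      rw [hTi, hx]; simp
    refine even_aux (i.restrict hiE) ?_
    ext1 x; apply Subtype.ext
    exact hii x
end

section
/- Let U be a 4-dimensional subspace of V with I(U) = U, let (X₀, Y₀) be an I-orthonormal pair of U, and set c = √(⟪X₀, J Y₀⟫² + ⟪X₀, K Y₀⟫²); assume c > 0. Let K' be any compatible complex structure with K'∘I = −I∘K'. Then for every unit vector X ∈ U, the vector Z = −(1/c)·K'(proj_{K'(U)}(X)) belongs to U, has norm 1, and satisfies ⟪Z, X⟫ = 0 and ⟪Z, I X⟫ = 0; that is, X and Z lie in strictly orthogonal I-complex 2-planes. -/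
open RealInnerProductSpace Module Submodule

theorem aux_expand {V : Type*} [NormedAddCommGroup V] [InnerProductSpace ℝ V]
    [FiniteDimensional ℝ V] (U : Submodule ℝ V) (hU4 : finrank ℝ U = 4)
    (e₁ e₂ e₃ e₄ : V) (h1 : e₁ ∈ U) (h2 : e₂ ∈ U) (h3 : e₃ ∈ U) (h4 : e₄ ∈ U)
    (h11 : ⟪e₁, e₁⟫ = 1) (h22 : ⟪e₂, e₂⟫ = 1) (h33 : ⟪e₃, e₃⟫ = 1) (h44 : ⟪e₄, e₄⟫ = 1)
    (h12 : ⟪e₁, e₂⟫ = 0) (h13 : ⟪e₁, e₃⟫ = 0) (h14 : ⟪e₁, e₄⟫ = 0)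
    (h23 : ⟪e₂, e₃⟫ = 0) (h24 : ⟪e₂, e₄⟫ = 0) (h34 : ⟪e₃, e₄⟫ = 0)
    (u : V) (hu : u ∈ U) :
    u = ⟪e₁, u⟫ • e₁ + ⟪e₂, u⟫ • e₂ + ⟪e₃, u⟫ • e₃ + ⟪e₄, u⟫ • e₄ := by
  let v : Fin 4 → U := ![⟨e₁, h1⟩, ⟨e₂, h2⟩, ⟨e₃, h3⟩, ⟨e₄, h4⟩]
  have hv : Orthonormal ℝ v := by
    rw [orthonormal_iff_ite]
    intro i j
    fin_cases i <;> fin_cases j <;>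
      simp [v, h11, h22, h33, h44, h12, h13, h14, h23, h24, h34,
        real_inner_comm e₁ e₂ ▸ h12, real_inner_comm e₁ e₃ ▸ h13, real_inner_comm e₁ e₄ ▸ h14,
        real_inner_comm e₂ e₃ ▸ h23, real_inner_comm e₂ e₄ ▸ h24, real_inner_comm e₃ e₄ ▸ h34,
        -inner_self_eq_norm_sq_to_K]
  have hsp : (⊤ : Submodule ℝ U) ≤ span ℝ (Set.range v) := by
    rw [hv.linearIndependent.span_eq_top_of_card_eq_finrank' (by simp [hU4])]
  let B := OrthonormalBasis.mk hv hsp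
  have h := B.sum_repr' ⟨u, hu⟩
  have h' := congrArg (Subtype.val) h
  simp [B, Fin.sum_univ_four, v] at h'
  exact h'.symm

/-- For a 4-dimensional `I`-complex subspace with `I⊥`-Kähler angle ≠ π/2 and
any compatible complex structure `K'` anticommuting with `I`, the unit vector
`Z = −(1/c)·K'(proj_{K'U} X)` lies in `U` and is `I`-orthogonal to `X`. -/
theorem stmt_7 {V : Type*} [NormedAddCommGroup V] [InnerProductSpace ℝ V]
    [FiniteDimensional ℝ V]
    (I J K : V →ₗ[ℝ] V)
    (hII : ∀ x, I (I x) = -x) (hJJ : ∀ x, J (J x) = -x) (hKK : ∀ x, K (K x) = -x)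
    (hIJ : ∀ x, I (J x) = K x) (hJI : ∀ x, J (I x) = -K x)
    (hIsk : ∀ x y, ⟪I x, y⟫ = -⟪x, I y⟫)
    (hJsk : ∀ x y, ⟪J x, y⟫ = -⟪x, J y⟫)
    (hKsk : ∀ x y, ⟪K x, y⟫ = -⟪x, K y⟫)
    (U : Submodule ℝ V) (hU4 : finrank ℝ U = 4) (hUI : U.map I = U)
    (X₀ Y₀ : V) (hX₀U : X₀ ∈ U) (hY₀U : Y₀ ∈ U)
    (hX₀1 : ‖X₀‖ = 1) (hY₀1 : ‖Y₀‖ = 1) (hX₀Y₀ : ⟪X₀, Y₀⟫ = 0) (hIX₀Y₀ : ⟪I X₀, Y₀⟫ = 0)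
    (c : ℝ) (hc : c = Real.sqrt (⟪X₀, J Y₀⟫ ^ 2 + ⟪X₀, K Y₀⟫ ^ 2)) (hcpos : 0 < c)
    (a b d : ℝ) (habd : a ^ 2 + b ^ 2 + d ^ 2 = 1)
    (K' : V →ₗ[ℝ] V) (hK' : K' = a • I + b • J + d • K)
    (hanti : ∀ x, K' (I x) = -(I (K' x)))
    (X : V) (hXU : X ∈ U) (hX1 : ‖X‖ = 1)
    (Z : V)
    (hZ : Z = -(1 / c) • K' ((orthogonalProjection (U.map K') X : U.map K') : V)) :
    Z ∈ U ∧ ‖Z‖ = 1 ∧ ⟪Z, X⟫ = 0 ∧ ⟪Z, I X⟫ = 0 := by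
  have hIU : ∀ x ∈ U, I x ∈ U := fun x hx => hUI ▸ Submodule.mem_map_of_mem hx
  have hXX : ⟪X, X⟫ = 1 := by rw [real_inner_self_eq_norm_sq, hX1]; norm_num
  have hX0X : X ≠ 0 := by rintro rfl; simp at hX1
  have hKI : ∀ x, K (I x) = J x := fun x => by
    rw [← hIJ, hJI, map_neg, ← hIJ, hII, neg_neg]
  have hIK : ∀ x, I (K x) = -J x := fun x => by rw [← hIJ, hII]
  have hJK : ∀ x, J (K x) = I x := fun x => by
    rw [← hIJ, hJI, ← hIJ, hJJ, map_neg, neg_neg]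
  have hKJ : ∀ x, K (J x) = -I x := fun x => by rw [← hIJ, hJJ, map_neg]
  have ha : a = 0 := by
    have h := hanti X
    simp only [hK', LinearMap.add_apply, LinearMap.smul_apply, map_add, map_smul, hII, hJI, hKI,
      hIJ, hIK] at h
    have h2 : (2 * a) • X = 0 := by
      linear_combination (norm := module) (-1 : ℝ) • h
    rcases smul_eq_zero.mp h2 with h | h
    · linarith
    · exact absurd h hX0X
  subst ha
  have hbd : b ^ 2 + d ^ 2 = 1 := by linarith
  have hK'a : ∀ x, K' x = b • J x + d • K x := fun x => by simp [hK']
  have hK'K' : ∀ x, K' (K' x) = -x := fun x => by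
    simp only [hK'a, map_add, map_smul, hJJ, hKK, hJK, hKJ]
    have : (b ^ 2 + d ^ 2) • x = x := by rw [hbd, one_smul]
    linear_combination (norm := module) (-1 : ℝ) • this
  have hK'sk : ∀ x y, ⟪K' x, y⟫ = -⟪x, K' y⟫ := fun x y => by
    simp only [hK'a, inner_add_left, inner_add_right, inner_smul_left, inner_smul_right, hJsk x,
      hKsk x]
    simp; ring
  have hself : ∀ x, ⟪x, K' x⟫ = 0 := fun x => by
    have := hK'sk x x
    rw [real_inner_comm] at this; linarith
  have hselfI : ∀ x, ⟪x, I x⟫ = 0 := fun x => by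
    have := hIsk x x
    rw [real_inner_comm] at this; linarith
  have hII' : ∀ x y, ⟪I x, I y⟫ = ⟪x, y⟫ := fun x y => by
    rw [hIsk, hII, inner_neg_right, neg_neg]
  have hIself : ∀ x, ⟪I x, K' x⟫ = 0 := fun x => by
    have h1 := hK'sk x (I x)
    rw [hanti, inner_neg_right, neg_neg, real_inner_comm] at h1
    have h2 := hIsk x (K' x)
    linarith
  -- the vector W
  obtain ⟨W, hWU, hW⟩ := (orthogonalProjection (U.map K') X).2
  rw [← hW, hK'K'] at hZ
  have hWin : ∀ u ∈ U, ⟪u, W⟫ = -⟪u, K' X⟫ := fun u hu => by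
    have h := Submodule.starProjection_inner_eq_zero (K := U.map K') X (K' u)
      (Submodule.mem_map_of_mem hu)
    rw [Submodule.starProjection_apply, ← hW, inner_sub_left, hK'sk W, hK'K', inner_neg_right,
      neg_neg] at h
    have h2 := hK'sk X u
    rw [real_inner_comm u W, real_inner_comm u (K' X)] at *
    linarith
  have hX₀X₀ : ⟪X₀, X₀⟫ = 1 := by rw [real_inner_self_eq_norm_sq, hX₀1]; norm_num
  have hY₀Y₀ : ⟪Y₀, Y₀⟫ = 1 := by rw [real_inner_self_eq_norm_sq, hY₀1]; norm_num
  have hX₀IY₀ : ⟪X₀, I Y₀⟫ = 0 := by have := hIsk X₀ Y₀; linarith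
  have hexp := aux_expand U hU4 X₀ (I X₀) Y₀ (I Y₀) hX₀U (hIU _ hX₀U) hY₀U (hIU _ hY₀U)
    hX₀X₀ (by rw [hII', hX₀X₀]) hY₀Y₀ (by rw [hII', hY₀Y₀]) (hselfI _) hX₀Y₀ hX₀IY₀ hIX₀Y₀
    (by rw [hII', hX₀Y₀]) (hselfI _)
  have hpar : ∀ u ∈ U, ⟪u, u⟫ = ⟪X₀, u⟫ ^ 2 + ⟪I X₀, u⟫ ^ 2 + ⟪Y₀, u⟫ ^ 2 + ⟪I Y₀, u⟫ ^ 2 := by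
    intro u hu
    have h := congrArg (fun t => ⟪t, u⟫) (hexp u hu)
    simp only [inner_add_left, real_inner_smul_left] at h
    rw [h]; ring
  have hc2 : c ^ 2 = ⟪X₀, J Y₀⟫ ^ 2 + ⟪X₀, K Y₀⟫ ^ 2 := by
    rw [hc, Real.sq_sqrt (by positivity)]
  obtain ⟨α, hα⟩ : ∃ α, α = ⟪X₀, K' Y₀⟫ := ⟨_, rfl⟩
  obtain ⟨β, hβ⟩ : ∃ β, β = ⟪X₀, K' (I Y₀)⟫ := ⟨_, rfl⟩
  have hαβ : α ^ 2 + β ^ 2 = c ^ 2 := by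
    rw [hα, hβ, hc2]
    simp only [hK'a, hJI, hKI, inner_add_right, real_inner_smul_right, inner_neg_right]
    linear_combination (⟪X₀, J Y₀⟫ ^ 2 + ⟪X₀, K Y₀⟫ ^ 2) * hbd
  -- matrix entries
  have m13 : ⟪X₀, K' Y₀⟫ = α := hα.symm
  have m14 : ⟪X₀, K' (I Y₀)⟫ = β := hβ.symm
  have sw : ∀ x y, ⟪x, K' y⟫ = -⟪y, K' x⟫ := fun x y => by
    rw [real_inner_comm, hK'sk]
  have iI : ∀ x y, ⟪I x, K' y⟫ = ⟪x, K' (I y)⟫ := fun x y => by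
    rw [hIsk, hanti, inner_neg_right]
  have iII : ∀ x, K' (I (I x)) = - K' x := fun x => by rw [hII, map_neg]
  have m12 : ∀ x, ⟪x, K' (I x)⟫ = 0 := fun x => by rw [← iI, hIself]
  have m31 : ⟪Y₀, K' X₀⟫ = -α := by rw [sw, m13]
  have m32 : ⟪Y₀, K' (I X₀)⟫ = -β := by rw [sw, iI, m14]
  have hXe := hexp X hXU
  have hXn := hpar X hXU
  obtain ⟨x1, e1⟩ : ∃ t, t = ⟪X₀, X⟫ := ⟨_, rfl⟩
  obtain ⟨x2, e2⟩ : ∃ t, t = ⟪I X₀, X⟫ := ⟨_, rfl⟩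
  obtain ⟨x3, e3⟩ : ∃ t, t = ⟪Y₀, X⟫ := ⟨_, rfl⟩
  obtain ⟨x4, e4⟩ : ∃ t, t = ⟪I Y₀, X⟫ := ⟨_, rfl⟩
  rw [← e1, ← e2, ← e3, ← e4] at hXe hXn
  have hWW : ⟪W, W⟫ = c ^ 2 := by
    rw [hpar W hWU, hWin _ hX₀U, hWin _ hY₀U, hWin _ (hIU _ hX₀U), hWin _ (hIU _ hY₀U), hXe]
    simp only [map_add, map_smul, inner_add_right, real_inner_smul_right, iI, iII,
      inner_neg_right, m12, m13, m14, m31, m32, hself]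
    rw [hXX] at hXn
    linear_combination (x1 ^ 2 + x2 ^ 2 + x3 ^ 2 + x4 ^ 2) * hαβ - c ^ 2 * hXn
  have hZ' : Z = (1 / c) • W := by rw [hZ]; simp
  have hWn : ‖W‖ = c := by
    rw [real_inner_self_eq_norm_sq] at hWW
    exact (sq_eq_sq₀ (norm_nonneg _) hcpos.le).mp hWW
  refine ⟨?_, ?_, ?_, ?_⟩
  · rw [hZ']; exact U.smul_mem _ hWU
  · rw [hZ', norm_smul, hWn, Real.norm_of_nonneg (by positivity)]
    field_simp
  · rw [hZ', real_inner_smul_left, real_inner_comm, hWin _ hXU, hself]; simp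
  · rw [hZ', real_inner_smul_left, real_inner_comm, hWin _ (hIU _ hXU), hIself]; simp
end

section
/- Let U be a 4-dimensional subspace of V with I(U) = U, let (X₀, Y₀) be an I-orthonormal pair of U, and set c = √(⟪X₀, J Y₀⟫² + ⟪X₀, K Y₀⟫²); assume c > 0. For a unit vector X ∈ U set Z = −(1/c)·K(proj_{K(U)}(X)). Then the four vectors (X, Z, I X, I Z) form an orthonormal basis of U, so U is the orthogonal direct sum of U₁ = span(X, Z) and I(U₁); moreover ⟪X, K Z⟫ = c, ⟪X, J Z⟫ = 0 and ⟪X, I Z⟫ = 0. -/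
open RealInnerProductSpace Module Submodule

theorem aux_frame {V : Type*} [NormedAddCommGroup V] [InnerProductSpace ℝ V]
    [FiniteDimensional ℝ V] (I : V →ₗ[ℝ] V)
    (hII : ∀ x, I (I x) = -x)
    (hIsk : ∀ x y, ⟪I x, y⟫ = -⟪x, I y⟫)
    (U : Submodule ℝ V) (hU4 : finrank ℝ U = 4) (hUI : ∀ x ∈ U, I x ∈ U)
    (A B : V) (hA : A ∈ U) (hB : B ∈ U) (hAA : ⟪A, A⟫ = 1) (hBB : ⟪B, B⟫ = 1)
    (hAB : ⟪A, B⟫ = 0) (hAIB : ⟪A, I B⟫ = 0) :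
    Orthonormal ℝ ![A, B, I A, I B] ∧ Submodule.span ℝ ({A, B, I A, I B} : Set V) = U ∧
    ∀ x ∈ U, x = ⟪x, A⟫ • A + ⟪x, B⟫ • B + ⟪x, I A⟫ • I A + ⟪x, I B⟫ • I B := by
  have hBA : ⟪B, A⟫ = 0 := by rw [real_inner_comm]; exact hAB
  have hself : ∀ x, ⟪x, I x⟫ = 0 := by
    intro x
    have h := hIsk x x
    rw [real_inner_comm] at h
    linarith
  have hBIA : ⟪B, I A⟫ = 0 := by
    have h := hIsk B A
    rw [real_inner_comm, hAIB] at h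
    linarith
  have hON : Orthonormal ℝ ![A, B, I A, I B] := by
    rw [orthonormal_iff_ite]
    intro i j
    fin_cases i <;> fin_cases j <;>
      simp [hAA, hBB, hAB, hAIB, hBA, hBIA, hself, hIsk, hII, -inner_self_eq_norm_sq_to_K]
  have hr : Set.range ![A, B, I A, I B] = ({A, B, I A, I B} : Set V) := by
    simp [Matrix.range_cons, Matrix.range_empty, Set.insert_def, Set.union_def]
  have hspan : Submodule.span ℝ ({A, B, I A, I B} : Set V) = U := by
    apply Submodule.eq_of_le_of_finrank_eq
    · rw [Submodule.span_le]
      intro x hx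
      simp only [Set.mem_insert_iff, Set.mem_singleton_iff] at hx
      rcases hx with rfl | rfl | rfl | rfl
      · exact hA
      · exact hB
      · exact hUI _ hA
      · exact hUI _ hB
    · rw [← hr, finrank_span_eq_card hON.linearIndependent, hU4]
      simp
  refine ⟨hON, hspan, ?_⟩
  intro x hx
  rw [← hspan, ← hr, Submodule.mem_span_range_iff_exists_fun] at hx
  obtain ⟨f, hf⟩ := hx
  have h : ∀ i, ⟪x, ![A, B, I A, I B] i⟫ = f i := by
    intro i
    rw [← hf, hON.inner_left_fintype]
    simp
  have h0 := h 0
  have h1 := h 1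
  have h2 := h 2
  have h3 := h 3
  simp at h0 h1 h2 h3
  rw [h0, h1, h2, h3]
  simpa [Fin.sum_univ_four] using hf.symm

/-- For a 4-dimensional `I`-complex subspace `U` with angle ≠ π/2 and a unit
vector `X ∈ U`, setting `Z = −(1/c)·K(proj_{KU} X)`, the vectors
`(X, Z, I X, I Z)` form an orthonormal basis of `U`, so `U = span(X,Z) ⊕ I span(X,Z)`,
with `⟪X, K Z⟫ = c`, `⟪X, J Z⟫ = 0`, `⟪X, I Z⟫ = 0`. -/
theorem stmt_8 {V : Type*} [NormedAddCommGroup V] [InnerProductSpace ℝ V]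
    [FiniteDimensional ℝ V]
    (I J K : V →ₗ[ℝ] V)
    (hII : ∀ x, I (I x) = -x) (hJJ : ∀ x, J (J x) = -x) (hKK : ∀ x, K (K x) = -x)
    (hIJ : ∀ x, I (J x) = K x) (hJI : ∀ x, J (I x) = -K x)
    (hIsk : ∀ x y, ⟪I x, y⟫ = -⟪x, I y⟫)
    (hJsk : ∀ x y, ⟪J x, y⟫ = -⟪x, J y⟫)
    (hKsk : ∀ x y, ⟪K x, y⟫ = -⟪x, K y⟫)
    (U : Submodule ℝ V) (hU4 : finrank ℝ U = 4) (hUI : U.map I = U)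
    (X₀ Y₀ : V) (hX₀U : X₀ ∈ U) (hY₀U : Y₀ ∈ U)
    (hX₀1 : ‖X₀‖ = 1) (hY₀1 : ‖Y₀‖ = 1) (hX₀Y₀ : ⟪X₀, Y₀⟫ = 0) (hIX₀Y₀ : ⟪I X₀, Y₀⟫ = 0)
    (c : ℝ) (hc : c = Real.sqrt (⟪X₀, J Y₀⟫ ^ 2 + ⟪X₀, K Y₀⟫ ^ 2)) (hcpos : 0 < c)
    (X : V) (hXU : X ∈ U) (hX1 : ‖X‖ = 1)
    (Z : V)
    (hZ : Z = -(1 / c) • K ((orthogonalProjection (U.map K) X : U.map K) : V)) :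
    Z ∈ U ∧ Orthonormal ℝ ![X, Z, I X, I Z] ∧
      Submodule.span ℝ ({X, Z, I X, I Z} : Set V) = U ∧
      U = Submodule.span ℝ ({X, Z} : Set V) ⊔
        (Submodule.span ℝ ({X, Z} : Set V)).map I ∧
      ⟪X, K Z⟫ = c ∧ ⟪X, J Z⟫ = 0 ∧ ⟪X, I Z⟫ = 0 := by
  have hIU : ∀ x ∈ U, I x ∈ U := fun x hx => by
    rw [← hUI]; exact Submodule.mem_map_of_mem hx
  have hKI : ∀ x, K (I x) = J x := by
    intro x
    rw [← hIJ, hJI, map_neg, ← hIJ, hII, neg_neg]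
  have hIK : ∀ x, I (K x) = - J x := by
    intro x
    rw [← hIJ, hII]
  have hIself : ∀ x, ⟪x, I x⟫ = 0 := by
    intro x
    have h := hIsk x x
    rw [real_inner_comm] at h
    linarith
  have hJself : ∀ x, ⟪x, J x⟫ = 0 := by
    intro x
    have h := hJsk x x
    rw [real_inner_comm] at h
    linarith
  have hKself : ∀ x, ⟪x, K x⟫ = 0 := by
    intro x
    have h := hKsk x x
    rw [real_inner_comm] at h
    linarith
  obtain ⟨W, hWU, hW⟩ := Submodule.mem_map.1 (orthogonalProjection (U.map K) X).2
  have hWZ : W = c • Z := by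
    rw [hZ, ← hW, hKK, smul_neg, neg_smul, neg_neg, smul_smul, mul_one_div_cancel hcpos.ne', one_smul]
  have hZW : Z = (1 / c) • W := by
    rw [hWZ, smul_smul, one_div_mul_cancel hcpos.ne', one_smul]
  have hZU : Z ∈ U := by
    rw [hZW]; exact U.smul_mem _ hWU
  have key : ∀ u ∈ U, ⟪X, K u⟫ = c * ⟪Z, u⟫ := by
    intro u hu
    have h : ⟪X - ((orthogonalProjection (U.map K) X : U.map K) : V), K u⟫ = 0 :=
      Submodule.starProjection_inner_eq_zero (K := U.map K) X (K u) (Submodule.mem_map_of_mem hu)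
    rw [← hW, inner_sub_left, hKsk W, hKK, inner_neg_right, hWZ, real_inner_smul_left] at h
    linarith
  have hZX : ⟪Z, X⟫ = 0 := by
    have h := key X hXU
    rw [hKself] at h
    rcases mul_eq_zero.1 h.symm with h | h
    · exact absurd h hcpos.ne'
    · exact h
  have hZIX : ⟪Z, I X⟫ = 0 := by
    have h := key (I X) (hIU _ hXU)
    rw [hKI, hJself] at h
    rcases mul_eq_zero.1 h.symm with h | h
    · exact absurd h hcpos.ne'
    · exact h
  have hXIZ : ⟪X, I Z⟫ = 0 := by
    have h := hIsk X Z
    rw [real_inner_comm, hZIX] at h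
    linarith
  have hXX : ⟪X, X⟫ = 1 := by rw [real_inner_self_eq_norm_sq, hX1]; norm_num
  have hXY' : ⟪X₀, I Y₀⟫ = 0 := by
    have h := hIsk X₀ Y₀
    rw [hIX₀Y₀] at h
    linarith
  obtain ⟨-, -, hexp⟩ := aux_frame I hII hIsk U hU4 hIU X₀ Y₀ hX₀U hY₀U
    (by rw [real_inner_self_eq_norm_sq, hX₀1]; norm_num)
    (by rw [real_inner_self_eq_norm_sq, hY₀1]; norm_num) hX₀Y₀ hXY'
  have hc2 : c ^ 2 = ⟪X₀, J Y₀⟫ ^ 2 + ⟪X₀, K Y₀⟫ ^ 2 := by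
    rw [hc, Real.sq_sqrt (by positivity)]
  have hnorm : ∀ x ∈ U, ⟪x, x⟫ = ⟪x, X₀⟫ ^ 2 + ⟪x, Y₀⟫ ^ 2 + ⟪x, I X₀⟫ ^ 2 + ⟪x, I Y₀⟫ ^ 2 := by
    intro x hx
    have h := congrArg (fun y => ⟪x, y⟫) (hexp x hx)
    simp only [inner_add_right, real_inner_smul_right] at h
    linarith
  have hJs : ⟪Y₀, J X₀⟫ = - ⟪X₀, J Y₀⟫ := by rw [real_inner_comm, hJsk]
  have hKs : ⟪Y₀, K X₀⟫ = - ⟪X₀, K Y₀⟫ := by rw [real_inner_comm, hKsk]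
  have hX := hexp X hXU
  have hXn := hnorm X hXU
  have hZn := hnorm Z hZU
  have k1 := key X₀ hX₀U
  have k2 := key Y₀ hY₀U
  have k3 := key (I X₀) (hIU _ hX₀U)
  have k4 := key (I Y₀) (hIU _ hY₀U)
  rw [hXX] at hXn
  generalize ⟪X, X₀⟫ = a at *
  generalize ⟪X, Y₀⟫ = b at *
  generalize ⟪X, I X₀⟫ = d at *
  generalize ⟪X, I Y₀⟫ = e at *
  rw [hX] at k1 k2 k3 k4
  simp only [inner_add_left, real_inner_smul_left, hIsk, hKI, hIK, hIJ, hJself, hKself, hJs, hKs,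
    inner_neg_right] at k1 k2 k3 k4
  have hZZ : ⟪Z, Z⟫ = 1 := by
    have h : c ^ 2 * ⟪Z, Z⟫ = c ^ 2 * 1 := by
      have e1 : c ^ 2 * ⟪Z, Z⟫ = (c * ⟪Z, X₀⟫) ^ 2 + (c * ⟪Z, Y₀⟫) ^ 2 + (c * ⟪Z, I X₀⟫) ^ 2
          + (c * ⟪Z, I Y₀⟫) ^ 2 := by rw [hZn]; ring
      rw [e1, ← k1, ← k2, ← k3, ← k4, hc2, hXn]
      ring
    exact mul_left_cancel₀ (by positivity) h
  obtain ⟨hON, hsp, -⟩ := aux_frame I hII hIsk U hU4 hIU X Z hXU hZU hXX hZZ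
    (by rw [real_inner_comm]; exact hZX) hXIZ
  refine ⟨hZU, hON, hsp, ?_, ?_, ?_, hXIZ⟩
  · rw [Submodule.map_span, ← Submodule.span_union, Set.image_pair, Set.insert_union,
      Set.singleton_union]
    exact hsp.symm
  · rw [key Z hZU, hZZ, mul_one]
  · rw [← hKI, key (I Z) (hIU _ hZU), hIself, mul_zero]
end

section
/- Let U be a 4-dimensional subspace of V with I(U) = U, let (X₀, Y₀) be an I-orthonormal pair of U and set c = √(⟪X₀, J Y₀⟫² + ⟪X₀, K Y₀⟫²); assume c > 0. For a unit vector X ∈ U set Z = −(1/c)·K(proj_{K(U)}(X)), and let (e₁, e₂, e₃, e₄) = (X, Z, I X, I Z). Then the characteristic deviation (1/6)·Σ_{1 ≤ r < s ≤ 4} (⟪e_r, I e_s⟫² + ⟪e_r, J e_s⟫² + ⟪e_r, K e_s⟫²) equals (2c² + 1)/3. -/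
open RealInnerProductSpace Module Submodule

theorem expand_aux_s10 {V : Type*} [NormedAddCommGroup V] [InnerProductSpace ℝ V]
    (U : Submodule ℝ V) (hU4 : finrank ℝ U = 4)
    (a b c d : V) (ha : a ∈ U) (hb : b ∈ U) (hc : c ∈ U) (hd : d ∈ U)
    (haa : ⟪a, a⟫ = 1) (hbb : ⟪b, b⟫ = 1) (hcc : ⟪c, c⟫ = 1) (hdd : ⟪d, d⟫ = 1)
    (hab : ⟪a, b⟫ = 0) (hac : ⟪a, c⟫ = 0) (had : ⟪a, d⟫ = 0)
    (hbc : ⟪b, c⟫ = 0) (hbd : ⟪b, d⟫ = 0) (hcd : ⟪c, d⟫ = 0) (u : V) (hu : u ∈ U) :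
    u = ⟪a, u⟫ • a + ⟪b, u⟫ • b + ⟪c, u⟫ • c + ⟪d, u⟫ • d := by
  let v : Fin 4 → U := ![⟨a, ha⟩, ⟨b, hb⟩, ⟨c, hc⟩, ⟨d, hd⟩]
  have hv : Orthonormal ℝ v := by
    rw [orthonormal_iff_ite]
    have hba := real_inner_comm a b ▸ hab
    have hca := real_inner_comm a c ▸ hac
    have hda := real_inner_comm a d ▸ had
    have hcb := real_inner_comm b c ▸ hbc
    have hdb := real_inner_comm b d ▸ hbd
    have hdc := real_inner_comm c d ▸ hcd
    intro i j
    fin_cases i <;> fin_cases j <;> simp [v, Submodule.coe_inner, *, -real_inner_self_eq_norm_sq, -inner_self_eq_norm_sq_to_K]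
  haveI : FiniteDimensional ℝ U := FiniteDimensional.of_finrank_pos (by omega)
  have hs : ⊤ ≤ span ℝ (Set.range v) :=
    (hv.linearIndependent.span_eq_top_of_card_eq_finrank (by simp [hU4])).ge
  have h := (OrthonormalBasis.mk hv hs).sum_repr' ⟨u, hu⟩
  have h2 := congrArg (fun x : U => (x : V)) h
  simp [Fin.sum_univ_four, v, Submodule.coe_inner] at h2
  exact h2.symm

/-- The characteristic deviation of a 4-dimensional `I`-complex subspace with
`I⊥`-Kähler angle `θ` (with `cos θ = c`) equals `(2c² + 1)/3`. -/
theorem stmt_10 {V : Type*} [NormedAddCommGroup V] [InnerProductSpace ℝ V]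
    [FiniteDimensional ℝ V]
    (I J K : V →ₗ[ℝ] V)
    (hII : ∀ x, I (I x) = -x) (hJJ : ∀ x, J (J x) = -x) (hKK : ∀ x, K (K x) = -x)
    (hIJ : ∀ x, I (J x) = K x) (hJI : ∀ x, J (I x) = -K x)
    (hIsk : ∀ x y, ⟪I x, y⟫ = -⟪x, I y⟫)
    (hJsk : ∀ x y, ⟪J x, y⟫ = -⟪x, J y⟫)
    (hKsk : ∀ x y, ⟪K x, y⟫ = -⟪x, K y⟫)
    (U : Submodule ℝ V) (hU4 : finrank ℝ U = 4) (hUI : U.map I = U)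
    (X₀ Y₀ : V) (hX₀U : X₀ ∈ U) (hY₀U : Y₀ ∈ U)
    (hX₀1 : ‖X₀‖ = 1) (hY₀1 : ‖Y₀‖ = 1) (hX₀Y₀ : ⟪X₀, Y₀⟫ = 0) (hIX₀Y₀ : ⟪I X₀, Y₀⟫ = 0)
    (c : ℝ) (hc : c = Real.sqrt (⟪X₀, J Y₀⟫ ^ 2 + ⟪X₀, K Y₀⟫ ^ 2)) (hcpos : 0 < c)
    (X : V) (hXU : X ∈ U) (hX1 : ‖X‖ = 1)
    (Z : V)
    (hZ : Z = -(1 / c) • K ((orthogonalProjection (U.map K) X : U.map K) : V))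
    (e : Fin 4 → V) (he : e = ![X, Z, I X, I Z]) :
    (1 / 6 : ℝ) *
      ∑ p ∈ Finset.univ.filter (fun p : Fin 4 × Fin 4 => p.1 < p.2),
        (⟪e p.1, I (e p.2)⟫ ^ 2 + ⟪e p.1, J (e p.2)⟫ ^ 2 + ⟪e p.1, K (e p.2)⟫ ^ 2)
      = (2 * c ^ 2 + 1) / 3 := by
  have hc2 : c ^ 2 = ⟪X₀, J Y₀⟫ ^ 2 + ⟪X₀, K Y₀⟫ ^ 2 := by
    rw [hc, Real.sq_sqrt (by positivity)]
  have hIK : ∀ x, I (K x) = -J x := fun x => by rw [← hIJ, hII]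
  have hKI : ∀ x, K (I x) = J x := fun x => by rw [← hIJ, hJI, map_neg, hIK, neg_neg]
  have hIU : ∀ x ∈ U, I x ∈ U := fun x hx => hUI ▸ Submodule.mem_map_of_mem hx
  have hself : ∀ (A : V →ₗ[ℝ] V), (∀ x y, ⟪A x, y⟫ = -⟪x, A y⟫) → ∀ x, ⟪x, A x⟫ = 0 := by
    intro A hA x
    have := hA x x
    rw [real_inner_comm] at this
    linarith
  have hI0 := hself I hIsk
  have hJ0 := hself J hJsk
  have hK0 := hself K hKsk
  have hX₀X₀ : ⟪X₀, X₀⟫ = 1 := by rw [real_inner_self_eq_norm_sq, hX₀1]; norm_num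
  have hY₀Y₀ : ⟪Y₀, Y₀⟫ = 1 := by rw [real_inner_self_eq_norm_sq, hY₀1]; norm_num
  have hXX : ⟪X, X⟫ = 1 := by rw [real_inner_self_eq_norm_sq, hX1]; norm_num
  have hXIY : ⟪X₀, I Y₀⟫ = 0 := by have := hIsk X₀ Y₀; linarith
  have hex := expand_aux_s10 U hU4 X₀ (I X₀) Y₀ (I Y₀) hX₀U (hIU _ hX₀U) hY₀U (hIU _ hY₀U)
    hX₀X₀ (by rw [hIsk, hII, inner_neg_right, hX₀X₀, neg_neg]) hY₀Y₀
    (by rw [hIsk, hII, inner_neg_right, hY₀Y₀, neg_neg]) (hI0 _) hX₀Y₀ hXIY hIX₀Y₀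
    (by rw [hIsk, hII, inner_neg_right, hX₀Y₀]; simp) (hI0 _)
  -- the vector w with P X = K w
  obtain ⟨w, hwU, hw⟩ := Submodule.mem_map.1 (orthogonalProjection (U.map K) X).2
  have hwZ : Z = (1 / c) • w := by rw [hZ, ← hw, hKK]; simp
  have hwu : ∀ u ∈ U, ⟪w, u⟫ = ⟪X, K u⟫ := by
    intro u hu
    have h1 : ⟪X - ((orthogonalProjection (U.map K) X : U.map K) : V), K u⟫ = 0 :=
      Submodule.starProjection_inner_eq_zero X (K u) (Submodule.mem_map_of_mem hu)
    rw [← hw, inner_sub_left, hKsk, hKK, inner_neg_right] at h1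
    linarith
  have hww : ⟪w, w⟫ = c ^ 2 := by
    have hpars : ∀ u ∈ U, ⟪u, u⟫ = ⟪X₀, u⟫ ^ 2 + ⟪I X₀, u⟫ ^ 2 + ⟪Y₀, u⟫ ^ 2 + ⟪I Y₀, u⟫ ^ 2 := by
      intro u hu
      have h := congrArg (fun t => ⟪t, u⟫) (hex u hu)
      simp only [inner_add_left, real_inner_smul_left] at h
      rw [h]; ring
    have hXe := hex X hXU
    have hXp := hpars X hXU
    rw [hXX] at hXp
    have q : ∀ u ∈ U, ⟪u, w⟫ = ⟪X₀, X⟫ * ⟪X₀, K u⟫ + ⟪I X₀, X⟫ * ⟪I X₀, K u⟫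
        + ⟪Y₀, X⟫ * ⟪Y₀, K u⟫ + ⟪I Y₀, X⟫ * ⟪I Y₀, K u⟫ := by
      intro u hu
      rw [real_inner_comm, hwu u hu]
      conv_lhs => rw [hXe]
      simp only [inner_add_left, real_inner_smul_left]
    have hYJ : ⟪Y₀, J X₀⟫ = -⟪X₀, J Y₀⟫ := by rw [← hJsk, real_inner_comm]
    have hYK : ⟪Y₀, K X₀⟫ = -⟪X₀, K Y₀⟫ := by rw [← hKsk, real_inner_comm]
    rw [hpars w hwU, q _ hX₀U, q _ hY₀U, q _ (hIU _ hX₀U), q _ (hIU _ hY₀U)]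
    simp only [hKI, hIsk _ (K _), hIsk _ (J _), hIK, hIJ, hK0, hJ0, hYJ, hYK, inner_neg_right]
    rw [hc2]
    linear_combination (-(⟪X₀, J Y₀⟫ ^ 2 + ⟪X₀, K Y₀⟫ ^ 2)) * hXp
  have hne := hcpos.ne'
  have hZU : Z ∈ U := hwZ ▸ U.smul_mem _ hwU
  have hZu : ∀ u ∈ U, ⟪Z, u⟫ = (1 / c) * ⟪X, K u⟫ := by
    intro u hu; rw [hwZ, real_inner_smul_left, hwu u hu]
  have hZZ : ⟪Z, Z⟫ = 1 := by
    rw [hwZ, real_inner_smul_left, real_inner_smul_right, hww]; field_simp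
  have hXKZ : ⟪X, K Z⟫ = c := by
    have := hZu Z hZU
    rw [hZZ] at this; field_simp at this; linarith
  have hXJZ : ⟪X, J Z⟫ = 0 := by
    have := hZu (I Z) (hIU _ hZU)
    rw [hI0, hKI] at this; field_simp at this; linarith
  have hZX : ⟪Z, X⟫ = 0 := by rw [hZu X hXU, hK0, mul_zero]
  have hXZ : ⟪X, Z⟫ = 0 := by rw [real_inner_comm, hZX]
  have hZIX : ⟪Z, I X⟫ = 0 := by rw [hZu _ (hIU _ hXU), hKI, hJ0, mul_zero]
  have hXIZ : ⟪X, I Z⟫ = 0 := by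
    have := hIsk X Z
    rw [real_inner_comm, hZIX] at this; linarith
  have hZJX : ⟪Z, J X⟫ = 0 := by have := hJsk Z X; rw [real_inner_comm, hXJZ] at this; linarith
  have hZKX : ⟪Z, K X⟫ = -c := by have := hKsk Z X; rw [real_inner_comm, hXKZ] at this; linarith
  have hfil : (Finset.univ.filter (fun p : Fin 4 × Fin 4 => p.1 < p.2))
      = {(0, 1), (0, 2), (0, 3), (1, 2), (1, 3), (2, 3)} := by decide
  have e0 : e 0 = X := by rw [he]; rfl
  have e1 : e 1 = Z := by rw [he]; rfl
  have e2 : e 2 = I X := by rw [he]; rfl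
  have e3 : e 3 = I Z := by rw [he]; rfl
  rw [hfil, Finset.sum_insert (by decide), Finset.sum_insert (by decide),
    Finset.sum_insert (by decide), Finset.sum_insert (by decide),
    Finset.sum_insert (by decide), Finset.sum_singleton]
  simp only [e0, e1, e2, e3, hII, hJI, hKI, hIsk, hIK, hIJ, hK0, hJ0, hI0, inner_neg_right,
    hXX, hZZ, hXKZ, hXJZ, hXZ, hZX, hZIX, hXIZ, hZJX, hZKX, map_neg]
  ring
end

section
/- Let U be a 4-dimensional subspace of V with I(U) = U, let (X₀, Y₀) be an I-orthonormal pair of U and set c = √(⟪X₀, J Y₀⟫² + ⟪X₀, K Y₀⟫²); assume c > 0 (U is not totally complex). For a unit vector X₁ ∈ U set Y₂ = −(1/c)·J(proj_{J(U)}(X₁)) and Z₂ = −(1/c)·K(proj_{K(U)}(X₁)). Then Y₂ = −I Z₂, and the four vectors (X₁, −I X₁, Y₂, Z₂) form an orthonormal basis of U; in particular ⟪−I X₁, Y₂⟫ = 0, ⟪−I X₁, Z₂⟫ = 0 and ⟪Y₂, Z₂⟫ = 0 (i.e. the invariants ξ, χ, η of U all vanish). -/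
open RealInnerProductSpace Module Submodule

theorem orth4 {V : Type*} [NormedAddCommGroup V] [InnerProductSpace ℝ V] (a b c d : V)
    (ha : ⟪a, a⟫ = 1) (hb : ⟪b, b⟫ = 1) (hc : ⟪c, c⟫ = 1) (hd : ⟪d, d⟫ = 1)
    (hab : ⟪a, b⟫ = 0) (hac : ⟪a, c⟫ = 0) (had : ⟪a, d⟫ = 0) (hbc : ⟪b, c⟫ = 0)
    (hbd : ⟪b, d⟫ = 0) (hcd : ⟪c, d⟫ = 0) : Orthonormal ℝ ![a, b, c, d] := by
  rw [orthonormal_iff_ite]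
  intro i j
  fin_cases i <;> fin_cases j <;> simp [-real_inner_self_eq_norm_sq, -inner_self_eq_norm_sq_to_K] <;>
    first
    | assumption
    | (rw [real_inner_comm]; assumption)
    | (left; rw [norm_eq_sqrt_real_inner]; simp only [ha, hb, hc, hd, Real.sqrt_one])

theorem span4 {V : Type*} [NormedAddCommGroup V] [InnerProductSpace ℝ V]
    [FiniteDimensional ℝ V] (U : Submodule ℝ V) (hU : finrank ℝ U = 4) (a b c d : V)
    (ha : a ∈ U) (hb : b ∈ U) (hc : c ∈ U) (hd : d ∈ U)
    (h : Orthonormal ℝ ![a, b, c, d]) :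
    Submodule.span ℝ ({a, b, c, d} : Set V) = U := by
  have hr : Set.range ![a, b, c, d] = {a, b, c, d} := by
    ext x; simp [Matrix.range_cons]; tauto
  rw [← hr]
  apply Submodule.eq_of_le_of_finrank_eq
  · rw [Submodule.span_le, hr]
    rintro x (rfl | rfl | rfl | rfl) <;> assumption
  · rw [finrank_span_eq_card h.linearIndependent, hU]; simp

/-- For a 4-dimensional `I`-complex subspace which is not totally complex,
`Y₂ = −I Z₂` and `(X₁, −I X₁, Y₂, Z₂)` is an orthonormal basis of `U`; in
particular the invariants `ξ, χ, η` all vanish. -/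
theorem stmt_11 {V : Type*} [NormedAddCommGroup V] [InnerProductSpace ℝ V]
    [FiniteDimensional ℝ V]
    (I J K : V →ₗ[ℝ] V)
    (hII : ∀ x, I (I x) = -x) (hJJ : ∀ x, J (J x) = -x) (hKK : ∀ x, K (K x) = -x)
    (hIJ : ∀ x, I (J x) = K x) (hJI : ∀ x, J (I x) = -K x)
    (hIsk : ∀ x y, ⟪I x, y⟫ = -⟪x, I y⟫)
    (hJsk : ∀ x y, ⟪J x, y⟫ = -⟪x, J y⟫)
    (hKsk : ∀ x y, ⟪K x, y⟫ = -⟪x, K y⟫)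
    (U : Submodule ℝ V) (hU4 : finrank ℝ U = 4) (hUI : U.map I = U)
    (X₀ Y₀ : V) (hX₀U : X₀ ∈ U) (hY₀U : Y₀ ∈ U)
    (hX₀1 : ‖X₀‖ = 1) (hY₀1 : ‖Y₀‖ = 1) (hX₀Y₀ : ⟪X₀, Y₀⟫ = 0) (hIX₀Y₀ : ⟪I X₀, Y₀⟫ = 0)
    (c : ℝ) (hc : c = Real.sqrt (⟪X₀, J Y₀⟫ ^ 2 + ⟪X₀, K Y₀⟫ ^ 2)) (hcpos : 0 < c)
    (X₁ : V) (hX₁U : X₁ ∈ U) (hX₁1 : ‖X₁‖ = 1)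
    (Y₂ Z₂ : V)
    (hY₂ : Y₂ = -(1 / c) • J ((orthogonalProjection (U.map J) X₁ : U.map J) : V))
    (hZ₂ : Z₂ = -(1 / c) • K ((orthogonalProjection (U.map K) X₁ : U.map K) : V)) :
    Y₂ = -(I Z₂) ∧ Orthonormal ℝ ![X₁, -(I X₁), Y₂, Z₂] ∧
      Submodule.span ℝ ({X₁, -(I X₁), Y₂, Z₂} : Set V) = U ∧
      ⟪-(I X₁), Y₂⟫ = 0 ∧ ⟪-(I X₁), Z₂⟫ = 0 ∧ ⟪Y₂, Z₂⟫ = 0 := by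
  have KI : ∀ x, K (I x) = J x := fun x => by
    rw [← hIJ, hJI, map_neg, ← hIJ, hII, neg_neg]
  have IK : ∀ x, I (K x) = - J x := fun x => by rw [← hIJ, hII]
  have IU : ∀ x ∈ U, I x ∈ U := fun x hx => by
    have := Submodule.mem_map_of_mem (f := I) hx
    rwa [hUI] at this
  have sI : ∀ x, ⟪x, I x⟫ = 0 := fun x => by
    have := hIsk x x; rw [real_inner_comm] at this; linarith
  have sJ : ∀ x, ⟪x, J x⟫ = 0 := fun x => by
    have := hJsk x x; rw [real_inner_comm] at this; linarith
  have sK : ∀ x, ⟪x, K x⟫ = 0 := fun x => by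
    have := hKsk x x; rw [real_inner_comm] at this; linarith
  have iI : ∀ x y, ⟪I x, I y⟫ = ⟪x, y⟫ := fun x y => by
    rw [hIsk, hII, inner_neg_right, neg_neg]
  have iJ : ∀ x y, ⟪J x, J y⟫ = ⟪x, y⟫ := fun x y => by
    rw [hJsk, hJJ, inner_neg_right, neg_neg]
  have iK : ∀ x y, ⟪K x, K y⟫ = ⟪x, y⟫ := fun x y => by
    rw [hKsk, hKK, inner_neg_right, neg_neg]
  obtain ⟨u, hu, hup⟩ := (orthogonalProjection (U.map J) X₁).2
  obtain ⟨v, hv, hvp⟩ := (orthogonalProjection (U.map K) X₁).2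
  have hu1 : ∀ w ∈ U, ⟪u, w⟫ = ⟪X₁, J w⟫ := fun w hw => by
    have := (U.map J).starProjection_inner_eq_zero X₁ (J w) (Submodule.mem_map_of_mem hw)
    rw [Submodule.starProjection_apply, ← hup, inner_sub_left, iJ] at this
    linarith
  have hv1 : ∀ w ∈ U, ⟪v, w⟫ = ⟪X₁, K w⟫ := fun w hw => by
    have := (U.map K).starProjection_inner_eq_zero X₁ (K w) (Submodule.mem_map_of_mem hw)
    rw [Submodule.starProjection_apply, ← hvp, inner_sub_left, iK] at this
    linarith
  rw [← hup, hJJ] at hY₂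
  rw [← hvp, hKK] at hZ₂
  have hY : Y₂ = (1 / c) • u := by rw [hY₂]; simp
  have hZ : Z₂ = (1 / c) • v := by rw [hZ₂]; simp
  clear hY₂ hZ₂ hup hvp
  have huv : u = - I v := by
    have hm : u + I v ∈ U := U.add_mem hu (IU v hv)
    have : ⟪u + I v, u + I v⟫ = 0 := by
      rw [inner_add_left, hu1 _ hm, hIsk, hv1 _ (IU _ hm), KI]; ring
    exact eq_neg_of_add_eq_zero_left (inner_self_eq_zero.1 this)
  have hX00 : ⟪X₀, X₀⟫ = 1 := by rw [real_inner_self_eq_norm_sq, hX₀1]; norm_num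
  have hY00 : ⟪Y₀, Y₀⟫ = 1 := by rw [real_inner_self_eq_norm_sq, hY₀1]; norm_num
  have hX11 : ⟪X₁, X₁⟫ = 1 := by rw [real_inner_self_eq_norm_sq, hX₁1]; norm_num
  have hXIY : ⟪X₀, I Y₀⟫ = 0 := by have := hIsk X₀ Y₀; linarith
  have ho := orth4 X₀ (I X₀) Y₀ (I Y₀) hX00 (by rw [iI, hX00]) hY00 (by rw [iI, hY00])
    (sI _) hX₀Y₀ hXIY hIX₀Y₀ (by rw [iI, hX₀Y₀]) (sI _)
  have hs := span4 U hU4 _ _ _ _ hX₀U (IU _ hX₀U) hY₀U (IU _ hY₀U) ho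
  have hcoef : ∀ x ∈ U, ∃ p q r s : ℝ, x = p • X₀ + q • I X₀ + r • Y₀ + s • I Y₀ := by
    intro x hx
    rw [← hs] at hx
    simp only [Submodule.mem_span_insert, Submodule.mem_span_singleton] at hx
    obtain ⟨p, _, ⟨q, _, ⟨r, _, ⟨s, rfl⟩, rfl⟩, rfl⟩, rfl⟩ := hx
    exact ⟨p, q, r, s, by abel⟩
  have hnu : ⟪u, u⟫ = c ^ 2 := by
    have hc2 : c ^ 2 = ⟪X₀, J Y₀⟫ ^ 2 + ⟪X₀, K Y₀⟫ ^ 2 := by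
      rw [hc, Real.sq_sqrt (by positivity)]
    obtain ⟨p, q, r, s, hx⟩ := hcoef X₁ hX₁U
    obtain ⟨p', q', r', s', hu'⟩ := hcoef u hu
    have hYX : ⟪Y₀, X₀⟫ = 0 := by rw [real_inner_comm]; exact hX₀Y₀
    have hYJ : ⟪Y₀, J X₀⟫ = - ⟪X₀, J Y₀⟫ := by rw [real_inner_comm, hJsk]
    have hYK : ⟪Y₀, K X₀⟫ = - ⟪X₀, K Y₀⟫ := by rw [real_inner_comm, hKsk]
    have hYI : ⟪Y₀, I X₀⟫ = 0 := by rw [real_inner_comm]; exact hIX₀Y₀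
    have e1 := hu1 _ hX₀U
    have e2 := hu1 _ (IU _ hX₀U)
    have e3 := hu1 _ hY₀U
    have e4 := hu1 _ (IU _ hY₀U)
    have hp : p ^ 2 + q ^ 2 + r ^ 2 + s ^ 2 = 1 := by
      rw [← hX11, hx]
      simp only [inner_add_left, inner_add_right, real_inner_smul_left, real_inner_smul_right,
        hIsk, hII, inner_neg_right, sI, hX00, hY00, hX₀Y₀, hYX, hXIY, hYI]
      ring
    have hn : ⟪u, u⟫ = p' ^ 2 + q' ^ 2 + r' ^ 2 + s' ^ 2 := by
      rw [hu']
      simp only [inner_add_left, inner_add_right, real_inner_smul_left, real_inner_smul_right,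
        hIsk, hII, inner_neg_right, sI, hX00, hY00, hX₀Y₀, hYX, hXIY, hYI]
      ring
    rw [hu', hx] at e1 e2 e3 e4
    simp only [inner_add_left, inner_add_right, real_inner_smul_left, real_inner_smul_right,
        hIsk, hII, inner_neg_right, sI, sJ, sK, hIJ, hJI, IK, hX00, hY00, hX₀Y₀, hYX, hXIY, hYI,
        hYJ, hYK] at e1 e2 e3 e4
    ring_nf at e1 e2 e3 e4
    rw [hn, hc2, e1, e2, e3, e4]
    linear_combination (⟪X₀, J Y₀⟫ ^ 2 + ⟪X₀, K Y₀⟫ ^ 2) * hp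
  have hIvu : I u = v := by rw [huv, map_neg, hII, neg_neg]
  have hYZ : Y₂ = -(I Z₂) := by rw [hY, hZ, huv, map_smul, smul_neg]
  have hcc : (1 / c) * ((1 / c) * c ^ 2) = 1 := by field_simp
  have hvv : ⟪v, v⟫ = c ^ 2 := by rw [← hIvu, iI, hnu]
  have hXu : ⟪X₁, u⟫ = 0 := by
    rw [real_inner_comm, hu1 _ hX₁U, sJ]
  have hXv : ⟪X₁, v⟫ = 0 := by
    rw [real_inner_comm, hv1 _ hX₁U, sK]
  have hIXu : ⟪I X₁, u⟫ = 0 := by rw [hIsk, hIvu, hXv, neg_zero]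
  have hIXv : ⟪I X₁, v⟫ = 0 := by rw [← hIvu, iI, hXu]
  have huv0 : ⟪u, v⟫ = 0 := by rw [← hIvu, sI]
  have g1 : ⟪-(I X₁), Y₂⟫ = 0 := by rw [hY, inner_neg_left, real_inner_smul_right, hIXu]; simp
  have g2 : ⟪-(I X₁), Z₂⟫ = 0 := by rw [hZ, inner_neg_left, real_inner_smul_right, hIXv]; simp
  have g3 : ⟪Y₂, Z₂⟫ = 0 := by
    rw [hY, hZ, real_inner_smul_left, real_inner_smul_right, huv0]; simp
  have hO : Orthonormal ℝ ![X₁, -(I X₁), Y₂, Z₂] := by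
    apply orth4 _ _ _ _ hX11 (by rw [inner_neg_neg, iI, hX11]) _ _ (by simp [sI]) _ _ g1 g2 g3
    · rw [hY, real_inner_smul_left, real_inner_smul_right, hnu, hcc]
    · rw [hZ, real_inner_smul_left, real_inner_smul_right, hvv, hcc]
    · rw [hY, real_inner_smul_right, hXu, mul_zero]
    · rw [hZ, real_inner_smul_right, hXv, mul_zero]
  exact ⟨hYZ, hO, span4 U hU4 _ _ _ _ hX₁U (U.neg_mem (IU _ hX₁U))
    (hY ▸ U.smul_mem _ hu) (hZ ▸ U.smul_mem _ hv) hO, g1, g2, g3⟩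
end

section
/- Let U be a subspace of V of odd finite dimension, and suppose that for every compatible complex structure A there exists a constant c_A ≥ 0 with ‖proj_{A(U)}(x)‖ = c_A·‖x‖ for every x ∈ U (U is an odd-dimensional isoclinic subspace). Then ⟪x, A y⟫ = 0 for every compatible complex structure A and all x, y ∈ U; that is, U is a real Hermitian product subspace. -/
open RealInnerProductSpace Module Submodule

/-- An odd-dimensional isoclinic subspace is a real Hermitian product subspace. -/
theorem stmt_12 {V : Type*} [NormedAddCommGroup V] [InnerProductSpace ℝ V]
    [FiniteDimensional ℝ V]
    (I J K : V →ₗ[ℝ] V)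
    (hII : ∀ x, I (I x) = -x) (hJJ : ∀ x, J (J x) = -x) (hKK : ∀ x, K (K x) = -x)
    (hIJ : ∀ x, I (J x) = K x) (hJI : ∀ x, J (I x) = -K x)
    (hIsk : ∀ x y, ⟪I x, y⟫ = -⟪x, I y⟫)
    (hJsk : ∀ x y, ⟪J x, y⟫ = -⟪x, J y⟫)
    (hKsk : ∀ x y, ⟪K x, y⟫ = -⟪x, K y⟫)
    (U : Submodule ℝ V) (hodd : Odd (finrank ℝ U))
    (hiso : ∀ a b c : ℝ, a ^ 2 + b ^ 2 + c ^ 2 = 1 →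
      ∃ cA : ℝ, 0 ≤ cA ∧ ∀ x ∈ U,
        ‖((orthogonalProjection (U.map (a • I + b • J + c • K)) x :
            U.map (a • I + b • J + c • K)) : V)‖ = cA * ‖x‖) :
    ∀ a b c : ℝ, a ^ 2 + b ^ 2 + c ^ 2 = 1 →
      ∀ x ∈ U, ∀ y ∈ U, ⟪x, (a • I + b • J + c • K) y⟫ = 0 := by
  intro a b c habc
  obtain ⟨cA, -, hc⟩ := hiso a b c habc
  set A : V →ₗ[ℝ] V := a • I + b • J + c • K with hA
  have hsk : ∀ x y, ⟪A x, y⟫ = -⟪x, A y⟫ := by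
    intro x y
    simp only [hA, LinearMap.add_apply, LinearMap.smul_apply, inner_add_left, inner_add_right,
      real_inner_smul_left, real_inner_smul_right, hIsk, hJsk, hKsk]
    ring
  let T : U →ₗ[ℝ] U := (U.orthogonalProjection : V →ₗ[ℝ] U) ∘ₗ A ∘ₗ U.subtype
  have hT : ∀ x y : U, ⟪T x, y⟫ = ⟪A x, (y : V)⟫ := by
    intro x y
    simp [T]
  have hadj : LinearMap.adjoint T = -T := by
    symm
    rw [LinearMap.eq_adjoint_iff]
    intro x y
    rw [LinearMap.neg_apply, inner_neg_left, hT, ← real_inner_comm x (T y), hT, hsk (y : V) x,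
      real_inner_comm]
  have hdet : LinearMap.det T = 0 := by
    have h1 : LinearMap.det (LinearMap.adjoint T) = LinearMap.det T := by
      let e := stdOrthonormalBasis ℝ U
      rw [← LinearMap.det_toMatrix e.toBasis, LinearMap.toMatrix_adjoint,
        Matrix.conjTranspose_eq_transpose_of_trivial, Matrix.det_transpose, LinearMap.det_toMatrix]
    rw [hadj, ← neg_one_smul ℝ T, LinearMap.det_smul, hodd.neg_one_pow] at h1
    linarith
  obtain ⟨u, hu, hu0⟩ := (Submodule.ne_bot_iff _).1 (LinearMap.bot_lt_ker_of_det_eq_zero hdet).ne'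
  have hu1 : ∀ y ∈ U, ⟪A u, y⟫ = 0 := by
    intro y hy
    rw [← hT u ⟨y, hy⟩, LinearMap.mem_ker.1 hu, inner_zero_left]
  have hP : (orthogonalProjection (U.map A) (u : V)) = 0 := by
    rw [orthogonalProjection_eq_zero_iff, Submodule.mem_orthogonal']
    rintro _ ⟨y, hy, rfl⟩
    have := hu1 y hy
    rw [hsk] at this
    linarith
  have hcA : cA = 0 := by
    have := hc u u.2
    rw [hP] at this
    simpa [hu0] using this
  intro x hx y hy
  have h := hc x hx
  rw [hcA, zero_mul, norm_eq_zero, ZeroMemClass.coe_eq_zero, orthogonalProjection_eq_zero_iff,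
    Submodule.mem_orthogonal'] at h
  exact h _ (Submodule.mem_map_of_mem hy)
end

section
/- Every subspace U of V admits an orthogonal decomposition U = U_Q ⊕ U₁ ⊕ … ⊕ U_p ⊕ U_R into pairwise strictly orthogonal subspaces, where U_Q is quaternionic and contains every quaternionic subspace of U, each U_i is a nonzero pure subspace with I_i(U_i) = U_i for some compatible complex structure I_i, and U_R is totally real. -/
open RealInnerProductSpace Module Submodule

/-- A subspace stable under an operator of square `-1` equals its image. -/
theorem map_eq_of_stable {V : Type*} [AddCommGroup V] [Module ℝ V] (A : V →ₗ[ℝ] V)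
    (hA : ∀ x, A (A x) = -x) (S : Submodule ℝ V) (h : ∀ x ∈ S, A x ∈ S) : S.map A = S := by
  apply le_antisymm
  · rintro _ ⟨x, hx, rfl⟩
    exact h x hx
  · intro x hx
    exact ⟨-(A x), S.neg_mem (h x hx), by simp [hA]⟩

/-- Greedy orthogonal decomposition. -/
theorem greedy_decomp {V : Type*} [NormedAddCommGroup V] [InnerProductSpace ℝ V]
    [FiniteDimensional ℝ V] (T C : Submodule ℝ V → Prop)
    (h : ∀ W, T W ∨ ∃ L ≤ W, L ≠ ⊥ ∧ C L) (W : Submodule ℝ V) :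
    ∃ (p : ℕ) (UR : Submodule ℝ V) (Us : Fin p → Submodule ℝ V),
      (⨆ i, Us i) ⊔ UR = W ∧
      (∀ i j, i ≠ j → ∀ x ∈ Us i, ∀ y ∈ Us j, ⟪x, y⟫ = 0) ∧
      (∀ i, ∀ x ∈ Us i, ∀ y ∈ UR, ⟪x, y⟫ = 0) ∧
      (∀ i, Us i ≠ ⊥) ∧ (∀ i, C (Us i)) ∧ T UR := by
  induction W using WellFoundedLT.induction with
  | _ W ih =>
  rcases h W with hT | ⟨L, hLW, hL0, hC⟩
  · exact ⟨0, W, fun i => i.elim0, by simp, fun i => i.elim0, fun i => i.elim0,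
      fun i => i.elim0, fun i => i.elim0, hT⟩
  · have hlt : Lᗮ ⊓ W < W := by
      refine lt_of_le_of_ne inf_le_right fun he => hL0 ?_
      have h1 : L ≤ Lᗮ := hLW.trans (inf_eq_right.mp he)
      rw [eq_bot_iff, ← Submodule.inf_orthogonal_eq_bot L]
      exact le_inf le_rfl h1
    obtain ⟨p, UR, Us, hsup, h1, h2, h3, h4, h5⟩ := ih _ hlt
    have hUs : ∀ i, Us i ≤ Lᗮ := fun i =>
      (le_iSup Us i).trans (le_sup_left.trans (hsup.le.trans inf_le_left))
    have hUR : UR ≤ Lᗮ := le_sup_right.trans (hsup.le.trans inf_le_left)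
    refine ⟨p + 1, UR, Fin.cons L Us, ?_, ?_, ?_, ?_, ?_, h5⟩
    · have : (⨆ i, (Fin.cons L Us : Fin (p+1) → Submodule ℝ V) i) = L ⊔ ⨆ i, Us i := by
        apply le_antisymm
        · refine iSup_le fun i => ?_
          refine Fin.cases ?_ (fun i => ?_) i
          · exact le_sup_left
          · exact (le_iSup Us i).trans le_sup_right
        · refine sup_le ?_ (iSup_le fun i => ?_)
          · exact le_iSup (Fin.cons L Us : Fin (p+1) → Submodule ℝ V) 0
          · exact le_iSup (Fin.cons L Us : Fin (p+1) → Submodule ℝ V) i.succ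
      rw [this, sup_assoc, hsup]
      exact Submodule.sup_orthogonal_inf_of_hasOrthogonalProjection hLW
    · intro i j
      refine Fin.cases ?_ (fun i => ?_) i <;> refine Fin.cases ?_ (fun j => ?_) j
      · intro h0
        exact absurd rfl h0
      · intro _ x hx y hy
        exact (Submodule.mem_orthogonal L y).mp (hUs j hy) x hx
      · intro _ x hx y hy
        exact (Submodule.mem_orthogonal' L x).mp (hUs i hx) y hy
      · intro hij x hx y hy
        exact h1 i j (fun e => hij (e ▸ rfl)) x hx y hy
    · intro i
      refine Fin.cases ?_ (fun i => ?_) i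
      · intro x hx y hy
        exact (Submodule.mem_orthogonal L y).mp (hUR hy) x hx
      · exact h2 i
    · intro i
      exact Fin.cases hL0 (fun i => h3 i) i
    · intro i
      exact Fin.cases hC (fun i => h4 i) i

/-- Every subspace `U` of a Hermitian quaternionic vector space admits an
orthogonal decomposition `U = U_Q ⊕ U₁ ⊕ … ⊕ U_p ⊕ U_R` with `U_Q` the maximal
quaternionic subspace, each `U_i` a nonzero pure `I_i`-complex subspace, and
`U_R` totally real. -/
theorem stmt_13 {V : Type*} [NormedAddCommGroup V] [InnerProductSpace ℝ V]
    [FiniteDimensional ℝ V]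
    (I J K : V →ₗ[ℝ] V)
    (hII : ∀ x, I (I x) = -x) (hJJ : ∀ x, J (J x) = -x) (hKK : ∀ x, K (K x) = -x)
    (hIJ : ∀ x, I (J x) = K x) (hJI : ∀ x, J (I x) = -K x)
    (hIsk : ∀ x y, ⟪I x, y⟫ = -⟪x, I y⟫)
    (hJsk : ∀ x y, ⟪J x, y⟫ = -⟪x, J y⟫)
    (hKsk : ∀ x y, ⟪K x, y⟫ = -⟪x, K y⟫)
    (U : Submodule ℝ V) :
    ∃ (p : ℕ) (UQ UR : Submodule ℝ V) (Us : Fin p → Submodule ℝ V),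
      UQ ⊔ (⨆ i, Us i) ⊔ UR = U ∧
      (∀ i, ∀ x ∈ UQ, ∀ y ∈ Us i, ⟪x, y⟫ = 0) ∧
      (∀ x ∈ UQ, ∀ y ∈ UR, ⟪x, y⟫ = 0) ∧
      (∀ i j, i ≠ j → ∀ x ∈ Us i, ∀ y ∈ Us j, ⟪x, y⟫ = 0) ∧
      (∀ i, ∀ x ∈ Us i, ∀ y ∈ UR, ⟪x, y⟫ = 0) ∧
      (UQ.map I = UQ ∧ UQ.map J = UQ ∧ UQ.map K = UQ) ∧
      (∀ S : Submodule ℝ V, S ≤ U → S.map I = S → S.map J = S → S.map K = S → S ≤ UQ) ∧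
      (∀ i, Us i ≠ ⊥) ∧
      (∀ i, ∀ S : Submodule ℝ V, S ≤ Us i →
        S.map I = S → S.map J = S → S.map K = S → S = ⊥) ∧
      (∀ i, ∃ a b c : ℝ, a ^ 2 + b ^ 2 + c ^ 2 = 1 ∧
        (Us i).map (a • I + b • J + c • K) = Us i) ∧
      (∀ a b c : ℝ, a ^ 2 + b ^ 2 + c ^ 2 = 1 →
        (UR.map (a • I + b • J + c • K)) ⊓ UR = ⊥) := by
  have hJK : ∀ x, J (K x) = I x := fun x => by
    rw [← hIJ, hJI, ← hIJ, hJJ]; simp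
  have hKJ : ∀ x, K (J x) = -I x := fun x => by
    rw [← hIJ, hJJ]; simp
  have hIK : ∀ x, I (K x) = -J x := fun x => by
    rw [← hIJ, hII]
  have hKI : ∀ x, K (I x) = J x := fun x => by
    rw [← hIJ, hJI, map_neg, hIK, neg_neg]
  have hAA : ∀ a b c : ℝ, a ^ 2 + b ^ 2 + c ^ 2 = 1 →
      ∀ x, (a • I + b • J + c • K) ((a • I + b • J + c • K) x) = -x := by
    intro a b c habc x
    simp only [LinearMap.add_apply, LinearMap.smul_apply, map_add, map_smul,
      hII, hJJ, hKK, hIJ, hJI, hJK, hKJ, hIK, hKI]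
    have : -x = -((a ^ 2 + b ^ 2 + c ^ 2) • x) := by rw [habc, one_smul]
    refine Eq.trans ?_ this.symm
    module
  let UQ : Submodule ℝ V := U ⊓ U.comap I ⊓ U.comap J ⊓ U.comap K
  have hmem : ∀ x, x ∈ UQ ↔ ((x ∈ U ∧ I x ∈ U) ∧ J x ∈ U) ∧ K x ∈ U := fun x => Iff.rfl
  have hUQU : UQ ≤ U := fun x hx => hx.1.1.1
  have hmax : ∀ S : Submodule ℝ V, S ≤ U → S.map I = S → S.map J = S → S.map K = S →
      S ≤ UQ := by
    intro S hS hI hJ hK x hx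
    rw [hmem]
    exact ⟨⟨⟨hS hx, hS (hI.le ⟨x, hx, rfl⟩)⟩, hS (hJ.le ⟨x, hx, rfl⟩)⟩,
      hS (hK.le ⟨x, hx, rfl⟩)⟩
  obtain ⟨p, UR, Us, hsup, h1, h2, h3, h4, h5⟩ := greedy_decomp
    (fun W => ∀ a b c : ℝ, a ^ 2 + b ^ 2 + c ^ 2 = 1 →
        (W.map (a • I + b • J + c • K)) ⊓ W = ⊥)
    (fun W => ∃ a b c : ℝ, a ^ 2 + b ^ 2 + c ^ 2 = 1 ∧
        W.map (a • I + b • J + c • K) = W)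
    (by
      intro W
      by_contra hcon
      push Not at hcon
      obtain ⟨⟨a, b, c, habc, hne⟩, hno⟩ := hcon
      obtain ⟨x, ⟨⟨y, hy, hyx⟩, hx⟩, hx0⟩ := Submodule.exists_mem_ne_zero_of_ne_bot hne
      refine hno (span ℝ {x, y}) ?_ ?_ a b c habc ?_
      · rw [span_le]
        rintro z (rfl | rfl)
        · exact hx
        · exact hy
      · intro hb
        have : x ∈ span ℝ {x, y} := subset_span (by simp)
        rw [hb] at this
        exact hx0 ((Submodule.mem_bot ℝ).mp this)
      · apply map_eq_of_stable _ (hAA a b c habc)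
        have hle : span ℝ {x, y} ≤ (span ℝ {x, y}).comap (a • I + b • J + c • K) := by
          rw [span_le]
          rintro z (rfl | rfl)
          · change _ ∈ span ℝ _
            rw [← hyx, hAA a b c habc, hyx]
            exact Submodule.neg_mem _ (subset_span (by simp))
          · change _ ∈ span ℝ _
            rw [hyx]
            exact subset_span (by simp)
        exact fun z hz => hle hz) (UQᗮ ⊓ U)
  have hUsW : ∀ i, Us i ≤ UQᗮ ⊓ U := fun i =>
    (le_iSup Us i).trans (le_sup_left.trans hsup.le)
  have hURW : UR ≤ UQᗮ ⊓ U := le_sup_right.trans hsup.le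
  refine ⟨p, UQ, UR, Us, ?_, ?_, ?_, h1, h2, ⟨?_, ?_, ?_⟩, hmax, h3, ?_, h4, h5⟩
  · rw [sup_assoc, hsup]
    exact Submodule.sup_orthogonal_inf_of_hasOrthogonalProjection hUQU
  · intro i x hx y hy
    exact (Submodule.mem_orthogonal UQ y).mp (hUsW i hy).1 x hx
  · intro x hx y hy
    exact (Submodule.mem_orthogonal UQ y).mp (hURW hy).1 x hx
  · refine map_eq_of_stable I hII UQ fun x hx => ?_
    rw [hmem] at hx ⊢
    simp only [hII, hJI, hKI, Submodule.neg_mem_iff]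
    tauto
  · refine map_eq_of_stable J hJJ UQ fun x hx => ?_
    rw [hmem] at hx ⊢
    simp only [hJJ, hIJ, hKJ, Submodule.neg_mem_iff]
    tauto
  · refine map_eq_of_stable K hKK UQ fun x hx => ?_
    rw [hmem] at hx ⊢
    simp only [hKK, hIK, hJK, Submodule.neg_mem_iff]
    tauto
  · intro i S hS hI hJ hK
    have hSW := hS.trans (hUsW i)
    have hSQ := hmax S (hSW.trans inf_le_right) hI hJ hK
    rw [eq_bot_iff, ← Submodule.inf_orthogonal_eq_bot UQ]
    exact le_inf hSQ (hSW.trans inf_le_left)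
end

section
/- Let X and Y be nonzero vectors of V and let I' = αI + βJ + γK be a compatible complex structure with I' ≠ I and I' ≠ −I. Set U₁ = span(X, I X) and U₂ = span(Y, I' Y). Then U₁ and U₂ are strictly orthogonal if and only if the 4-dimensional subspaces span(X, I X, J X, K X) and span(Y, I Y, J Y, K Y) are strictly orthogonal. -/
open RealInnerProductSpace Module Submodule

/-- A pair of complex 2-planes `span(X, I X)` and `span(Y, I' Y)` by different
(up to sign) complex structures are strictly orthogonal iff the quaternionic
lines `ℚ X` and `ℚ Y` are strictly orthogonal. -/
theorem stmt_15 {V : Type*} [NormedAddCommGroup V] [InnerProductSpace ℝ V]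
    [FiniteDimensional ℝ V]
    (I J K : V →ₗ[ℝ] V)
    (hII : ∀ x, I (I x) = -x) (hJJ : ∀ x, J (J x) = -x) (hKK : ∀ x, K (K x) = -x)
    (hIJ : ∀ x, I (J x) = K x) (hJI : ∀ x, J (I x) = -K x)
    (hIsk : ∀ x y, ⟪I x, y⟫ = -⟪x, I y⟫)
    (hJsk : ∀ x y, ⟪J x, y⟫ = -⟪x, J y⟫)
    (hKsk : ∀ x y, ⟪K x, y⟫ = -⟪x, K y⟫)
    (X Y : V) (hX : X ≠ 0) (hY : Y ≠ 0)
    (α β γ : ℝ) (hαβγ : α ^ 2 + β ^ 2 + γ ^ 2 = 1)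
    (I' : V →ₗ[ℝ] V) (hI' : I' = α • I + β • J + γ • K)
    (hne : I' ≠ I) (hne' : I' ≠ -I) :
    ((∀ u ∈ Submodule.span ℝ ({X, I X} : Set V),
        ∀ v ∈ Submodule.span ℝ ({Y, I' Y} : Set V), ⟪u, v⟫ = 0) ↔
      (∀ u ∈ Submodule.span ℝ ({X, I X, J X, K X} : Set V),
        ∀ v ∈ Submodule.span ℝ ({Y, I Y, J Y, K Y} : Set V), ⟪u, v⟫ = 0)) := by
  have hIK : ∀ x, I (K x) = -J x := fun x => by rw [← hIJ, hII]
  have hKJ : ∀ x, K (J x) = -I x := fun x => by rw [← hIJ, hJJ, map_neg]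
  have hJK : ∀ x, J (K x) = I x := fun x => by rw [← hIJ x, hJI, hKJ, neg_neg]
  have hKI : ∀ x, K (I x) = J x := fun x => by rw [← hIJ, hJI, map_neg, hIK, neg_neg]
  have key : ∀ S T : Set V, (∀ u ∈ Submodule.span ℝ S, ∀ v ∈ Submodule.span ℝ T, ⟪u, v⟫ = 0) ↔
      ∀ u ∈ S, ∀ v ∈ T, ⟪u, v⟫ = 0 := by
    intro S T
    constructor
    · intro h u hu v hv
      exact h u (Submodule.subset_span hu) v (Submodule.subset_span hv)
    · intro h u hu v hv
      exact (Submodule.isOrtho_span.2 (fun a ha b hb => h a ha b hb)).inner_eq hu hv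
  have hI'Y : I' Y = α • I Y + β • J Y + γ • K Y := by rw [hI']; simp
  rw [key, key]
  constructor
  · intro h
    have h1 := h X (by simp) Y (by simp)
    have h2 := h (I X) (by simp) Y (by simp)
    have h3 := h X (by simp) (I' Y) (by simp)
    have h4 := h (I X) (by simp) (I' Y) (by simp)
    rw [hIsk, neg_eq_zero] at h2
    rw [hI'Y] at h3
    rw [hIsk, neg_eq_zero, hI'Y] at h4
    simp only [map_add, map_smul, hII, hIJ, hIK, inner_add_right, inner_smul_right,
      inner_neg_right, h1, h2] at h3 h4
    have hpos : β ^ 2 + γ ^ 2 ≠ 0 := by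
      intro h0
      have hb : β = 0 := by nlinarith [sq_nonneg β, sq_nonneg γ]
      have hc : γ = 0 := by nlinarith [sq_nonneg β, sq_nonneg γ]
      subst hb hc
      have : (α - 1) * (α + 1) = 0 := by linarith
      rcases mul_eq_zero.1 this with h | h
      · exact hne (by rw [hI', sub_eq_zero.1 h]; simp)
      · exact hne' (by rw [hI', eq_neg_of_add_eq_zero_left h]; simp)
    have hc : ⟪X, J Y⟫ = 0 := by
      apply (mul_eq_zero.1 (_ : (β ^ 2 + γ ^ 2) * ⟪X, J Y⟫ = 0)).resolve_left hpos
      linear_combination β * h3 - γ * h4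
    have hd : ⟪X, K Y⟫ = 0 := by
      apply (mul_eq_zero.1 (_ : (β ^ 2 + γ ^ 2) * ⟪X, K Y⟫ = 0)).resolve_left hpos
      linear_combination γ * h3 + β * h4
    intro u hu v hv
    simp only [Set.mem_insert_iff, Set.mem_singleton_iff] at hu hv
    rcases hu with rfl | rfl | rfl | rfl <;> rcases hv with rfl | rfl | rfl | rfl <;>
      simp [hIsk, hJsk, hKsk, hII, hJJ, hKK, hIJ, hJI, hIK, hKJ, hJK, hKI, h1, h2, hc, hd]
  · intro h u hu v hv
    have hu' : u ∈ ({X, I X, J X, K X} : Set V) := by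
      rcases hu with rfl | rfl <;> simp
    rcases hv with rfl | rfl
    · exact h u hu' _ (by simp)
    · rw [hI'Y]
      simp [inner_add_right, inner_smul_right, h u hu' (I Y) (by simp),
        h u hu' (J Y) (by simp), h u hu' (K Y) (by simp)]
end

section
/- Let I₁ and I₂ be compatible complex structures with I₂ ≠ I₁ and I₂ ≠ −I₁, and let U₁, U₂ be finite-dimensional subspaces of V with I₁(U₁) = U₁ and I₂(U₂) = U₂. If U₁ and U₂ are strictly orthogonal, then their quaternionifications U₁^ℍ and U₂^ℍ are strictly orthogonal, i.e. U₁ and U₂ are Hermitian orthogonal. -/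
open RealInnerProductSpace Module Submodule

set_option maxHeartbeats 4000000 in
/-- Strictly orthogonal complex subspaces by different (up to sign) compatible
complex structures are Hermitian orthogonal: their quaternionifications are
strictly orthogonal. -/
theorem stmt_16 {V : Type*} [NormedAddCommGroup V] [InnerProductSpace ℝ V]
    [FiniteDimensional ℝ V]
    (I J K : V →ₗ[ℝ] V)
    (hII : ∀ x, I (I x) = -x) (hJJ : ∀ x, J (J x) = -x) (hKK : ∀ x, K (K x) = -x)
    (hIJ : ∀ x, I (J x) = K x) (hJI : ∀ x, J (I x) = -K x)
    (hIsk : ∀ x y, ⟪I x, y⟫ = -⟪x, I y⟫)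
    (hJsk : ∀ x y, ⟪J x, y⟫ = -⟪x, J y⟫)
    (hKsk : ∀ x y, ⟪K x, y⟫ = -⟪x, K y⟫)
    (I₁ I₂ : V →ₗ[ℝ] V)
    (hI₁ : ∃ a b c : ℝ, a ^ 2 + b ^ 2 + c ^ 2 = 1 ∧ I₁ = a • I + b • J + c • K)
    (hI₂ : ∃ a b c : ℝ, a ^ 2 + b ^ 2 + c ^ 2 = 1 ∧ I₂ = a • I + b • J + c • K)
    (hne : I₂ ≠ I₁) (hne' : I₂ ≠ -I₁)
    (U₁ U₂ : Submodule ℝ V)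
    (hU₁ : U₁.map I₁ = U₁) (hU₂ : U₂.map I₂ = U₂)
    (horth : ∀ x ∈ U₁, ∀ y ∈ U₂, ⟪x, y⟫ = 0) :
    ∀ x ∈ (U₁ ⊔ U₁.map I ⊔ U₁.map J ⊔ U₁.map K),
      ∀ y ∈ (U₂ ⊔ U₂.map I ⊔ U₂.map J ⊔ U₂.map K), ⟪x, y⟫ = 0 := by
  obtain ⟨a, b, c, h1, rfl⟩ := hI₁
  obtain ⟨d, e, f, h2, rfl⟩ := hI₂
  have hIK : ∀ x, I (K x) = -J x := fun x => by rw [← hIJ, hII]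
  have hKJ : ∀ x, K (J x) = -I x := fun x => by rw [← hIJ, hJJ, map_neg]
  have hJK : ∀ x, J (K x) = I x := fun x => by rw [← hIJ x, hJI, hKJ, neg_neg]
  have hKI : ∀ x, K (I x) = J x := fun x => by rw [← hIJ, hJI, map_neg, hIK, neg_neg]
  have hD : (b * f - c * e) ^ 2 + (c * d - a * f) ^ 2 + (a * e - b * d) ^ 2 ≠ 0 := by
    intro h0
    have hd : (a * d + b * e + c * f) ^ 2 = 1 := by
      linear_combination (d ^ 2 + e ^ 2 + f ^ 2) * h1 + h2 - h0
    rcases mul_self_eq_one_iff.mp ((sq _).symm.trans hd) with h | h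
    · have hs : (d - a) ^ 2 + (e - b) ^ 2 + (f - c) ^ 2 = 0 := by
        linear_combination h1 + h2 - 2 * h
      have e1 : d = a := by nlinarith [sq_nonneg (d - a), sq_nonneg (e - b), sq_nonneg (f - c)]
      have e2 : e = b := by nlinarith [sq_nonneg (d - a), sq_nonneg (e - b), sq_nonneg (f - c)]
      have e3 : f = c := by nlinarith [sq_nonneg (d - a), sq_nonneg (e - b), sq_nonneg (f - c)]
      exact hne (by rw [e1, e2, e3])
    · have hs : (d + a) ^ 2 + (e + b) ^ 2 + (f + c) ^ 2 = 0 := by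
        linear_combination h1 + h2 + 2 * h
      have e1 : d = -a := by nlinarith [sq_nonneg (d + a), sq_nonneg (e + b), sq_nonneg (f + c)]
      have e2 : e = -b := by nlinarith [sq_nonneg (d + a), sq_nonneg (e + b), sq_nonneg (f + c)]
      have e3 : f = -c := by nlinarith [sq_nonneg (d + a), sq_nonneg (e + b), sq_nonneg (f + c)]
      exact hne' (by rw [e1, e2, e3]; module)
  have key : ∀ x ∈ U₁, ∀ y ∈ U₂, ⟪x, y⟫ = 0 ∧ ⟪x, I y⟫ = 0 ∧ ⟪x, J y⟫ = 0 ∧ ⟪x, K y⟫ = 0 := by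
    intro x hx y hy
    have hx' : (a • I + b • J + c • K) x ∈ U₁ := by
      have := Submodule.mem_map_of_mem (f := a • I + b • J + c • K) hx
      rwa [hU₁] at this
    have hy' : (d • I + e • J + f • K) y ∈ U₂ := by
      have := Submodule.mem_map_of_mem (f := d • I + e • J + f • K) hy
      rwa [hU₂] at this
    have g0 := horth x hx y hy
    have g1 := horth _ hx' y hy
    have g2 := horth x hx _ hy'
    have g3 := horth _ hx' _ hy'
    simp only [LinearMap.add_apply, LinearMap.smul_apply, inner_add_left, inner_add_right,
      real_inner_smul_left, real_inner_smul_right, hIsk, hJsk, hKsk, hII, hJJ, hKK, hIJ, hJI,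
      hIK, hKJ, hJK, hKI, inner_neg_right, g0] at g1 g2 g3
    generalize ⟪x, I y⟫ = p at *
    generalize ⟪x, J y⟫ = q at *
    generalize ⟪x, K y⟫ = r at *
    have k3 : (b * f - c * e) * p + (c * d - a * f) * q + (a * e - b * d) * r = 0 := by
      linear_combination -g3
    refine ⟨g0, ?_, ?_, ?_⟩ <;> apply (mul_eq_zero.mp _).resolve_left hD
    · linear_combination (b * f - c * e) * k3
        - (e * (a * e - b * d) - f * (c * d - a * f)) * g1
        + ((c * d - a * f) * c - (a * e - b * d) * b) * g2
    · linear_combination (c * d - a * f) * k3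
        - (f * (b * f - c * e) - d * (a * e - b * d)) * g1
        + ((a * e - b * d) * a - (b * f - c * e) * c) * g2
    · linear_combination (a * e - b * d) * k3
        - (d * (c * d - a * f) - e * (b * f - c * e)) * g1
        + ((b * f - c * e) * b - (c * d - a * f) * a) * g2
  intro x hx y hy
  simp only [Submodule.mem_sup, Submodule.mem_map] at hx hy
  obtain ⟨_, ⟨_, ⟨x0, h0, _, ⟨x1, h1', rfl⟩, rfl⟩, _, ⟨x2, h2', rfl⟩, rfl⟩, _, ⟨x3, h3', rfl⟩, rfl⟩ := hx
  obtain ⟨_, ⟨_, ⟨y0, k0, _, ⟨y1, k1, rfl⟩, rfl⟩, _, ⟨y2, k2, rfl⟩, rfl⟩, _, ⟨y3, k3, rfl⟩, rfl⟩ := hy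
  have kk : ∀ x ∈ U₁, ∀ y ∈ U₂, ⟪x, K y⟫ = 0 := fun x hx y hy => (key x hx y hy).2.2.2
  have kj : ∀ x ∈ U₁, ∀ y ∈ U₂, ⟪x, J y⟫ = 0 := fun x hx y hy => (key x hx y hy).2.2.1
  have ki : ∀ x ∈ U₁, ∀ y ∈ U₂, ⟪x, I y⟫ = 0 := fun x hx y hy => (key x hx y hy).2.1
  simp [inner_add_left, inner_add_right, hIsk, hJsk, hKsk, hII, hJJ, hKK, hIJ, hJI,
      hIK, hKJ, hJK, hKI, inner_neg_right, *]
end
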